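/- For every limit-periodic potential V : ℤ → ℝ and every ε > 0, there exists a limit-periodic potential Ṽ : ℤ → ℝ with ‖V − Ṽ‖_∞ < ε such that the discrete Schrödinger operator on ℓ²(ℤ) with potential Ṽ has pure point spectrum. -/

import Mathlib

open MeasureTheory

noncomputable section

/-- `ψ ∈ ℓ²(ℤ)` is an eigenfunction of the discrete Schrödinger operator with potential `V`
corresponding to the eigenvalue `E`: `ψ ≠ 0` and `ψ(n+1) + ψ(n-1) + V(n)ψ(n) = Eψ(n)`. -/
def IsEigenfunction (V : ℤ → ℝ) (E : ℝ) (ψ : lp (fun _ : ℤ => ℝ) 2) : Prop :=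
  ψ ≠ 0 ∧ ∀ n : ℤ, (ψ : ∀ _ : ℤ, ℝ) (n + 1) + (ψ : ∀ _ : ℤ, ℝ) (n - 1)
    + V n * (ψ : ∀ _ : ℤ, ℝ) n = E * (ψ : ∀ _ : ℤ, ℝ) n

/-- The discrete Schrödinger operator with potential `V` has pure point spectrum:
its eigenfunctions span a dense subspace of `ℓ²(ℤ)`. -/
def HasPurePointSpectrum (V : ℤ → ℝ) : Prop :=
  (Submodule.span ℝ
    {ψ : lp (fun _ : ℤ => ℝ) 2 | ∃ E : ℝ, IsEigenfunction V E ψ}).topologicalClosure = ⊤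

/-- A potential is periodic if it is invariant under translation by some positive period. -/
def IsPeriodicPotential (W : ℤ → ℝ) : Prop :=
  ∃ p : ℕ, 0 < p ∧ ∀ n : ℤ, W (n + p) = W n

/-- A potential is limit-periodic if it is a uniform limit of periodic potentials. -/
def IsLimitPeriodic (V : ℤ → ℝ) : Prop :=
  ∀ ε > (0:ℝ), ∃ W : ℤ → ℝ, IsPeriodicPotential W ∧ ∀ n : ℤ, |V n - W n| ≤ ε

/-- The Hilbert space `ℓ²(ℤ)`. -/
abbrev L2Z := lp (fun _ : ℤ => ℝ) 2

namespace L2Z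

open scoped InnerProductSpace

section Operators

/-! ### Operators on `ℓ²(ℤ)` -/

open Finset (sum_congr)

theorem ext {u v : L2Z} (h : ∀ n, u n = v n) : u = v := lp.ext (funext h)

@[simp] theorem add_apply (u v : L2Z) (n : ℤ) : (u + v) n = u n + v n := rfl
@[simp] theorem sub_apply (u v : L2Z) (n : ℤ) : (u - v) n = u n - v n := rfl
@[simp] theorem neg_apply (u : L2Z) (n : ℤ) : (-u) n = -u n := rfl
@[simp] theorem smul_apply (c : ℝ) (u : L2Z) (n : ℤ) : (c • u) n = c * u n := rfl
@[simp] theorem zero_apply (n : ℤ) : (0 : L2Z) n = 0 := rfl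

@[simp] theorem sum_apply {ι : Type*} (s : Finset ι) (f : ι → L2Z) (n : ℤ) :
    (∑ i ∈ s, f i) n = ∑ i ∈ s, f i n := by
  rw [lp.coeFn_sum]; simp

theorem hasSum_sq (u : L2Z) : HasSum (fun n => u n ^ 2) (‖u‖ ^ 2) := by
  have := lp.hasSum_norm (p := 2) (by norm_num) u
  simpa using this

theorem memlp_iff {f : ℤ → ℝ} : Memℓp f 2 ↔ Summable (fun n => f n ^ 2) := by
  rw [memℓp_gen_iff (by norm_num)]; simp

theorem hasSum_mul (u v : L2Z) : HasSum (fun n => u n * v n) ⟪u, v⟫_ℝ := by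
  have := lp.hasSum_inner (𝕜 := ℝ) u v
  simpa [mul_comm] using this

theorem norm_le_of_abs_le {u v : L2Z} (h : ∀ n, |u n| ≤ |v n|) : ‖u‖ ≤ ‖v‖ := by
  have := hasSum_le (fun n => sq_le_sq.mpr (h n)) (hasSum_sq u) (hasSum_sq v)
  exact le_of_sq_le_sq this (norm_nonneg _)

theorem abs_apply_le (u : L2Z) (n : ℤ) : |u n| ≤ ‖u‖ := lp.norm_apply_le_norm (by norm_num) u n

/-- The standard basis vector at `n`. -/
def single (n : ℤ) : L2Z := lp.single 2 n (1 : ℝ)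

theorem single_apply (n k : ℤ) : single n k = if k = n then 1 else 0 := by
  unfold single
  split_ifs with h
  · subst h; exact lp.single_apply_self ..
  · exact lp.single_apply_ne _ _ _ h

@[simp] theorem norm_single (n : ℤ) : ‖single n‖ = 1 := by
  unfold single; rw [lp.norm_single (by norm_num)]; simp

/-- Multiplication by a bounded function (and `0` for an unbounded one). -/
def mul (f : ℤ → ℝ) : L2Z →ₗ[ℝ] L2Z :=
  open Classical in
  if h : ∃ C, ∀ n, |f n| ≤ C then
    { toFun := fun u => ⟨fun n => f n * u n, by
        obtain ⟨C, hC⟩ := h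
        change Memℓp _ 2
        rw [memlp_iff]
        refine Summable.of_nonneg_of_le (fun n => sq_nonneg _) (fun n => ?_)
          ((hasSum_sq u).summable.mul_left (C ^ 2))
        rw [mul_pow]
        exact mul_le_mul_of_nonneg_right (sq_le_sq' (neg_le_of_abs_le (hC n))
          (le_of_abs_le (hC n))) (sq_nonneg _)⟩
      map_add' := fun u v => ext fun n => mul_add ..
      map_smul' := fun c u => ext fun n => mul_left_comm .. }
  else 0

theorem mul_apply {f : ℤ → ℝ} {C : ℝ} (h : ∀ n, |f n| ≤ C) (u : L2Z) (n : ℤ) :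
    mul f u n = f n * u n := by
  have : ∃ C, ∀ n, |f n| ≤ C := ⟨C, h⟩
  simp only [mul, dif_pos this]; rfl

/-- Translation by `k`. -/
def shift (k : ℤ) : L2Z →ₗ[ℝ] L2Z where
  toFun u := ⟨fun n => u (n + k), by
    change Memℓp _ 2
    rw [memlp_iff]
    exact ((Equiv.addRight k).summable_iff (f := fun n => u n ^ 2)).2 (hasSum_sq u).summable⟩
  map_add' _ _ := rfl
  map_smul' _ _ := rfl

@[simp] theorem shift_apply (k : ℤ) (u : L2Z) (n : ℤ) : shift k u n = u (n + k) := rfl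

@[simp] theorem norm_shift (k : ℤ) (u : L2Z) : ‖shift k u‖ = ‖u‖ := by
  have h1 := hasSum_sq (shift k u)
  have h2 := ((Equiv.addRight k).hasSum_iff (f := fun n => u n ^ 2)).2 (hasSum_sq u)
  have := h1.unique h2
  exact (sq_eq_sq₀ (norm_nonneg _) (norm_nonneg _)).1 this

theorem inner_shift (k : ℤ) (u v : L2Z) : ⟪shift k u, v⟫_ℝ = ⟪u, shift (-k) v⟫_ℝ := by
  have h1 := hasSum_mul u (shift (-k) v)
  have h2 := ((Equiv.addRight k).hasSum_iff (f := fun n => u n * shift (-k) v n)).2 h1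
  have h3 := hasSum_mul (shift k u) v
  refine h3.unique ?_
  convert h2 using 2
  simp

theorem inner_mul {f : ℤ → ℝ} {C : ℝ} (h : ∀ n, |f n| ≤ C) (u v : L2Z) :
    ⟪mul f u, v⟫_ℝ = ⟪u, mul f v⟫_ℝ := by
  refine (hasSum_mul _ _).unique ?_
  convert hasSum_mul u (mul f v) using 2 with n
  rw [mul_apply h, mul_apply h]; ring

theorem norm_mul_le {f : ℤ → ℝ} {C : ℝ} (h : ∀ n, |f n| ≤ C) (u : L2Z) :
    ‖mul f u‖ ≤ C * ‖u‖ := by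
  have hC : 0 ≤ C := (abs_nonneg _).trans (h 0)
  rw [← abs_of_nonneg hC, ← Real.norm_eq_abs, ← norm_smul]
  refine norm_le_of_abs_le fun n => ?_
  rw [mul_apply h, smul_apply, abs_mul, abs_mul, abs_of_nonneg hC]
  gcongr; exact h n

theorem indicator_bdd (I : Set ℤ) (n : ℤ) : |I.indicator (1 : ℤ → ℝ) n| ≤ 1 := by
  by_cases h : n ∈ I <;> simp [h]

/-- Restriction to the set `I`. -/
def proj (I : Set ℤ) : L2Z →ₗ[ℝ] L2Z := mul (I.indicator 1)

theorem proj_apply (I : Set ℤ) (u : L2Z) (n : ℤ) [Decidable (n ∈ I)] :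
    proj I u n = if n ∈ I then u n else 0 := by
  rw [proj, mul_apply (indicator_bdd I)]
  split_ifs with h <;> simp [h]

theorem proj_of_mem {I : Set ℤ} {n : ℤ} (h : n ∈ I) (u : L2Z) : proj I u n = u n := by
  classical rw [proj_apply, if_pos h]

theorem proj_of_notMem {I : Set ℤ} {n : ℤ} (h : n ∉ I) (u : L2Z) : proj I u n = 0 := by
  classical rw [proj_apply, if_neg h]

theorem norm_proj_le (I : Set ℤ) (u : L2Z) : ‖proj I u‖ ≤ ‖u‖ := by
  refine norm_le_of_abs_le fun n => ?_
  by_cases h : n ∈ I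
  · rw [proj_of_mem h]
  · rw [proj_of_notMem h]; simp

theorem inner_proj (I : Set ℤ) (u v : L2Z) : ⟪proj I u, v⟫_ℝ = ⟪u, proj I v⟫_ℝ :=
  inner_mul (indicator_bdd I) u v

/-- `u` vanishes off `I`. -/
def Supp (I : Set ℤ) (u : L2Z) : Prop := ∀ n, n ∉ I → u n = 0

theorem Supp.proj_eq {I : Set ℤ} {u : L2Z} (h : Supp I u) : proj I u = u := ext fun n => by
  by_cases hn : n ∈ I
  · rw [proj_of_mem hn]
  · rw [proj_of_notMem hn, h n hn]

theorem supp_proj (I : Set ℤ) (u : L2Z) : Supp I (proj I u) := fun _ hn => proj_of_notMem hn u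

theorem Supp.mono {I J : Set ℤ} {u : L2Z} (h : Supp I u) (hIJ : I ⊆ J) : Supp J u :=
  fun n hn => h n fun h' => hn (hIJ h')

theorem supp_zero (I : Set ℤ) : Supp I 0 := fun _ _ => rfl

theorem Supp.add {I : Set ℤ} {u v : L2Z} (hu : Supp I u) (hv : Supp I v) : Supp I (u + v) :=
  fun n hn => by simp [hu n hn, hv n hn]

theorem Supp.sub {I : Set ℤ} {u v : L2Z} (hu : Supp I u) (hv : Supp I v) : Supp I (u - v) :=
  fun n hn => by simp [hu n hn, hv n hn]

theorem Supp.smul {I : Set ℤ} {u : L2Z} (c : ℝ) (hu : Supp I u) : Supp I (c • u) :=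
  fun n hn => by simp [hu n hn]

theorem Supp.sum {I : Set ℤ} {ι : Type*} {s : Finset ι} {f : ι → L2Z}
    (h : ∀ i ∈ s, Supp I (f i)) : Supp I (∑ i ∈ s, f i) := fun n hn => by
  rw [sum_apply]; exact Finset.sum_eq_zero fun i hi => h i hi n hn

theorem supp_single {I : Set ℤ} {n : ℤ} (h : n ∈ I) : Supp I (single n) := fun k hk => by
  rw [single_apply, if_neg]; rintro rfl; exact hk h

/-- Bessel's inequality for restrictions to disjoint sets. -/
theorem sum_norm_sq_proj_le {ι : Type*} (s : Finset ι) (I : ι → Set ℤ)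
    (h : (s : Set ι).PairwiseDisjoint I) (u : L2Z) : ∑ i ∈ s, ‖proj (I i) u‖ ^ 2 ≤ ‖u‖ ^ 2 := by
  classical
  have h1 : HasSum (fun n => ∑ i ∈ s, proj (I i) u n ^ 2) (∑ i ∈ s, ‖proj (I i) u‖ ^ 2) :=
    hasSum_sum fun i _ => hasSum_sq _
  refine hasSum_le (fun n => ?_) h1 (hasSum_sq u)
  by_cases hn : ∃ i ∈ s, n ∈ I i
  · obtain ⟨i, hi, hni⟩ := hn
    rw [Finset.sum_eq_single_of_mem i hi, proj_of_mem hni]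
    intro j hj hji
    rw [proj_of_notMem, zero_pow two_ne_zero]
    exact fun hnj => Set.disjoint_left.1 (h hj hi hji) hnj hni
  · push Not at hn
    rw [Finset.sum_eq_zero]
    · positivity
    · intro i hi
      rw [proj_of_notMem (hn i hi), zero_pow two_ne_zero]

/-- The discrete Schrödinger operator with bounded potential `U`. -/
def ham (U : ℤ → ℝ) : L2Z →ₗ[ℝ] L2Z := shift 1 + shift (-1) + mul U

theorem ham_apply {U : ℤ → ℝ} {B : ℝ} (hU : ∀ n, |U n| ≤ B) (u : L2Z) (n : ℤ) :
    ham U u n = u (n + 1) + u (n - 1) + U n * u n := by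
  simp only [ham, LinearMap.add_apply, add_apply, shift_apply, mul_apply hU, sub_eq_add_neg]

theorem inner_ham {U : ℤ → ℝ} {B : ℝ} (hU : ∀ n, |U n| ≤ B) (u v : L2Z) :
    ⟪ham U u, v⟫_ℝ = ⟪u, ham U v⟫_ℝ := by
  simp only [ham, LinearMap.add_apply, inner_add_left, inner_add_right, inner_mul hU, inner_shift,
    neg_neg]
  ring

theorem norm_ham_le {U : ℤ → ℝ} {B : ℝ} (hU : ∀ n, |U n| ≤ B) (u : L2Z) :
    ‖ham U u‖ ≤ (B + 2) * ‖u‖ := by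
  have h1 : ‖ham U u‖ ≤ ‖shift 1 u‖ + ‖shift (-1) u‖ + ‖mul U u‖ := by
    refine (norm_add_le _ _).trans ?_
    gcongr; exact norm_add_le _ _
  have := norm_mul_le hU u
  simp only [norm_shift] at h1
  linarith

/-- The Schrödinger operator on the circle obtained from `Ico x y`. -/
def circ (x y : ℤ) (U : ℤ → ℝ) : L2Z →ₗ[ℝ] L2Z :=
  proj (Set.Ico x y) ∘ₗ
    (shift 1 + shift (-1) + (shift (y - x - 1) + shift (-(y - x - 1))) + mul U) ∘ₗ
    proj (Set.Ico x y)

theorem supp_circ (x y : ℤ) (U : ℤ → ℝ) (u : L2Z) : Supp (Set.Ico x y) (circ x y U u) :=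
  supp_proj _ _

theorem circ_apply {U : ℤ → ℝ} {B : ℝ} (hU : ∀ n, |U n| ≤ B) {x y : ℤ} {u : L2Z}
    (hu : Supp (Set.Ico x y) u) {n : ℤ} (hn : n ∈ Set.Ico x y) :
    circ x y U u n = u (n + 1) + u (n - 1) + (u (n + (y - x - 1)) + u (n - (y - x - 1)))
      + U n * u n := by
  simp only [circ, LinearMap.comp_apply, proj_of_mem hn, LinearMap.add_apply, add_apply,
    shift_apply, mul_apply hU, hu.proj_eq, sub_eq_add_neg]

theorem inner_circ {U : ℤ → ℝ} {B : ℝ} (hU : ∀ n, |U n| ≤ B) (x y : ℤ) (u v : L2Z) :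
    ⟪circ x y U u, v⟫_ℝ = ⟪u, circ x y U v⟫_ℝ := by
  simp only [circ, LinearMap.comp_apply]
  rw [inner_proj, ← inner_proj _ u]
  simp only [LinearMap.add_apply, inner_add_left, inner_add_right, inner_mul hU, inner_shift,
    neg_neg]
  ring

theorem ham_sub_circ {U : ℤ → ℝ} {B : ℝ} (hU : ∀ n, |U n| ≤ B) {x y : ℤ} (hxy : x < y) {u : L2Z}
    (hu : Supp (Set.Ico x y) u) :
    ham U u - circ x y U u = u x • (single (x - 1) - single (y - 1))
      + u (y - 1) • (single y - single x) := by
  refine ext fun n => ?_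
  have hout : ∀ k, k < x ∨ y ≤ k → u k = 0 := fun k hk => hu k fun h => by
    rcases hk with hk | hk
    · exact absurd h.1 (by omega)
    · exact absurd h.2 (by omega)
  simp only [sub_apply, add_apply, smul_apply, single_apply, ham_apply hU]
  by_cases hn : n ∈ Set.Ico x y
  · rw [circ_apply hU hu hn]
    obtain ⟨h1, h2⟩ := hn
    rw [if_neg (by omega : n ≠ x - 1), if_neg (by omega : n ≠ y)]
    by_cases hnx : n = x
    · subst hnx
      rw [show n + (y - n - 1) = y - 1 by ring]
      by_cases hny : n = y - 1
      · subst hny; simp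
      · rw [hout (n - (y - n - 1)) (by omega)]; simp [hny]
    · rw [hout (n + (y - x - 1)) (by omega)]
      by_cases hny : n = y - 1
      · subst hny
        rw [show y - 1 - (y - x - 1) = x by ring]; simp [hnx]
      · rw [hout (n - (y - x - 1)) (by omega)]; simp [hnx, hny]
  · rw [supp_circ x y U u n hn, hu n hn]
    simp only [Set.mem_Ico, not_and_or, not_le, not_lt] at hn
    rw [if_neg (by omega : n ≠ y - 1), if_neg (by omega : n ≠ x)]
    rcases hn with hn | hn
    · rw [hout (n - 1) (by omega), if_neg (by omega : n ≠ y)]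
      by_cases h : n = x - 1
      · subst h; simp
      · rw [hout (n + 1) (by omega)]; simp [h]
    · rw [hout (n + 1) (by omega), if_neg (by omega : n ≠ x - 1)]
      by_cases h : n = y
      · subst h; simp
      · rw [hout (n - 1) (by omega)]; simp [h]

theorem norm_ham_sub_circ_le {U : ℤ → ℝ} {B : ℝ} (hU : ∀ n, |U n| ≤ B) {x y : ℤ} (hxy : x < y)
    {u : L2Z} (hu : Supp (Set.Ico x y) u) :
    ‖ham U u - circ x y U u‖ ≤ 2 * |u x| + 2 * |u (y - 1)| := by
  rw [ham_sub_circ hU hxy hu]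
  have h : ∀ a b : ℤ, ‖single a - single b‖ ≤ 2 := fun a b =>
    (norm_sub_le _ _).trans (by norm_num)
  refine (norm_add_le _ _).trans ?_
  rw [norm_smul, norm_smul, Real.norm_eq_abs, Real.norm_eq_abs, mul_comm 2, mul_comm 2]
  gcongr <;> apply h

theorem norm_circ_sub_le {U : ℤ → ℝ} {B : ℝ} (hU : ∀ n, |U n| ≤ B) {x y : ℤ} (hxy : x < y)
    {u : L2Z} (hu : Supp (Set.Ico x y) u) (e : ℝ) :
    ‖circ x y U u - e • u‖ ≤ 5 * ‖ham U u - e • u‖ := by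
  have h1 := norm_ham_sub_circ_le hU hxy hu
  have hx : u x = (ham U u - e • u) (x - 1) := by
    simp only [sub_apply, smul_apply, ham_apply hU]
    rw [hu (x - 1) (by simp), hu (x - 1 - 1) (fun h => by have := h.1; omega)]
    simp
  have hy : u (y - 1) = (ham U u - e • u) y := by
    simp only [sub_apply, smul_apply, ham_apply hU]
    rw [hu y (by simp), hu (y + 1) (fun h => by have := h.2; omega)]
    simp
  have h2 := abs_apply_le (ham U u - e • u) (x - 1)
  have h3 := abs_apply_le (ham U u - e • u) y
  rw [← hx] at h2; rw [← hy] at h3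
  have h4 : circ x y U u - e • u = (ham U u - e • u) - (ham U u - circ x y U u) := by abel
  rw [h4]
  refine (norm_sub_le _ _).trans ?_
  linarith

theorem norm_circ_le {U : ℤ → ℝ} {B : ℝ} (hU : ∀ n, |U n| ≤ B) (x y : ℤ) (u : L2Z) :
    ‖circ x y U u‖ ≤ (B + 4) * ‖u‖ := by
  have hB : 0 ≤ B := (abs_nonneg _).trans (hU 0)
  refine (norm_proj_le _ _).trans ?_
  set v := proj (Set.Ico x y) u
  have hv : ‖v‖ ≤ ‖u‖ := norm_proj_le _ _
  have h1 := norm_mul_le hU v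
  have : ‖(shift 1 + shift (-1) + (shift (y - x - 1) + shift (-(y - x - 1))) + mul U) v‖
      ≤ ‖shift 1 v‖ + ‖shift (-1) v‖ + (‖shift (y - x - 1) v‖ + ‖shift (-(y - x - 1)) v‖)
        + ‖mul U v‖ := by
    simp only [LinearMap.add_apply]
    refine (norm_add_le _ _).trans ?_
    gcongr
    refine (norm_add_le _ _).trans ?_
    gcongr <;> exact norm_add_le _ _
  simp only [norm_shift] at this
  simp only [LinearMap.comp_apply]
  refine this.trans ?_
  nlinarith

end Operators

section Orthonormal

/-! ### Finite orthonormal families -/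

/-- The vectors in a finite set of (vector, energy) pairs are orthonormal. -/
def ON (cl : Finset (L2Z × ℝ)) : Prop :=
  (∀ a ∈ cl, ‖a.1‖ = 1) ∧ ∀ a ∈ cl, ∀ b ∈ cl, a ≠ b → ⟪a.1, b.1⟫_ℝ = 0

theorem ON.subset {cl cl' : Finset (L2Z × ℝ)} (h : ON cl) (hs : cl' ⊆ cl) : ON cl' :=
  ⟨fun a ha => h.1 a (hs ha), fun a ha b hb => h.2 a (hs ha) b (hs hb)⟩

/-- The orthogonal projection onto the span of an orthonormal set of vectors. -/
def spanProj (cl : Finset (L2Z × ℝ)) (f : L2Z) : L2Z := ∑ b ∈ cl, ⟪b.1, f⟫_ℝ • b.1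

theorem spanProj_add (cl : Finset (L2Z × ℝ)) (f g : L2Z) :
    spanProj cl (f + g) = spanProj cl f + spanProj cl g := by
  simp only [spanProj, inner_add_right, add_smul, Finset.sum_add_distrib]

namespace ON
variable {cl : Finset (L2Z × ℝ)}

theorem inner_sum (h : ON cl) (c : L2Z × ℝ → ℝ) {b : L2Z × ℝ} (hb : b ∈ cl) :
    ⟪b.1, ∑ a ∈ cl, c a • a.1⟫_ℝ = c b := by
  rw [_root_.inner_sum, Finset.sum_eq_single_of_mem b hb]
  · rw [inner_smul_right, real_inner_self_eq_norm_sq, h.1 b hb]; ring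
  · intro a ha hab
    rw [inner_smul_right, h.2 b hb a ha hab.symm, mul_zero]

theorem norm_sq_sum (h : ON cl) (c : L2Z × ℝ → ℝ) :
    ‖∑ a ∈ cl, c a • a.1‖ ^ 2 = ∑ a ∈ cl, c a ^ 2 := by
  rw [← real_inner_self_eq_norm_sq, sum_inner]
  refine Finset.sum_congr rfl fun a ha => ?_
  rw [inner_smul_left, h.inner_sum c ha]; simp [sq]

theorem inner_spanProj (h : ON cl) (f : L2Z) {b : L2Z × ℝ} (hb : b ∈ cl) :
    ⟪b.1, spanProj cl f⟫_ℝ = ⟪b.1, f⟫_ℝ :=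
  h.inner_sum (fun a => ⟪a.1, f⟫_ℝ) hb

theorem spanProj_idem (h : ON cl) (f : L2Z) : spanProj cl (spanProj cl f) = spanProj cl f :=
  Finset.sum_congr rfl fun _ hb => by rw [h.inner_spanProj f hb]

theorem inner_sub_spanProj (h : ON cl) (f : L2Z) {b : L2Z × ℝ} (hb : b ∈ cl) :
    ⟪b.1, f - spanProj cl f⟫_ℝ = 0 := by
  rw [inner_sub_right, h.inner_spanProj f hb, sub_self]

theorem inner_spanProj_sub (h : ON cl) (f g : L2Z) :
    ⟪spanProj cl g, f - spanProj cl f⟫_ℝ = 0 := by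
  rw [spanProj, sum_inner]
  refine Finset.sum_eq_zero fun b hb => ?_
  rw [inner_smul_left, h.inner_sub_spanProj f hb, mul_zero]

theorem norm_sq_spanProj (h : ON cl) (f : L2Z) :
    ‖spanProj cl f‖ ^ 2 = ∑ b ∈ cl, ⟪b.1, f⟫_ℝ ^ 2 := h.norm_sq_sum _

theorem norm_sq_add (h : ON cl) (f : L2Z) :
    ‖spanProj cl f‖ ^ 2 + ‖f - spanProj cl f‖ ^ 2 = ‖f‖ ^ 2 := by
  have := norm_add_sq_eq_norm_sq_add_norm_sq_of_inner_eq_zero _ _ (h.inner_spanProj_sub f f)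
  rw [add_sub_cancel] at this
  nlinarith

theorem norm_spanProj_le (h : ON cl) (f : L2Z) : ‖spanProj cl f‖ ≤ ‖f‖ :=
  le_of_sq_le_sq (by nlinarith [h.norm_sq_add f, sq_nonneg ‖f - spanProj cl f‖]) (norm_nonneg _)

theorem norm_sub_spanProj_le (h : ON cl) (f : L2Z) : ‖f - spanProj cl f‖ ≤ ‖f‖ :=
  le_of_sq_le_sq (by nlinarith [h.norm_sq_add f, sq_nonneg ‖spanProj cl f‖]) (norm_nonneg _)

theorem abs_inner_le (h : ON cl) (f : L2Z) {b : L2Z × ℝ} (hb : b ∈ cl) :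
    |⟪b.1, f⟫_ℝ| ≤ ‖f‖ := by
  simpa [h.1 b hb] using abs_real_inner_le_norm b.1 f

/-- Bessel's inequality. -/
theorem sum_inner_sq_le (h : ON cl) (f : L2Z) : ∑ b ∈ cl, ⟪b.1, f⟫_ℝ ^ 2 ≤ ‖f‖ ^ 2 := by
  rw [← h.norm_sq_spanProj]
  nlinarith [h.norm_sq_add f, sq_nonneg ‖f - spanProj cl f‖]

end ON

theorem Supp.spanProj {I : Set ℤ} {cl : Finset (L2Z × ℝ)} (h : ∀ a ∈ cl, Supp I a.1) (f : L2Z) :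
    Supp I (spanProj cl f) := Supp.sum fun a ha => (h a ha).smul _

/-- The subspace of vectors supported in `I`. -/
def suppSubmodule (I : Set ℤ) : Submodule ℝ L2Z where
  carrier := {u | Supp I u}
  add_mem' := Supp.add
  zero_mem' := supp_zero I
  smul_mem' c _ h := h.smul c

/-- The coordinates in `s` of vectors supported in the finite set `s`. -/
def suppCoord (s : Finset ℤ) : suppSubmodule (s : Set ℤ) →ₗ[ℝ] (s → ℝ) where
  toFun u i := (u : L2Z) i
  map_add' _ _ := rfl
  map_smul' _ _ := rfl

theorem suppCoord_injective (s : Finset ℤ) : Function.Injective (suppCoord s) := by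
  intro u v h
  refine Subtype.ext (ext fun n => ?_)
  by_cases hn : n ∈ s
  · exact congrFun h ⟨n, hn⟩
  · rw [u.2 n hn, v.2 n hn]

instance (s : Finset ℤ) : FiniteDimensional ℝ (suppSubmodule (s : Set ℤ)) :=
  FiniteDimensional.of_injective (suppCoord s) (suppCoord_injective s)

theorem finrank_suppSubmodule_le (s : Finset ℤ) :
    Module.finrank ℝ (suppSubmodule (s : Set ℤ)) ≤ s.card := by
  simpa using LinearMap.finrank_le_finrank_of_injective (suppCoord_injective s)

/-- `𝓑` is an orthonormal basis, of the vectors supported in `I`, of eigenvectors of `A`, each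
paired with its eigenvalue. -/
structure IsEigenbasis (I : Set ℤ) (A : L2Z →ₗ[ℝ] L2Z) (𝓑 : Finset (L2Z × ℝ)) : Prop where
  supp : ∀ a ∈ 𝓑, Supp I a.1
  eig : ∀ a ∈ 𝓑, A a.1 = a.2 • a.1
  on : ON 𝓑
  complete : ∀ w, Supp I w → spanProj 𝓑 w = w

theorem exists_isEigenbasis (s : Finset ℤ) (A : L2Z →ₗ[ℝ] L2Z)
    (hA : ∀ w, Supp (s : Set ℤ) w → Supp (s : Set ℤ) (A w))
    (hsymm : ∀ u v, ⟪A u, v⟫_ℝ = ⟪u, A v⟫_ℝ) :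
    ∃ 𝓑, IsEigenbasis s A 𝓑 ∧ 𝓑.card ≤ s.card := by
  classical
  let W := suppSubmodule (s : Set ℤ)
  let A' : W →ₗ[ℝ] W := A.restrict (fun w hw => hA w hw)
  have hA' : A'.IsSymmetric := fun u v => hsymm u v
  let b := hA'.eigenvectorBasis rfl
  have hb : Function.Injective fun i => (((b i : W) : L2Z), hA'.eigenvalues rfl i) := by
    intro i j hij
    have : b i = b j := Subtype.ext (Prod.ext_iff.1 hij).1
    exact b.toBasis.injective (by simpa using this)
  refine ⟨Finset.univ.image fun i => (((b i : W) : L2Z), hA'.eigenvalues rfl i),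
    ⟨?_, ?_, ⟨?_, ?_⟩, ?_⟩, ?_⟩
  · simp only [Finset.mem_image, Finset.mem_univ, true_and, forall_exists_index,
      forall_apply_eq_imp_iff]
    exact fun i => (b i).2
  · simp only [Finset.mem_image, Finset.mem_univ, true_and, forall_exists_index,
      forall_apply_eq_imp_iff]
    intro i
    have := hA'.apply_eigenvectorBasis rfl i
    exact congrArg Subtype.val this
  · simp only [Finset.mem_image, Finset.mem_univ, true_and, forall_exists_index,
      forall_apply_eq_imp_iff]
    exact fun i => b.orthonormal.1 i
  · simp only [Finset.mem_image, Finset.mem_univ, true_and, forall_exists_index,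
      forall_apply_eq_imp_iff]
    intro i j hij
    have : i ≠ j := fun h => hij (by rw [h])
    exact b.orthonormal.2 this
  · intro w hw
    rw [spanProj, Finset.sum_image fun i _ j _ h => hb h]
    have := b.sum_repr' ⟨w, hw⟩
    have := congrArg Subtype.val this
    simpa using this
  · refine Finset.card_image_le.trans ?_
    simpa using finrank_suppSubmodule_le s

namespace IsEigenbasis
variable {I : Set ℤ} {A : L2Z →ₗ[ℝ] L2Z} {𝓑 : Finset (L2Z × ℝ)}

theorem norm_sq (h : IsEigenbasis I A 𝓑) {w : L2Z} (hw : Supp I w) :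
    ‖w‖ ^ 2 = ∑ a ∈ 𝓑, ⟪a.1, w⟫_ℝ ^ 2 := by
  rw [← h.on.norm_sq_spanProj, h.complete w hw]

theorem apply_sub (h : IsEigenbasis I A 𝓑) {w : L2Z} (hw : Supp I w) (e : ℝ) :
    A w - e • w = ∑ a ∈ 𝓑, ((a.2 - e) * ⟪a.1, w⟫_ℝ) • a.1 := by
  conv_lhs => rw [← h.complete w hw]
  simp only [spanProj, map_sum, Finset.smul_sum, ← Finset.sum_sub_distrib, map_smul]
  refine Finset.sum_congr rfl fun a ha => ?_
  rw [h.eig a ha]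
  module

theorem norm_apply_sub_sq (h : IsEigenbasis I A 𝓑) {w : L2Z} (hw : Supp I w) (e : ℝ) :
    ‖A w - e • w‖ ^ 2 = ∑ a ∈ 𝓑, (a.2 - e) ^ 2 * ⟪a.1, w⟫_ℝ ^ 2 := by
  rw [h.apply_sub hw e, h.on.norm_sq_sum]
  exact Finset.sum_congr rfl fun a _ => mul_pow ..

theorem le_norm_apply_sub (h : IsEigenbasis I A 𝓑) {w : L2Z} (hw : Supp I w) {e g : ℝ}
    (hg : 0 ≤ g) (hgap : ∀ a ∈ 𝓑, ⟪a.1, w⟫_ℝ ≠ 0 → g ≤ |a.2 - e|) :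
    g * ‖w‖ ≤ ‖A w - e • w‖ := by
  refine le_of_sq_le_sq ?_ (norm_nonneg _)
  rw [h.norm_apply_sub_sq hw, mul_pow, h.norm_sq hw, Finset.mul_sum]
  refine Finset.sum_le_sum fun a ha => ?_
  by_cases h0 : ⟪a.1, w⟫_ℝ = 0
  · simp [h0]
  · rw [← sq_abs (a.2 - e)]
    exact mul_le_mul_of_nonneg_right (pow_le_pow_left₀ hg (hgap a ha h0) 2) (sq_nonneg _)

theorem abs_le (h : IsEigenbasis I A 𝓑) {C : ℝ} (hC : ∀ w, ‖A w‖ ≤ C * ‖w‖) {a : L2Z × ℝ}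
    (ha : a ∈ 𝓑) : |a.2| ≤ C := by
  have := hC a.1
  rwa [h.eig a ha, norm_smul, h.on.1 a ha, mul_one, mul_one] at this

theorem inner_spanProj_filter (h : IsEigenbasis I A 𝓑) (P : L2Z × ℝ → Prop) [DecidablePred P]
    (w : L2Z) {a : L2Z × ℝ} (ha : a ∈ 𝓑) :
    ⟪a.1, spanProj (𝓑.filter P) w⟫_ℝ = if P a then ⟪a.1, w⟫_ℝ else 0 := by
  split_ifs with hP
  · exact (h.on.subset (Finset.filter_subset _ _)).inner_spanProj w (Finset.mem_filter.2 ⟨ha, hP⟩)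
  · rw [spanProj, _root_.inner_sum]
    refine Finset.sum_eq_zero fun b hb => ?_
    rw [Finset.mem_filter] at hb
    rw [inner_smul_right, h.on.2 a ha b hb.1 (by rintro rfl; exact hP hb.2), mul_zero]

theorem sub_spanProj_filter (h : IsEigenbasis I A 𝓑) (P : L2Z × ℝ → Prop) [DecidablePred P]
    {w : L2Z} (hw : Supp I w) :
    w - spanProj (𝓑.filter P) w = spanProj (𝓑.filter fun a => ¬ P a) w := by
  conv_lhs => enter [1]; rw [← h.complete w hw]
  rw [sub_eq_iff_eq_add', spanProj, spanProj, spanProj, Finset.sum_filter_add_sum_filter_not]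

end IsEigenbasis

/-- The eigenbasis of the circle operator. -/
theorem exists_isEigenbasis_circ {U : ℤ → ℝ} {B : ℝ} (hU : ∀ n, |U n| ≤ B) (x y : ℤ) :
    ∃ 𝓑, IsEigenbasis (Set.Ico x y) (circ x y U) 𝓑 ∧ 𝓑.card ≤ (y - x).toNat ∧
      ∀ a ∈ 𝓑, |a.2| ≤ B + 4 := by
  obtain ⟨𝓑, h1, h2⟩ := exists_isEigenbasis (Finset.Ico x y) (circ x y U)
    (fun w _ => by rw [Finset.coe_Ico]; exact supp_circ x y U w) (inner_circ hU x y)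
  rw [Finset.coe_Ico] at h1
  exact ⟨𝓑, h1, by simpa using h2, fun a ha => h1.abs_le (norm_circ_le hU x y) ha⟩

/-- The eigenbasis of the Dirichlet operator. -/
theorem exists_isEigenbasis_proj_ham {U : ℤ → ℝ} {B : ℝ} (hU : ∀ n, |U n| ≤ B) (x y : ℤ) :
    ∃ 𝓑, IsEigenbasis (Set.Ico x y)
      (proj (Set.Ico x y) ∘ₗ ham U ∘ₗ proj (Set.Ico x y)) 𝓑 ∧ 𝓑.card ≤ (y - x).toNat := by
  obtain ⟨𝓑, h1, h2⟩ := exists_isEigenbasis (Finset.Ico x y)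
    (proj (Set.Ico x y) ∘ₗ ham U ∘ₗ proj (Set.Ico x y))
    (fun w _ => by rw [Finset.coe_Ico]; exact supp_proj _ _) (fun u v => by
      simp only [LinearMap.comp_apply]
      rw [inner_proj, inner_ham hU, inner_proj])
  rw [Finset.coe_Ico] at h1
  exact ⟨𝓑, h1, by simpa using h2⟩

end Orthonormal

section Gaps

/-! ### Gaps -/

/-- `H - E` is bounded below by `ρ` on the vectors supported in `S`. -/
def GapOn (U : ℤ → ℝ) (S : Set ℤ) (E ρ : ℝ) : Prop :=
  ∀ w, Supp S w → ρ * ‖w‖ ≤ ‖ham U w - E • w‖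

/-- `H - E` is bounded below by `ρ` on the finitely supported vectors. -/
def Gap (U : ℤ → ℝ) (E ρ : ℝ) : Prop := ∀ a b : ℤ, GapOn U (Set.Ico a b) E ρ

theorem GapOn.mono {U : ℤ → ℝ} {S S' : Set ℤ} {E ρ ρ' : ℝ} (h : GapOn U S E ρ) (hS : S' ⊆ S)
    (hρ : ρ' ≤ ρ) : GapOn U S' E ρ' := fun w hw =>
  (mul_le_mul_of_nonneg_right hρ (norm_nonneg w)).trans (h w (hw.mono hS))

theorem Gap.mono {U : ℤ → ℝ} {E ρ ρ' : ℝ} (h : Gap U E ρ) (hρ : ρ' ≤ ρ) : Gap U E ρ' :=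
  fun a b => (h a b).mono subset_rfl hρ

theorem ham_congr {U U' : ℤ → ℝ} {B B' : ℝ} (hU : ∀ n, |U n| ≤ B) (hU' : ∀ n, |U' n| ≤ B')
    {S : Set ℤ} (h : ∀ n ∈ S, U n = U' n) {w : L2Z} (hw : Supp S w) : ham U w = ham U' w :=
  ext fun n => by
    rw [ham_apply hU, ham_apply hU']
    by_cases hn : n ∈ S
    · rw [h n hn]
    · rw [hw n hn]; simp

theorem GapOn.congr {U U' : ℤ → ℝ} {B B' : ℝ} (hU : ∀ n, |U n| ≤ B) (hU' : ∀ n, |U' n| ≤ B')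
    {S : Set ℤ} (h : ∀ n ∈ S, U n = U' n) {E ρ : ℝ} (hg : GapOn U S E ρ) : GapOn U' S E ρ :=
  fun w hw => by rw [← ham_congr hU hU' h hw]; exact hg w hw

theorem GapOn.add_const {U : ℤ → ℝ} {B : ℝ} (hU : ∀ n, |U n| ≤ B) {S : Set ℤ} {E ρ μ : ℝ}
    (h : GapOn U S (E - μ) ρ) : GapOn (fun n => U n + μ) S E ρ := fun w hw => by
  have hU' : ∀ n, |U n + μ| ≤ B + |μ| := fun n => (abs_add_le _ _).trans (by gcongr; exact hU n)
  have : ham (fun n => U n + μ) w - E • w = ham U w - (E - μ) • w := ext fun n => by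
    simp only [sub_apply, smul_apply, ham_apply hU, ham_apply hU']; ring
  rw [this]; exact h w hw

theorem ham_shift {U : ℤ → ℝ} {B : ℝ} (hU : ∀ n, |U n| ≤ B) {k : ℤ} (hk : ∀ n, U (n + k) = U n)
    (w : L2Z) : ham U (shift k w) = shift k (ham U w) := ext fun n => by
  simp only [shift_apply, ham_apply hU, hk]
  rw [show n + k + 1 = n + 1 + k by ring, show n + k - 1 = n - 1 + k by ring]

theorem norm_proj_shift (I : Set ℤ) (k : ℤ) (u : L2Z) :
    ‖proj I (shift k u)‖ = ‖proj {n | n - k ∈ I} u‖ := by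
  have : proj I (shift k u) = shift k (proj {n | n - k ∈ I} u) := ext fun n => by
    classical
    rw [shift_apply, proj_apply, proj_apply]; simp
  rw [this, norm_shift]

theorem norm_sq_le_sum_proj {ι : Type*} (s : Finset ι) (I : ι → Set ℤ) (u : L2Z)
    (h : ∀ n, u n ≠ 0 → ∃ i ∈ s, n ∈ I i) : ‖u‖ ^ 2 ≤ ∑ i ∈ s, ‖proj (I i) u‖ ^ 2 := by
  have h1 : HasSum (fun n => ∑ i ∈ s, proj (I i) u n ^ 2) (∑ i ∈ s, ‖proj (I i) u‖ ^ 2) :=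
    hasSum_sum fun i _ => hasSum_sq _
  refine hasSum_le (fun n => ?_) (hasSum_sq u) h1
  by_cases hn : u n = 0
  · rw [hn, zero_pow two_ne_zero]; positivity
  · obtain ⟨i, hi, hni⟩ := h n hn
    rw [← proj_of_mem hni u]
    exact Finset.single_le_sum (f := fun i => proj (I i) u n ^ 2) (fun _ _ => sq_nonneg _) hi

theorem exp_sub_one_le {κ : ℝ} (h0 : 0 ≤ κ) (h1 : κ ≤ 1 / 8) : Real.exp κ ≤ 1 + 2 * κ := by
  have := Real.abs_exp_sub_one_le (x := κ) (by rw [abs_of_nonneg h0]; linarith)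
  rw [abs_of_nonneg h0] at this
  linarith [le_abs_self (Real.exp κ - 1)]

theorem abs_sub_le_of_ratio {a b e : ℝ} (ha : 0 ≤ a) (he : 1 ≤ e) (h1 : a ≤ e * b)
    (h2 : b ≤ e * a) : |a - b| ≤ (e - 1) * a := by
  rw [abs_le]
  constructor
  · linarith
  · have : e * (b - (2 - e) * a) ≥ 0 := by nlinarith [sq_nonneg (e - 1), mul_nonneg ha (sq_nonneg (e - 1))]
    have := nonneg_of_mul_nonneg_right this (by linarith)
    linarith

set_option maxHeartbeats 1000000 in
/-- Exponential decay into a gap: if `H - E` is bounded below near `z`, then `w` is small at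
`z` and `z - 1` up to a multiple of `(H - E) w`. -/
theorem GapOn.apply_le {U : ℤ → ℝ} {B : ℝ} (hU : ∀ n, |U n| ≤ B) {z l : ℤ} (hl : 1 ≤ l) {E ρ : ℝ}
    (hρ : 0 < ρ) (hρ1 : ρ ≤ 1) (hg : GapOn U (Set.Ioo (z - l) (z + l)) E ρ) (w : L2Z) {n : ℤ}
    (hn : n = z ∨ n = z - 1) :
    |w n| ≤ 4 / ρ * ‖proj (Set.Icc (z - l) (z + l)) (ham U w - E • w)‖
      + 4 * Real.exp (-(ρ * l / 8)) * ‖proj (Set.Icc (z - l) (z + l)) w‖ := by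
  set κ := ρ / 8 with hκ
  have hκ0 : 0 < κ := by positivity
  have hκ1 : κ ≤ 1 / 8 := by linarith
  set ε := Real.exp (-(ρ * l / 8)) with hε
  set J := Set.Icc (z - l) (z + l)
  set f := ham U w - E • w with hf
  set w' := proj J w
  have hε0 : 0 < ε := Real.exp_pos _
  set M : ℤ → ℝ := fun n => max ε (Real.exp (-(κ * |((n - z : ℤ) : ℝ)|))) with hM
  have hM0 : ∀ n, 0 < M n := fun n => lt_max_of_lt_left hε0
  have hM1 : ∀ n, M n ≤ 1 := fun n => max_le
    (Real.exp_le_one_iff.2 (by have : (1:ℝ) ≤ l := by exact_mod_cast hl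
                               simp; positivity))
    (Real.exp_le_one_iff.2 (by simp; positivity))
  have hMε : ∀ n, ε ≤ M n := fun n => le_max_left _ _
  have he1 : 1 ≤ Real.exp κ := Real.one_le_exp hκ0.le
  have hratio : ∀ m n : ℤ, |m - n| ≤ 1 → M m ≤ Real.exp κ * M n := by
    intro m n hmn
    refine max_le ?_ ?_
    · calc ε ≤ 1 * M n := by rw [one_mul]; exact hMε n
        _ ≤ _ := by gcongr
    · calc Real.exp (-(κ * |((m - z : ℤ) : ℝ)|))
          ≤ Real.exp (κ + -(κ * |((n - z : ℤ) : ℝ)|)) := by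
            apply Real.exp_le_exp.2
            have h3 : |n - z| ≤ |m - z| + 1 := by
              have := abs_sub_abs_le_abs_sub (n - z) (m - z)
              rw [abs_sub_comm] at hmn
              rw [show n - z - (m - z) = n - m by ring] at this
              linarith
            have h4 : |((n - z : ℤ) : ℝ)| ≤ |((m - z : ℤ) : ℝ)| + 1 := by exact_mod_cast h3
            nlinarith
        _ = Real.exp κ * Real.exp (-(κ * |((n - z : ℤ) : ℝ)|)) := Real.exp_add _ _
        _ ≤ _ := by gcongr; exact le_max_right _ _
  have hdiff : ∀ m n : ℤ, |m - n| ≤ 1 → |M m - M n| ≤ (Real.exp κ - 1) * M m := fun m n hmn =>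
    abs_sub_le_of_ratio (hM0 m).le he1 (hratio m n hmn) (hratio n m (by rwa [abs_sub_comm]))
  have hMout : ∀ n, n ∉ Set.Ioo (z - l) (z + l) → M n = ε := by
    intro n hn
    refine max_eq_left (Real.exp_le_exp.2 ?_)
    have h3 : l ≤ |n - z| := by
      simp only [Set.mem_Ioo, not_and_or, not_lt] at hn
      rcases hn with hn | hn
      · rw [le_abs]; right; linarith
      · rw [le_abs]; left; linarith
    have h4 : (l : ℝ) ≤ |((n - z : ℤ) : ℝ)| := by exact_mod_cast h3
    rw [hκ]; nlinarith
  set η : ℤ → ℝ := fun n => M n - ε with hη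
  have hη0 : ∀ n, 0 ≤ η n := fun n => sub_nonneg.2 (hMε n)
  have hη1 : ∀ n, |η n| ≤ 1 := fun n => by
    rw [abs_of_nonneg (hη0 n)]; have := hM1 n; simp only [hη]; linarith
  have hηout : ∀ n, n ∉ Set.Ioo (z - l) (z + l) → η n = 0 := fun n hn => by
    simp only [hη, hMout n hn, sub_self]
  have hηJ : ∀ n, n ∉ J → η n = 0 := fun n hn =>
    hηout n fun h => hn ⟨h.1.le, h.2.le⟩
  set v := mul η w with hv
  have hvs : Supp (Set.Ioo (z - l) (z + l)) v := fun n hn => by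
    rw [hv, mul_apply hη1, hηout n hn, zero_mul]
  have hvw' : mul η w' = v := ext fun n => by
    rw [hv, mul_apply hη1, mul_apply hη1]
    by_cases hnJ : n ∈ J
    · rw [proj_of_mem hnJ]
    · rw [hηJ n hnJ]; simp
  have hd1 : ∀ k : ℤ, |k| = 1 → ∀ n, |η n - η (n + k)| ≤ 1 := fun k _ n => by
    have h1 := hη0 n; have h2 := hη0 (n + k)
    have h3 := (abs_le.1 (hη1 n)).2; have h4 := (abs_le.1 (hη1 (n + k))).2
    rw [abs_le]; constructor <;> linarith
  have hdnorm : ∀ k : ℤ, |k| = 1 →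
      ‖mul (fun n => η n - η (n + k)) w'‖ ≤ ρ / 4 * (‖v‖ + ε * ‖w'‖) := by
    intro k hk
    have h1 : ‖mul (fun n => η n - η (n + k)) w'‖
        ≤ ‖(Real.exp κ - 1) • (mul η w' + ε • w')‖ := by
      refine norm_le_of_abs_le fun n => ?_
      rw [mul_apply (hd1 k hk), smul_apply, add_apply, mul_apply hη1, smul_apply, ← add_mul,
        ← mul_assoc, abs_mul, abs_mul]
      refine mul_le_mul_of_nonneg_right ?_ (abs_nonneg _)
      have := hdiff n (n + k) (by simp [hk])
      have hMn : η n + ε = M n := sub_add_cancel _ _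
      rw [hMn, abs_of_nonneg (mul_nonneg (sub_nonneg.2 he1) (hM0 n).le)]
      simpa only [hη, sub_sub_sub_cancel_right] using this
    refine h1.trans ?_
    rw [norm_smul, hvw', Real.norm_of_nonneg (by linarith)]
    have h2 : ‖v + ε • w'‖ ≤ ‖v‖ + ε * ‖w'‖ := by
      refine (norm_add_le _ _).trans ?_
      rw [norm_smul, Real.norm_of_nonneg hε0.le]
    have h3 := exp_sub_one_le hκ0.le hκ1
    have h4 : Real.exp κ - 1 ≤ ρ / 4 := by rw [hκ] at h3 ⊢; linarith
    gcongr
  have hcomm : ham U v - E • v = mul η (proj J f) - shift 1 (mul (fun n => η (n + -1) - η n) w')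
      - shift (-1) (mul (fun n => η (n + 1) - η n) w') := by
    refine ext fun n => ?_
    have hb1 : ∀ n, |η (n + -1) - η n| ≤ 1 := fun n => by
      rw [abs_sub_comm]; exact hd1 (-1) (by norm_num) n
    have hb2 : ∀ n, |η (n + 1) - η n| ≤ 1 := fun n => by
      rw [abs_sub_comm]; exact hd1 1 (by norm_num) n
    have e1 : (η n - η (n + 1)) * w' (n + 1) = (η n - η (n + 1)) * w (n + 1) := by
      by_cases hJ : n + 1 ∈ J
      · rw [proj_of_mem hJ]
      · rw [hηJ _ hJ, hηout n]
        · simp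
        · intro h; exact hJ ⟨by have := h.1; omega, by have := h.2; omega⟩
    have e2 : (η n - η (n - 1)) * w' (n - 1) = (η n - η (n - 1)) * w (n - 1) := by
      by_cases hJ : n - 1 ∈ J
      · rw [proj_of_mem hJ]
      · rw [hηJ _ hJ, hηout n]
        · simp
        · intro h; exact hJ ⟨by have := h.1; omega, by have := h.2; omega⟩
    have e3 : η n * proj J f n = η n * f n := by
      by_cases hJ : n ∈ J
      · rw [proj_of_mem hJ]
      · rw [hηJ _ hJ]; simp
    simp only [sub_apply, smul_apply, shift_apply, mul_apply hη1, mul_apply hb1, mul_apply hb2,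
      ham_apply hU, hv, e3]
    rw [show n + 1 + -1 = n by ring, show n + -1 + 1 = n by ring, show n + -1 = n - 1 by ring,
      e1, e2, hf]
    simp only [sub_apply, smul_apply, ham_apply hU]
    ring
  have hmain := hg v hvs
  rw [hcomm] at hmain
  have hneg : ∀ k : ℤ, ‖mul (fun n => η (n + k) - η n) w'‖ = ‖mul (fun n => η n - η (n + k)) w'‖ := by
    intro k
    have hb : ∀ n, |η n - η (n + k)| ≤ 1 := fun n => by
      have h1 := hη0 n; have h2 := hη0 (n + k)
      have h3 := (abs_le.1 (hη1 n)).2; have h4 := (abs_le.1 (hη1 (n + k))).2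
      rw [abs_le]; constructor <;> linarith
    rw [← norm_neg]
    congr 1
    refine ext fun n => ?_
    rw [neg_apply, mul_apply hb, mul_apply (fun n => by rw [abs_sub_comm]; exact hb n)]
    ring
  have hfin : ρ * ‖v‖ ≤ ‖proj J f‖ + ρ / 2 * (‖v‖ + ε * ‖w'‖) := by
    have t1 := norm_sub_le (mul η (proj J f) - shift 1 (mul (fun n => η (n + -1) - η n) w'))
      (shift (-1) (mul (fun n => η (n + 1) - η n) w'))
    have t2 := norm_sub_le (mul η (proj J f)) (shift 1 (mul (fun n => η (n + -1) - η n) w'))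
    rw [norm_shift, hneg] at t1 t2
    have t3 := hdnorm 1 (by norm_num)
    have t4 := hdnorm (-1) (by norm_num)
    have t5 := norm_mul_le hη1 (proj J f)
    linarith
  have hvn : ‖v‖ ≤ 2 / ρ * ‖proj J f‖ + ε * ‖w'‖ := by
    rw [← mul_le_mul_iff_of_pos_left (by positivity : 0 < ρ / 2)]
    have : ρ / 2 * (2 / ρ * ‖proj J f‖ + ε * ‖w'‖) = ‖proj J f‖ + ρ / 2 * (ε * ‖w'‖) := by
      field_simp
    rw [this]; linarith
  have hnJ : n ∈ J := by rcases hn with rfl | rfl <;> constructor <;> omega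
  have hMn : 1 / 2 ≤ M n := by
    refine le_trans ?_ (le_max_right _ _)
    have h1 : |((n - z : ℤ) : ℝ)| ≤ 1 := by
      rcases hn with rfl | rfl <;> simp
    have h2 : -(1 / 8) ≤ -(κ * |((n - z : ℤ) : ℝ)|) := by nlinarith
    have := Real.add_one_le_exp (-(κ * |((n - z : ℤ) : ℝ)|))
    linarith
  have hwn : w n = w' n := (proj_of_mem hnJ w).symm
  have h1 : M n * |w n| ≤ ‖v‖ + ε * ‖w'‖ := by
    have a1 := abs_apply_le v n
    have a2 := abs_apply_le w' n
    rw [hv, mul_apply hη1, abs_mul, abs_of_nonneg (hη0 n)] at a1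
    rw [← hwn] at a2
    have : M n = η n + ε := by simp [hη]
    rw [this]; nlinarith
  have h2 : 1 / 2 * |w n| ≤ M n * |w n| := by gcongr
  have h3 : 4 / ρ * ‖proj J f‖ = 2 * (2 / ρ * ‖proj J f‖) := by ring
  rw [h3]; linarith

theorem sq_add_three_le (a b c : ℝ) : (a + b + c) ^ 2 ≤ 3 * (a ^ 2 + b ^ 2 + c ^ 2) := by
  nlinarith [sq_nonneg (a - b), sq_nonneg (b - c), sq_nonneg (a - c)]

set_option maxHeartbeats 1000000 in
/-- A periodic potential has a gap at `E` if `E` is away from the Dirichlet spectrum of a period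
cell whose endpoints lie deep inside a region where `E` is in a gap. -/
theorem gap_of_cut {V : ℤ → ℝ} {B : ℝ} (hV : ∀ n, |V n| ≤ B) {N : ℤ} (hper : ∀ n, V (n + N) = V n)
    {z l : ℤ} (hl : 1 ≤ l) (hlN : 2 * l + 1 ≤ N) {E ρ d : ℝ} (hρ : 0 < ρ) (hρ1 : ρ ≤ 1) (hd : 0 < d)
    (hg : GapOn V (Set.Ioo (z - l) (z + l)) E ρ) {𝓑 : Finset (L2Z × ℝ)}
    (h𝓑 : IsEigenbasis (Set.Ico z (z + N))
      (proj (Set.Ico z (z + N)) ∘ₗ ham V ∘ₗ proj (Set.Ico z (z + N))) 𝓑)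
    (hdist : ∀ a ∈ 𝓑, d ≤ |a.2 - E|) (hβ : 24 * (4 * Real.exp (-(ρ * l / 8))) ^ 2 ≤ d ^ 2) :
    Gap V E (d * ρ / 20) := by
  intro x y w hw
  set β := 4 * Real.exp (-(ρ * l / 8))
  set C := Set.Ico z (z + N)
  set J := Set.Icc (z - l) (z + l)
  have hperm : ∀ m n : ℤ, V (n + m * N) = V n := by
    intro m
    induction m using Int.induction_on with
    | zero => simp
    | succ k ih => intro n; rw [add_mul, one_mul, ← add_assoc, hper, ih]
    | pred k ih =>
      intro n
      rw [← hper (n + (-(k : ℤ) - 1) * N), ← ih n]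
      congr 1; ring
  have hcell : ∀ u : L2Z, d ^ 2 * ‖proj C u‖ ^ 2
      ≤ 3 * (‖proj C (ham V u - E • u)‖ ^ 2 + |u (z - 1)| ^ 2 + |u (z + N)| ^ 2) := by
    intro u
    have h1 := h𝓑.le_norm_apply_sub (supp_proj C u) hd.le fun a ha _ => hdist a ha
    have h2 : (proj C ∘ₗ ham V ∘ₗ proj C) (proj C u) - E • proj C u
        = proj C (ham V u - E • u) - u (z - 1) • single z - u (z + N) • single (z + N - 1) := by
      have hpp : proj C (proj C u) = proj C u := (supp_proj C u).proj_eq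
      refine ext fun n => ?_
      simp only [LinearMap.comp_apply, hpp, sub_apply, smul_apply, single_apply]
      by_cases hn : n ∈ C
      · rw [proj_of_mem hn, proj_of_mem hn, proj_of_mem hn, ham_apply hV, sub_apply, ham_apply hV,
          proj_of_mem hn, smul_apply]
        have hn' := hn
        obtain ⟨hn1, hn2⟩ := hn'
        have e1 : proj C u (n + 1) = u (n + 1) - (u (z + N) * if n = z + N - 1 then 1 else 0) := by
          split_ifs with h
          · subst h
            rw [proj_of_notMem (by simp [C])]; simp
          · rw [proj_of_mem (show _ ∈ C from ⟨by omega, by omega⟩)]; simp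
        have e2 : proj C u (n - 1) = u (n - 1) - (u (z - 1) * if n = z then 1 else 0) := by
          split_ifs with h
          · subst h
            rw [proj_of_notMem (by simp [C])]; simp
          · rw [proj_of_mem (show _ ∈ C from ⟨by omega, by omega⟩)]; simp
        rw [e1, e2]; ring
      · rw [proj_of_notMem hn, proj_of_notMem hn, proj_of_notMem hn,
          if_neg (by rintro rfl; exact hn ⟨le_rfl, by omega⟩),
          if_neg (by rintro rfl; exact hn ⟨by omega, by omega⟩)]
        simp
    have h3 : d * ‖proj C u‖ ≤ ‖proj C (ham V u - E • u)‖ + |u (z - 1)| + |u (z + N)| := by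
      refine h1.trans ?_
      rw [h2]
      refine (norm_sub_le _ _).trans (add_le_add ((norm_sub_le _ _).trans ?_) ?_)
      · rw [norm_smul, norm_single, mul_one, Real.norm_eq_abs]
      · rw [norm_smul, norm_single, mul_one, Real.norm_eq_abs]
    rw [← mul_pow]
    exact (pow_le_pow_left₀ (by positivity) h3 2).trans (sq_add_three_le _ _ _)
  have hbar : ∀ u : L2Z, ∀ n, (n = z ∨ n = z - 1) →
      |u n| ^ 2 ≤ 32 / ρ ^ 2 * ‖proj J (ham V u - E • u)‖ ^ 2 + 2 * β ^ 2 * ‖proj J u‖ ^ 2 := by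
    intro u n hn
    have h1 := hg.apply_le hV hl hρ hρ1 u hn
    have h2 := pow_le_pow_left₀ (abs_nonneg _) h1 2
    refine h2.trans ((add_sq_le).trans (le_of_eq ?_))
    simp only [β]; field_simp; ring
  set f := ham V w - E • w with hf
  have hfs : ∀ m : ℤ, ham V (shift (m * N) w) - E • shift (m * N) w = shift (m * N) f := by
    intro m
    rw [ham_shift hV (hperm m), hf, map_sub, map_smul]
  set R := |x - z| + |y - z| + 1
  set s := Finset.Icc (-R) R
  have hN : 0 < N := by omega
  have hdisjC : ∀ k : ℤ, ((s : Finset ℤ) : Set ℤ).PairwiseDisjoint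
      fun m => {n | n - (m + k) * N ∈ C} := by
    intro k m _ m' _ hmm
    refine Set.disjoint_left.2 fun n h1 h2 => hmm ?_
    simp only [C, Set.mem_ofPred_eq, Set.mem_Ico] at h1 h2
    have : (m - m') * N < 1 * N := by linarith [h1.1, h2.2]
    have := lt_of_mul_lt_mul_right this hN.le
    have : (m' - m) * N < 1 * N := by linarith [h1.2, h2.1]
    have := lt_of_mul_lt_mul_right this hN.le
    omega
  have hdisjJ : ∀ k : ℤ, ((s : Finset ℤ) : Set ℤ).PairwiseDisjoint
      fun m => {n | n - (m + k) * N ∈ J} := by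
    intro k m _ m' _ hmm
    refine Set.disjoint_left.2 fun n h1 h2 => hmm ?_
    simp only [J, Set.mem_ofPred_eq, Set.mem_Icc] at h1 h2
    have : (m - m') * N < 1 * N := by linarith [h1.1, h2.2]
    have := lt_of_mul_lt_mul_right this hN.le
    have : (m' - m) * N < 1 * N := by linarith [h1.2, h2.1]
    have := lt_of_mul_lt_mul_right this hN.le
    omega
  have hcov : ‖w‖ ^ 2 ≤ ∑ m ∈ s, ‖proj {n | n - m * N ∈ C} w‖ ^ 2 := by
    refine norm_sq_le_sum_proj s _ w fun n hn => ?_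
    have hnI : n ∈ Set.Ico x y := by
      by_contra h; exact hn (hw n h)
    have hk1 := Int.emod_add_mul_ediv (n - z) N
    have hk2 := Int.emod_nonneg (n - z) hN.ne'
    have hk3 := Int.emod_lt_of_pos (n - z) hN
    set k := (n - z) / N
    refine ⟨k, ?_, ?_⟩
    · have hb : |n - z| ≤ |x - z| + |y - z| := by
        have := hnI.1; have := hnI.2
        rcases abs_cases (n - z) with h | h <;> rcases abs_cases (x - z) with h' | h' <;>
          rcases abs_cases (y - z) with h'' | h'' <;> omega
      have h4 := abs_le.1 hb
      rw [Finset.mem_Icc]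
      constructor
      · by_contra hc
        push Not at hc
        have : N * k ≤ N * (-R) := by gcongr
        nlinarith
      · by_contra hc
        push Not at hc
        have : N * R ≤ N * k := by gcongr
        nlinarith
    · simp only [C, Set.mem_ofPred_eq, Set.mem_Ico]
      constructor <;> linarith
  have hone : ∀ m : ℤ, d ^ 2 * ‖proj {n | n - m * N ∈ C} w‖ ^ 2 ≤
      3 * ‖proj {n | n - (m + 0) * N ∈ C} f‖ ^ 2
      + 3 * (32 / ρ ^ 2 * ‖proj {n | n - (m + 0) * N ∈ J} f‖ ^ 2
        + 2 * β ^ 2 * ‖proj {n | n - (m + 0) * N ∈ J} w‖ ^ 2)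
      + 3 * (32 / ρ ^ 2 * ‖proj {n | n - (m + 1) * N ∈ J} f‖ ^ 2
        + 2 * β ^ 2 * ‖proj {n | n - (m + 1) * N ∈ J} w‖ ^ 2) := by
    intro m
    have h1 := hcell (shift (m * N) w)
    have h2 := hbar (shift (m * N) w) (z - 1) (Or.inr rfl)
    have h3 := hbar (shift ((m + 1) * N) w) z (Or.inl rfl)
    rw [hfs] at h1 h2 h3
    have e : shift (m * N) w (z + N) = shift ((m + 1) * N) w z := by
      rw [shift_apply, shift_apply]; exact congrArg w (by ring)
    rw [e] at h1
    simp only [norm_proj_shift] at h1 h2 h3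
    simp only [add_zero]
    linarith
  have hsum := Finset.sum_le_sum fun m (_ : m ∈ s) => hone m
  simp only [Finset.sum_add_distrib, ← Finset.mul_sum] at hsum
  have b1 := sum_norm_sq_proj_le s _ (hdisjC 0) f
  have b2 := sum_norm_sq_proj_le s _ (hdisjJ 0) f
  have b3 := sum_norm_sq_proj_le s _ (hdisjJ 0) w
  have b4 := sum_norm_sq_proj_le s _ (hdisjJ 1) f
  have b5 := sum_norm_sq_proj_le s _ (hdisjJ 1) w
  have hρ2 : 0 < 32 / ρ ^ 2 := by positivity
  have hβ2 : 0 ≤ 2 * β ^ 2 := by positivity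
  have hA : d ^ 2 * ‖w‖ ^ 2 ≤ 3 * ‖f‖ ^ 2
      + 6 * (32 / ρ ^ 2 * ‖f‖ ^ 2 + 2 * β ^ 2 * ‖w‖ ^ 2) := by
    have c0 := mul_le_mul_of_nonneg_left hcov (sq_nonneg d)
    have c2 := mul_le_mul_of_nonneg_left b2 hρ2.le
    have c3 := mul_le_mul_of_nonneg_left b3 hβ2
    have c4 := mul_le_mul_of_nonneg_left b4 hρ2.le
    have c5 := mul_le_mul_of_nonneg_left b5 hβ2
    linarith
  have hB : d ^ 2 * ‖w‖ ^ 2 ≤ (20 / ρ) ^ 2 * ‖f‖ ^ 2 := by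
    have h1 : 24 * β ^ 2 * ‖w‖ ^ 2 ≤ d ^ 2 * ‖w‖ ^ 2 := by gcongr
    have h2 : 3 * ‖f‖ ^ 2 ≤ 3 / ρ ^ 2 * ‖f‖ ^ 2 := by
      gcongr
      rw [le_div_iff₀ (by positivity)]
      nlinarith
    have h3 : d ^ 2 * ‖w‖ ^ 2 ≤ 390 * (1 / ρ ^ 2 * ‖f‖ ^ 2) := by
      have : 3 / ρ ^ 2 * ‖f‖ ^ 2 = 3 * (1 / ρ ^ 2 * ‖f‖ ^ 2) := by ring
      have : 32 / ρ ^ 2 * ‖f‖ ^ 2 = 32 * (1 / ρ ^ 2 * ‖f‖ ^ 2) := by ring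
      linarith
    have h4 : (20 / ρ) ^ 2 * ‖f‖ ^ 2 = 400 * (1 / ρ ^ 2 * ‖f‖ ^ 2) := by ring
    have h5 : 0 ≤ 1 / ρ ^ 2 * ‖f‖ ^ 2 := by positivity
    linarith
  rw [← mul_pow, ← mul_pow] at hB
  have hC := le_of_sq_le_sq hB (by positivity)
  have : d * ρ / 20 * ‖w‖ = ρ / 20 * (d * ‖w‖) := by ring
  rw [this]
  calc ρ / 20 * (d * ‖w‖) ≤ ρ / 20 * (20 / ρ * ‖f‖) := by gcongr
    _ = ‖f‖ := by field_simp

/-- If every energy is in a gap near one of the points of `zs`, then outside a finite set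
every energy is in a gap. -/
theorem exists_thin {V : ℤ → ℝ} {B : ℝ} (hV : ∀ n, |V n| ≤ B) {N : ℕ}
    (hper : ∀ n, V (n + N) = V n) (zs : Finset ℤ) {l : ℤ} (hl : 1 ≤ l) (hlN : 2 * l + 1 ≤ N)
    {ρ d₀ : ℝ} (hρ : 0 < ρ) (hρ1 : ρ ≤ 1) (hd₀ : 0 < d₀)
    (hg : ∀ E, ∃ z ∈ zs, GapOn V (Set.Ioo (z - l) (z + l)) E ρ)
    (hβ : 24 * (4 * Real.exp (-(ρ * l / 8))) ^ 2 ≤ d₀ ^ 2) :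
    ∃ S : Finset ℝ, S.card ≤ zs.card * N ∧ ∀ E d, d₀ ≤ d → (∀ σ ∈ S, d ≤ |E - σ|) →
      Gap V E (d * ρ / 20) := by
  classical
  choose 𝓑 h𝓑 hcard using fun z : ℤ => exists_isEigenbasis_proj_ham hV z (z + N)
  refine ⟨zs.biUnion fun z => (𝓑 z).image Prod.snd, ?_, ?_⟩
  · refine Finset.card_biUnion_le_card_mul _ _ _ fun z _ => Finset.card_image_le.trans ?_
    simpa using hcard z
  · intro E d hd hS
    obtain ⟨z, hz, hgz⟩ := hg E
    refine gap_of_cut hV hper hl hlN hρ hρ1 (hd₀.trans_le hd) hgz (h𝓑 z) (fun a ha => ?_)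
      (hβ.trans (pow_le_pow_left₀ hd₀.le hd 2))
    rw [abs_sub_comm]
    exact hS _ (Finset.mem_biUnion.2 ⟨z, hz, Finset.mem_image_of_mem _ ha⟩)

end Gaps

section Clusters

/-! ### Good clusters -/

/-- An orthonormal cluster of approximate eigenvectors of `H` (error `τ`) supported in `Ico x y`,
such that `H - a.2` is bounded below by `g` on the vectors of `Ico x y` orthogonal to the
cluster, for all energies `a.2` of the cluster. -/
structure Good (U : ℤ → ℝ) (x y : ℤ) (cl : Finset (L2Z × ℝ)) (τ g C : ℝ) : Prop where
  supp : ∀ a ∈ cl, Supp (Set.Ico x y) a.1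
  on : ON cl
  abs_le : ∀ a ∈ cl, |a.2| ≤ C
  res : ∀ a ∈ cl, ‖ham U a.1 - a.2 • a.1‖ ≤ τ
  sep : ∀ a ∈ cl, ∀ w, Supp (Set.Ico x y) w → (∀ b ∈ cl, ⟪b.1, w⟫_ℝ = 0) →
    g * ‖w‖ ≤ ‖ham U w - a.2 • w‖

theorem Good.congr {U U' : ℤ → ℝ} {B B' : ℝ} (hU : ∀ n, |U n| ≤ B) (hU' : ∀ n, |U' n| ≤ B')
    {x y : ℤ} {cl : Finset (L2Z × ℝ)} {τ g C : ℝ} (h : Good U x y cl τ g C)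
    (hUU : ∀ n ∈ Set.Ico x y, U n = U' n) : Good U' x y cl τ g C where
  supp := h.supp
  on := h.on
  abs_le := h.abs_le
  res a ha := by rw [← ham_congr hU hU' hUU (h.supp a ha)]; exact h.res a ha
  sep a ha w hw hb := by rw [← ham_congr hU hU' hUU hw]; exact h.sep a ha w hw hb

theorem Good.mono {U : ℤ → ℝ} {x y : ℤ} {cl : Finset (L2Z × ℝ)} {τ g C τ' g' C' : ℝ}
    (h : Good U x y cl τ g C) (hτ : τ ≤ τ') (hg : g' ≤ g) (hC : C ≤ C') :
    Good U x y cl τ' g' C' where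
  supp := h.supp
  on := h.on
  abs_le a ha := (h.abs_le a ha).trans hC
  res a ha := (h.res a ha).trans hτ
  sep a ha w hw hb := (mul_le_mul_of_nonneg_right hg (norm_nonneg _)).trans (h.sep a ha w hw hb)

/-- A separated set of eigenvectors of the circle operator that are small at the cut is good. -/
theorem good_of_isEigenbasis {U : ℤ → ℝ} {B : ℝ} (hU : ∀ n, |U n| ≤ B) {x y : ℤ} (hxy : x < y)
    {𝓑 : Finset (L2Z × ℝ)} (h𝓑 : IsEigenbasis (Set.Ico x y) (circ x y U) 𝓑)
    (P : L2Z × ℝ → Prop) [DecidablePred P] {γ β : ℝ} (hγ : 0 ≤ γ)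
    (hgap : ∀ a ∈ 𝓑, ∀ b ∈ 𝓑, P a → ¬ P b → γ ≤ |a.2 - b.2|)
    (hβ : ∀ a ∈ 𝓑, P a → |a.1 x| ≤ β ∧ |a.1 (y - 1)| ≤ β) :
    Good U x y (𝓑.filter P) (4 * β) (γ / 5) (B + 4) where
  supp a ha := h𝓑.supp a (Finset.mem_of_mem_filter a ha)
  on := h𝓑.on.subset (Finset.filter_subset _ _)
  abs_le a ha := h𝓑.abs_le (norm_circ_le hU x y) (Finset.mem_of_mem_filter a ha)
  res a ha := by
    rw [Finset.mem_filter] at ha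
    have h1 := norm_ham_sub_circ_le hU hxy (h𝓑.supp a ha.1)
    rw [h𝓑.eig a ha.1] at h1
    have := hβ a ha.1 ha.2
    linarith [this.1, this.2]
  sep a ha w hw hb := by
    rw [Finset.mem_filter] at ha
    have h1 := h𝓑.le_norm_apply_sub hw (e := a.2) hγ fun b hb' h0 => by
      rw [abs_sub_comm]
      exact hgap a ha.1 b hb' ha.2 fun hPb => h0 (hb b (Finset.mem_filter.2 ⟨hb', hPb⟩))
    have h2 := norm_circ_sub_le hU hxy hw a.2
    linarith

/-- Eigenvectors of the circle operator decay at the cut, if their energy is in a gap there. -/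
theorem circ_tail_le {U W : ℤ → ℝ} {B B' : ℝ} (hU : ∀ n, |U n| ≤ B) (hW : ∀ n, |W n| ≤ B')
    {x y l : ℤ} (hl : 1 ≤ l) (hlN : l + 2 ≤ y - x)
    (hUW1 : ∀ n, y - l ≤ n → n < y → U n = W n)
    (hUW2 : ∀ n, y ≤ n → n ≤ y + l → U (n - (y - x)) = W n) {e ρ : ℝ} (hρ : 0 < ρ) (hρ1 : ρ ≤ 1)
    (hg : GapOn W (Set.Ioo (y - l) (y + l)) e ρ) {u : L2Z} (hu : Supp (Set.Ico x y) u)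
    (heig : circ x y U u = e • u) (hu1 : ‖u‖ = 1) :
    |u x| ≤ 8 * Real.exp (-(ρ * l / 8)) ∧ |u (y - 1)| ≤ 8 * Real.exp (-(ρ * l / 8)) := by
  set v := u + shift (-(y - x)) u with hv
  have hvn : ‖v‖ ≤ 2 := by
    refine (norm_add_le _ _).trans ?_
    rw [norm_shift, hu1]; norm_num
  have hout : ∀ k, k < x ∨ y ≤ k → u k = 0 := fun k hk => hu k fun h => by
    rcases hk with hk | hk
    · exact absurd h.1 (by omega)
    · exact absurd h.2 (by omega)
  have hzero : proj (Set.Icc (y - l) (y + l)) (ham W v - e • v) = 0 := by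
    refine ext fun n => ?_
    by_cases hn : n ∈ Set.Icc (y - l) (y + l)
    · rw [proj_of_mem hn]
      obtain ⟨hn1, hn2⟩ := hn
      simp only [sub_apply, smul_apply, ham_apply hW, zero_apply, hv, add_apply, shift_apply]
      by_cases hny : n < y
      · have h1 := congrArg (fun f : L2Z => f n) heig
        simp only [circ_apply hU hu (show n ∈ Set.Ico x y from ⟨by omega, hny⟩), smul_apply] at h1
        rw [hUW1 n hn1 hny] at h1
        rw [hout (n + -(y - x)) (by omega), hout (n - 1 + -(y - x)) (by omega)]
        rw [hout (n + (y - x - 1)) (by omega)] at h1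
        rw [show n + 1 + -(y - x) = n - (y - x - 1) by ring]
        linarith
      · have hmem : n - (y - x) ∈ Set.Ico x y := ⟨by omega, by omega⟩
        have h1 := congrArg (fun f : L2Z => f (n - (y - x))) heig
        simp only [circ_apply hU hu hmem, smul_apply] at h1
        rw [hUW2 n (by omega) hn2] at h1
        rw [hout n (by omega), hout (n + 1) (by omega)]
        rw [hout (n - (y - x) - (y - x - 1)) (by omega),
          show n - (y - x) + (y - x - 1) = n - 1 by ring] at h1
        rw [show n + 1 + -(y - x) = n - (y - x) + 1 by ring,
          show n + -(y - x) = n - (y - x) by ring, show n - 1 + -(y - x) = n - (y - x) - 1 by ring]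
        linarith
    · rw [proj_of_notMem hn]; rfl
  have hε : 0 < Real.exp (-(ρ * l / 8)) := Real.exp_pos _
  have hmain : ∀ n, (n = y ∨ n = y - 1) → |v n| ≤ 8 * Real.exp (-(ρ * l / 8)) := by
    intro n hn
    have h1 := hg.apply_le hW hl hρ hρ1 v hn
    rw [hzero, norm_zero, mul_zero, zero_add] at h1
    have h2 := (norm_proj_le (Set.Icc (y - l) (y + l)) v).trans hvn
    nlinarith
  have e1 : v y = u x := by
    simp only [hv, add_apply, shift_apply]
    rw [hout y (Or.inr le_rfl), show y + -(y - x) = x by ring, zero_add]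
  have e2 : v (y - 1) = u (y - 1) := by
    simp only [hv, add_apply, shift_apply]
    rw [hout (y - 1 + -(y - x)) (Or.inl (by linarith)), add_zero]
  rw [← e1, ← e2]
  exact ⟨hmain y (Or.inl rfl), hmain (y - 1) (Or.inr rfl)⟩

end Clusters

section Resonances

/-! ### Resonances -/

/-- For a monotone family `A + s • proj K`, few values of `s` on a grid can have an approximate
eigenvector at `e` that charges `K`. -/
theorem card_resonant_le (S : Finset ℤ) {K : Set ℤ} (hK : K ⊆ S) (A : L2Z →ₗ[ℝ] L2Z)
    (hA : ∀ u v, ⟪A u, v⟫_ℝ = ⟪u, A v⟫_ℝ) {Δ δ r e : ℝ} (hΔ : 0 < Δ) (hr : 0 ≤ r)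
    (hsmall : S.card * (2 * r) < Δ * δ ^ 2) (hδ : 0 ≤ δ) (𝒦 : Finset ℕ) (w : ℕ → L2Z)
    (hw1 : ∀ k ∈ 𝒦, ‖w k‖ = 1) (hw2 : ∀ k ∈ 𝒦, δ ≤ ‖proj K (w k)‖)
    (hw3 : ∀ k ∈ 𝒦, ‖A (w k) + (k * Δ) • proj K (w k) - e • w k‖ ≤ r) : 𝒦.card ≤ S.card := by
  classical
  by_contra hcard
  push Not at hcard
  obtain ⟨𝒯, h𝒯, h𝒯c⟩ := Finset.exists_subset_card_eq (Nat.succ_le_of_lt hcard)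
  have hoff : ∀ i ∈ 𝒯, ∀ j ∈ 𝒯, i ≠ j → |⟪proj K (w i), proj K (w j)⟫_ℝ| ≤ 2 * r / Δ := by
    intro i hi j hj hij
    have hpp : ⟪proj K (w i), proj K (w j)⟫_ℝ = ⟪w i, proj K (w j)⟫_ℝ := by
      rw [inner_proj, (supp_proj K (w j)).proj_eq]
    have hpp' : ⟪w i, proj K (w j)⟫_ℝ = ⟪proj K (w i), w j⟫_ℝ := (inner_proj _ _ _).symm
    have e1 : ((i : ℝ) * Δ - j * Δ) * ⟪w i, proj K (w j)⟫_ℝ =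
        ⟪A (w i) + (i * Δ) • proj K (w i) - e • w i, w j⟫_ℝ
        - ⟪w i, A (w j) + (j * Δ) • proj K (w j) - e • w j⟫_ℝ := by
      simp only [inner_sub_left, inner_sub_right, inner_add_left, inner_add_right,
        real_inner_smul_left, real_inner_smul_right, hA, ← hpp']
      ring
    have b1 : |⟪A (w i) + (i * Δ) • proj K (w i) - e • w i, w j⟫_ℝ| ≤ r := by
      have := abs_real_inner_le_norm (A (w i) + (i * Δ) • proj K (w i) - e • w i) (w j)
      rw [hw1 j (h𝒯 hj), mul_one] at this
      exact this.trans (hw3 i (h𝒯 hi))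
    have b2 : |⟪w i, A (w j) + (j * Δ) • proj K (w j) - e • w j⟫_ℝ| ≤ r := by
      have := abs_real_inner_le_norm (w i) (A (w j) + (j * Δ) • proj K (w j) - e • w j)
      rw [hw1 i (h𝒯 hi), one_mul] at this
      exact this.trans (hw3 j (h𝒯 hj))
    have b3 : |((i : ℝ) * Δ - j * Δ) * ⟪w i, proj K (w j)⟫_ℝ| ≤ 2 * r := by
      rw [e1]; exact (abs_sub _ _).trans (by linarith)
    have b4 : Δ ≤ |(i : ℝ) * Δ - j * Δ| := by
      rw [← sub_mul, abs_mul, abs_of_pos hΔ]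
      have : (1 : ℤ) ≤ |(i : ℤ) - j| := Int.one_le_abs (by
        intro h; exact hij (by exact_mod_cast sub_eq_zero.1 h))
      have : (1 : ℝ) ≤ |(i : ℝ) - j| := by exact_mod_cast this
      nlinarith
    rw [hpp, le_div_iff₀ hΔ, mul_comm]
    rw [abs_mul] at b3
    exact (mul_le_mul_of_nonneg_right b4 (abs_nonneg _)).trans b3
  have hmem : ∀ k, proj K (w k) ∈ suppSubmodule (S : Set ℤ) := fun k => (supp_proj K (w k)).mono hK
  have hli : LinearIndependent ℝ
      (fun k : 𝒯 => (⟨proj K (w k), hmem k⟩ : suppSubmodule (S : Set ℤ))) := by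
    rw [linearIndependent_iff']
    intro s c hc
    by_contra! hne
    obtain ⟨i₀, hi₀, hci₀⟩ := hne
    obtain ⟨i, hi, hmax⟩ := s.exists_max_image (fun k => |c k|) ⟨i₀, hi₀⟩
    have hcpos : 0 < |c i| := (abs_pos.2 hci₀).trans_le (hmax i₀ hi₀)
    have h1 : ∑ k ∈ s, c k • proj K (w k) = 0 := by
      have := congrArg Subtype.val hc
      simpa using this
    have h2 : ∑ k ∈ s, c k * ⟪proj K (w i), proj K (w k)⟫_ℝ = 0 := by
      have := congrArg (fun v => ⟪proj K (w i), v⟫_ℝ) h1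
      simpa [inner_sum, real_inner_smul_right] using this
    rw [← Finset.add_sum_erase _ _ hi, real_inner_self_eq_norm_sq] at h2
    have h3 : |c i * ‖proj K (w i)‖ ^ 2| ≤
        ∑ k ∈ s.erase i, |c i| * (2 * r / Δ) := by
      rw [eq_neg_of_add_eq_zero_left h2, abs_neg]
      refine (Finset.abs_sum_le_sum_abs _ _).trans (Finset.sum_le_sum fun k hk => ?_)
      rw [Finset.mem_erase] at hk
      rw [abs_mul]
      refine mul_le_mul (hmax k hk.2) (hoff i i.2 k k.2 fun h => hk.1 (Subtype.ext h.symm))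
        (abs_nonneg _) hcpos.le
    rw [Finset.sum_const, nsmul_eq_mul, abs_mul, abs_of_nonneg (sq_nonneg ‖proj K (w i)‖)] at h3
    have h4 : ((s.erase i).card : ℝ) ≤ S.card := by
      have h5 : (s.erase i).card + 1 ≤ 𝒯.card := by
        rw [Finset.card_erase_add_one hi]
        simpa using Finset.card_le_univ s
      have : (s.erase i).card ≤ S.card := by omega
      exact_mod_cast this
    have h5 : δ ^ 2 ≤ ‖proj K (w i)‖ ^ 2 := pow_le_pow_left₀ hδ (hw2 i (h𝒯 i.2)) 2
    have h6 : |c i| * δ ^ 2 ≤ |c i| * (S.card * (2 * r / Δ)) := by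
      calc |c i| * δ ^ 2 ≤ |c i| * ‖proj K (w i)‖ ^ 2 := by gcongr
        _ ≤ _ := h3
        _ = |c i| * ((s.erase i).card * (2 * r / Δ)) := by ring
        _ ≤ _ := by gcongr
    have h7 := le_of_mul_le_mul_left h6 hcpos
    rw [← mul_div_assoc, le_div_iff₀ hΔ] at h7
    linarith
  have := hli.fintype_card_le_finrank
  have h8 := finrank_suppSubmodule_le S
  rw [Fintype.card_coe] at this
  omega

/-- Some grid point is non-resonant for all energies of a finite set. -/
theorem exists_nonresonant (S : Finset ℤ) {K : Set ℤ} (hK : K ⊆ S) (A : L2Z →ₗ[ℝ] L2Z)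
    (hA : ∀ u v, ⟪A u, v⟫_ℝ = ⟪u, A v⟫_ℝ) {Δ δ r : ℝ} (hΔ : 0 < Δ) (hr : 0 ≤ r)
    (hsmall : S.card * (2 * r) < Δ * δ ^ 2) (hδ : 0 ≤ δ) (𝓔 : Finset ℝ) :
    ∃ k ≤ 𝓔.card * S.card, ∀ e ∈ 𝓔, ∀ w : L2Z, ‖w‖ = 1 → δ ≤ ‖proj K w‖ →
      r ≤ ‖A w + (k * Δ) • proj K w - e • w‖ := by
  classical
  by_contra! hcon
  choose! e he w hw1 hw2 hw3 using hcon
  set R := Finset.range (𝓔.card * S.card + 1)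
  have h1 : ∀ k ∈ R, k ≤ 𝓔.card * S.card := fun k hk => Nat.lt_succ_iff.1 (Finset.mem_range.1 hk)
  have h2 := Finset.card_le_mul_card_image_of_maps_to (s := R) (t := 𝓔) (f := e)
    (fun k hk => he k (h1 k hk)) S.card (fun b _ => by
      refine card_resonant_le S hK A hA hΔ hr hsmall hδ _ w (e := b) ?_ ?_ ?_
      · intro k hk; rw [Finset.mem_filter] at hk; exact hw1 k (h1 k hk.1)
      · intro k hk; rw [Finset.mem_filter] at hk; exact hw2 k (h1 k hk.1)
      · intro k hk
        rw [Finset.mem_filter] at hk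
        have := hw3 k (h1 k hk.1)
        rw [hk.2] at this
        exact this.le)
  rw [Finset.card_range] at h2
  nlinarith

/-- The potential equal to `U` on `Ico x y` and to `U₀` elsewhere. -/
def glue (x y : ℤ) (U U₀ : ℤ → ℝ) (n : ℤ) : ℝ := if x ≤ n ∧ n < y then U n else U₀ n

theorem glue_of_mem {x y : ℤ} {U U₀ : ℤ → ℝ} {n : ℤ} (h1 : x ≤ n) (h2 : n < y) :
    glue x y U U₀ n = U n := if_pos ⟨h1, h2⟩

theorem glue_of_notMem {x y : ℤ} {U U₀ : ℤ → ℝ} {n : ℤ} (h : n < x ∨ y ≤ n) :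
    glue x y U U₀ n = U₀ n := if_neg (by omega)

theorem abs_glue_le {x y : ℤ} {U U₀ : ℤ → ℝ} {B : ℝ} (hU : ∀ n, |U n| ≤ B)
    (hU₀ : ∀ n, |U₀ n| ≤ B) (n : ℤ) : |glue x y U U₀ n| ≤ B := by
  unfold glue; split_ifs; exacts [hU n, hU₀ n]

theorem abs_add_le_of_mem {B s : ℝ} {U : ℤ → ℝ} (hU : ∀ n, |U n| ≤ B) (h0 : 0 ≤ s) (h1 : s ≤ 1)
    (n : ℤ) : |U n + s| ≤ B + 1 := by
  refine (abs_add_le _ _).trans (add_le_add (hU n) ?_)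
  rwa [abs_of_nonneg h0]

/-- Separation of clusters persists in a larger interval, after an arbitrarily small shift of the
potential off the original interval. -/
theorem exists_persist {ι : Type*} (J : Finset ι) (cls : ι → Finset (L2Z × ℝ))
    {x y x' y' : ℤ} (hx : x' < x) (hy : y < y') (hxy : x < y) {U U₀ : ℤ → ℝ} {B : ℝ}
    (hU : ∀ n, |U n| ≤ B) (hU₀ : ∀ n, |U₀ n| ≤ B) {τ g C : ℝ} (hg : 0 ≤ g)
    (hgood : ∀ j ∈ J, Good U x y (cls j) τ g C) {n : ℕ} (hn : ∑ j ∈ J, (cls j).card ≤ n)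
    {N' : ℕ} (hN' : y' - x' = N') {Δ δ r : ℝ} (hΔ : 0 < Δ) (hΔ1 : n * N' * Δ ≤ 1) (hr : 0 ≤ r)
    (hδ : 0 ≤ δ) (hδ1 : δ ≤ 1 / 2) (hsmall : N' * (2 * r) < Δ * δ ^ 2)
    (hrg : r + (B + 5 + C) * δ ≤ g / 2) :
    ∃ s, 0 ≤ s ∧ s ≤ n * N' * Δ ∧ ∀ j ∈ J, ∀ a ∈ cls j, ∀ w, Supp (Set.Ico x' y') w →
      (∀ b ∈ cls j, ⟪b.1, w⟫_ℝ = 0) →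
      r * ‖w‖ ≤ ‖circ x' y' (glue x y U fun n => U₀ n + s) w - a.2 • w‖ := by
  classical
  set 𝓔 := J.biUnion fun j => (cls j).image Prod.snd
  have h𝓔 : 𝓔.card ≤ n := by
    refine Finset.card_biUnion_le.trans ((Finset.sum_le_sum fun j _ => ?_).trans hn)
    exact Finset.card_image_le
  set S := Finset.Ico x' y' with hS
  have hScard : S.card = N' := by rw [hS, Int.card_Ico, hN']; simp
  set K : Set ℤ := Set.Ico x' y' \ Set.Ico x y
  have hK : K ⊆ S := by rw [hS, Finset.coe_Ico]; exact Set.sdiff_subset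
  set G := glue x y U U₀
  have hG : ∀ n, |G n| ≤ B := abs_glue_le hU hU₀
  obtain ⟨k, hk, hkw⟩ := exists_nonresonant S hK (circ x' y' G) (inner_circ hG x' y') hΔ hr
    (by rwa [hScard]) hδ 𝓔
  rw [hScard] at hk
  set s : ℝ := k * Δ with hs
  have hs0 : 0 ≤ s := by positivity
  have hs1 : s ≤ n * N' * Δ := by
    rw [hs]
    gcongr
    have : k ≤ n * N' := hk.trans (by gcongr)
    exact_mod_cast this
  have hs2 : s ≤ 1 := hs1.trans hΔ1
  set Gs := glue x y U fun n => U₀ n + s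
  have hGs : ∀ n, |Gs n| ≤ B + 1 :=
    abs_glue_le (fun n => (hU n).trans (by linarith)) (abs_add_le_of_mem hU₀ hs0 hs2)
  have hcirc : ∀ w, Supp (Set.Ico x' y') w →
      circ x' y' Gs w = circ x' y' G w + s • proj K w := by
    intro w hw
    refine ext fun n => ?_
    rw [add_apply, smul_apply]
    by_cases hn : n ∈ Set.Ico x' y'
    · rw [circ_apply hGs hw hn, circ_apply hG hw hn]
      by_cases hn2 : n ∈ Set.Ico x y
      · rw [proj_of_notMem (fun h : n ∈ K => h.2 hn2)]
        simp only [Gs, G, glue_of_mem hn2.1 hn2.2]; ring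
      · rw [proj_of_mem (show n ∈ K from ⟨hn, hn2⟩)]
        have : n < x ∨ y ≤ n := by
          simpa only [Set.mem_Ico, not_and_or, not_le, not_lt] using hn2
        simp only [Gs, G, glue_of_notMem this]; ring
    · rw [supp_circ _ _ _ _ _ hn, supp_circ _ _ _ _ _ hn,
        proj_of_notMem (fun h : n ∈ K => hn h.1)]
      simp
  refine ⟨s, hs0, hs1, fun j hj a ha w hw hb => ?_⟩
  have hunit : ∀ w : L2Z, ‖w‖ = 1 → Supp (Set.Ico x' y') w → (∀ b ∈ cls j, ⟪b.1, w⟫_ℝ = 0) →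
      r ≤ ‖circ x' y' Gs w - a.2 • w‖ := by
    intro w hw1 hw hb
    by_cases hδw : δ ≤ ‖proj K w‖
    · rw [hcirc w hw]
      exact hkw a.2 (Finset.mem_biUnion.2 ⟨j, hj, Finset.mem_image_of_mem _ ha⟩) w hw1 hδw
    · push Not at hδw
      set w₁ := proj (Set.Ico x y) w with hw₁
      have hw₁s : Supp (Set.Ico x y) w₁ := supp_proj _ _
      have hdec : w = w₁ + proj K w := ext fun n => by
        rw [add_apply]
        by_cases hn : n ∈ Set.Ico x y
        · rw [hw₁, proj_of_mem hn, proj_of_notMem (fun h : n ∈ K => h.2 hn), add_zero]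
        · rw [hw₁, proj_of_notMem hn, zero_add]
          by_cases hn' : n ∈ Set.Ico x' y'
          · rw [proj_of_mem (show n ∈ K from ⟨hn', hn⟩)]
          · rw [hw n hn', proj_of_notMem (fun h : n ∈ K => hn' h.1)]
      have hw₁n : 1 / 2 ≤ ‖w₁‖ := by
        have := norm_add_le w₁ (proj K w)
        rw [← hdec, hw1] at this
        linarith
      have hw₁b : ∀ b ∈ cls j, ⟪b.1, w₁⟫_ℝ = 0 := fun b hb' => by
        rw [hw₁, ← inner_proj, ((hgood j hj).supp b hb').proj_eq, hb b hb']
      have h1 := (hgood j hj).sep a ha w₁ hw₁s hw₁b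
      have hsub : Set.Ico x y ⊆ Set.Ico x' y' := Set.Ico_subset_Ico hx.le hy.le
      have h2 : circ x' y' Gs w₁ = ham U w₁ := by
        have e1 := ham_sub_circ hGs (by omega : x' < y') (hw₁s.mono hsub)
        rw [hw₁s x' (fun h => by have := h.1; omega), hw₁s (y' - 1) (fun h => by have := h.2; omega),
          zero_smul, zero_smul, add_zero, sub_eq_zero] at e1
        rw [← e1]
        exact ham_congr hGs hU (fun n hn => glue_of_mem hn.1 hn.2) hw₁s
      have h3 : circ x' y' Gs w - a.2 • w = (ham U w₁ - a.2 • w₁)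
          + (circ x' y' Gs (proj K w) - a.2 • proj K w) := by
        conv_lhs => rw [hdec]
        rw [map_add, h2, smul_add]; abel
      have h4 : ‖circ x' y' Gs (proj K w) - a.2 • proj K w‖ ≤ (B + 5 + C) * δ := by
        have hC := (hgood j hj).abs_le a ha
        have hB : 0 ≤ B := (abs_nonneg _).trans (hU 0)
        have hC0 : 0 ≤ C := (abs_nonneg _).trans hC
        refine (norm_sub_le _ _).trans ?_
        have b1 := norm_circ_le hGs x' y' (proj K w)
        rw [norm_smul, Real.norm_eq_abs]
        have b2 : |a.2| * ‖proj K w‖ ≤ C * ‖proj K w‖ := by gcongr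
        have b3 : (B + 5 + C) * ‖proj K w‖ ≤ (B + 5 + C) * δ := by gcongr
        linarith
      have h5 : ‖ham U w₁ - a.2 • w₁‖ ≤ ‖circ x' y' Gs w - a.2 • w‖
          + ‖circ x' y' Gs (proj K w) - a.2 • proj K w‖ := by
        rw [h3]; exact norm_le_add_norm_add _ _
      have h6 : g / 2 ≤ g * ‖w₁‖ := by nlinarith
      linarith
  by_cases hw0 : w = 0
  · simp [hw0]
  · have hpos : 0 < ‖w‖ := norm_pos_iff.2 hw0
    have h1 := hunit (‖w‖⁻¹ • w) (by rw [norm_smul, norm_inv, norm_norm, inv_mul_cancel₀ hpos.ne'])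
      (hw.smul _) (fun b hb' => by rw [real_inner_smul_right, hb b hb', mul_zero])
    rw [map_smul, smul_comm, ← smul_sub, norm_smul, norm_inv, norm_norm] at h1
    rw [mul_comm]
    calc ‖w‖ * r ≤ ‖w‖ * (‖w‖⁻¹ * ‖circ x' y' Gs w - a.2 • w‖) := by gcongr
      _ = _ := by rw [mul_inv_cancel_left₀ hpos.ne']

end Resonances

section Projections

/-! ### Spectral projections -/

/-- The eigenvectors in `𝓑` whose energy is within `r` of an energy of `cl`. -/
def near (cl : Finset (L2Z × ℝ)) (r : ℝ) (a : L2Z × ℝ) : Prop := ∃ c ∈ cl, |a.2 - c.2| < r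

namespace IsEigenbasis
variable {I : Set ℤ} {A : L2Z →ₗ[ℝ] L2Z} {𝓑 cl : Finset (L2Z × ℝ)} {τ r : ℝ}

theorem norm_sub_spanProj_le (h : IsEigenbasis I A 𝓑) (hsymm : ∀ u v, ⟪A u, v⟫_ℝ = ⟪u, A v⟫_ℝ)
    (hon : ON cl) (hsupp : ∀ c ∈ cl, Supp I c.1) (hτ : 0 ≤ τ) (hr : 0 < r)
    (hres : ∀ c ∈ cl, ‖A c.1 - c.2 • c.1‖ ≤ τ)
    (hsep : ∀ c ∈ cl, ∀ w, Supp I w → (∀ b ∈ cl, ⟪b.1, w⟫_ℝ = 0) → r * ‖w‖ ≤ ‖A w - c.2 • w‖)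
    {a : L2Z × ℝ} (ha : a ∈ 𝓑) (hnear : near cl (r / 4) a) :
    ‖a.1 - spanProj cl a.1‖ ≤ 3 * cl.card * τ / r := by
  obtain ⟨c₀, hc₀, hlt⟩ := hnear
  set w := a.1 - spanProj cl a.1 with hw
  have hws : Supp I w := (h.supp a ha).sub (Supp.spanProj hsupp _)
  have hwo : ∀ b ∈ cl, ⟪b.1, w⟫_ℝ = 0 := fun b hb => hon.inner_sub_spanProj _ hb
  have hwn : ‖w‖ ≤ 1 := by
    rw [← h.on.1 a ha]; exact hon.norm_sub_spanProj_le _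
  set R : L2Z × ℝ → L2Z := fun c => A c.1 - c.2 • c.1 with hR
  have key : A w - a.2 • w + (∑ c ∈ cl, ⟪c.1, a.1⟫_ℝ • R c)
      = ∑ c ∈ cl, (- ((c.2 - a.2) * ⟪c.1, a.1⟫_ℝ)) • c.1 := by
    rw [hw, map_sub, h.eig a ha, smul_sub, spanProj, map_sum, Finset.smul_sum, hR]
    rw [sub_sub_sub_cancel_left, ← Finset.sum_sub_distrib, ← Finset.sum_add_distrib]
    refine Finset.sum_congr rfl fun c _ => ?_
    rw [map_smul]; module
  set D := ∑ c ∈ cl, ⟪c.1, a.1⟫_ℝ • R c with hD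
  have hDn : ‖D‖ ≤ cl.card * τ := by
    refine (norm_sum_le _ _).trans ?_
    rw [← nsmul_eq_mul, ← Finset.sum_const]
    refine Finset.sum_le_sum fun c hc => ?_
    rw [norm_smul, Real.norm_eq_abs]
    have h1 := hon.abs_inner_le a.1 hc
    rw [h.on.1 a ha] at h1
    calc _ ≤ 1 * τ := mul_le_mul h1 (hres c hc) (norm_nonneg _) zero_le_one
      _ = τ := one_mul _
  set X := A w - a.2 • w with hX
  have hXin : ∀ c ∈ cl, ⟪c.1, X⟫_ℝ = ⟪R c, w⟫_ℝ := fun c hc => by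
    rw [hX, hR]
    simp only [inner_sub_right, inner_sub_left, inner_smul_left, inner_smul_right, hwo c hc,
      hsymm, mul_zero, sub_zero]
  have hPX : ‖spanProj cl X‖ ≤ cl.card * τ := by
    refine (norm_sum_le _ _).trans ?_
    rw [← nsmul_eq_mul, ← Finset.sum_const]
    refine Finset.sum_le_sum fun c hc => ?_
    rw [norm_smul, hon.1 c hc, mul_one, hXin c hc, Real.norm_eq_abs]
    refine (abs_real_inner_le_norm _ _).trans ?_
    calc _ ≤ τ * 1 := mul_le_mul (hres c hc) hwn (norm_nonneg _) hτ
      _ = τ := mul_one _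
  have hQX : X - spanProj cl X = -(D - spanProj cl D) := by
    have h1 : X + D - spanProj cl (X + D) = 0 := by
      rw [key, sub_eq_zero]
      refine Finset.sum_congr rfl fun c hc => ?_
      rw [hon.inner_sum _ hc]
    rw [spanProj_add] at h1
    rw [eq_neg_iff_add_eq_zero, ← h1]; abel
  have hXn : ‖X‖ ≤ 2 * (cl.card * τ) := by
    calc ‖X‖ = ‖spanProj cl X + (X - spanProj cl X)‖ := by rw [add_sub_cancel]
      _ ≤ cl.card * τ + cl.card * τ := by
        refine (norm_add_le _ _).trans (add_le_add hPX ?_)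
        rw [hQX, norm_neg]
        exact (hon.norm_sub_spanProj_le _).trans hDn
      _ = _ := by ring
  have h1 := hsep c₀ hc₀ w hws hwo
  have h2 : ‖A w - c₀.2 • w‖ ≤ ‖X‖ + r / 4 * ‖w‖ := by
    have : A w - c₀.2 • w = X + (a.2 - c₀.2) • w := by rw [hX]; module
    rw [this]
    refine (norm_add_le _ _).trans (add_le_add le_rfl ?_)
    rw [norm_smul, Real.norm_eq_abs]
    exact mul_le_mul_of_nonneg_right hlt.le (norm_nonneg _)
  rw [le_div_iff₀ hr]
  have : 0 ≤ cl.card * τ := by positivity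
  nlinarith

theorem exists_abs_sub_le_of_near (h : IsEigenbasis I A 𝓑)
    (hsymm : ∀ u v, ⟪A u, v⟫_ℝ = ⟪u, A v⟫_ℝ) (hon : ON cl)
    (hres : ∀ c ∈ cl, ‖A c.1 - c.2 • c.1‖ ≤ τ) {a : L2Z × ℝ} (ha : a ∈ 𝓑)
    (hw : ‖a.1 - spanProj cl a.1‖ ≤ 1 / 2) (hcl : cl.Nonempty) :
    ∃ c ∈ cl, |a.2 - c.2| ≤ 2 * cl.card * τ := by
  obtain ⟨c, hc, hmax⟩ := cl.exists_max_image (fun c => ⟪c.1, a.1⟫_ℝ ^ 2) hcl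
  refine ⟨c, hc, ?_⟩
  have h1 := hon.norm_sq_add a.1
  rw [h.on.1 a ha, hon.norm_sq_spanProj] at h1
  have h2 := Finset.sum_le_card_nsmul _ _ _ hmax
  rw [nsmul_eq_mul] at h2
  have h3 : ‖a.1 - spanProj cl a.1‖ ^ 2 ≤ (1 / 2) ^ 2 := pow_le_pow_left₀ (norm_nonneg _) hw 2
  have hn : (1 : ℝ) ≤ cl.card := by exact_mod_cast hcl.card_pos
  set i := ⟪c.1, a.1⟫_ℝ with hi
  have h4 : 1 ≤ 2 * cl.card * |i| := by
    by_contra! hlt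
    have : (2 * cl.card * |i|) ^ 2 < 1 := by
      have := pow_lt_pow_left₀ hlt (by positivity) two_ne_zero
      simpa using this
    rw [mul_pow, sq_abs] at this
    nlinarith [sq_nonneg i]
  have h5 : (a.2 - c.2) * i = ⟪A c.1 - c.2 • c.1, a.1⟫_ℝ := by
    rw [inner_sub_left, hsymm, h.eig a ha, inner_smul_left, inner_smul_right]; simp; ring
  have h6 : |a.2 - c.2| * |i| ≤ τ := by
    rw [← abs_mul, h5]
    refine (abs_real_inner_le_norm _ _).trans ?_
    rw [h.on.1 a ha, mul_one]; exact hres c hc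
  have := abs_nonneg (a.2 - c.2)
  calc |a.2 - c.2| ≤ |a.2 - c.2| * (2 * cl.card * |i|) := le_mul_of_one_le_right this h4
    _ = 2 * cl.card * (|a.2 - c.2| * |i|) := by ring
    _ ≤ _ := by gcongr

open scoped Classical in
theorem card_filter_near_le (h : IsEigenbasis I A 𝓑) (hon : ON cl) {η : ℝ}
    (hw : ∀ a ∈ 𝓑, near cl r a → ‖a.1 - spanProj cl a.1‖ ≤ η)
    (hη2 : 2 * (𝓑.card * η ^ 2) ≤ 1) : (𝓑.filter (near cl r)).card ≤ cl.card := by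
  set F := 𝓑.filter (near cl r)
  have hF : ON F := h.on.subset (Finset.filter_subset _ _)
  have h1 : ∑ a ∈ F, ‖spanProj cl a.1‖ ^ 2 ≤ cl.card := by
    calc _ = ∑ a ∈ F, ∑ c ∈ cl, ⟪c.1, a.1⟫_ℝ ^ 2 :=
          Finset.sum_congr rfl fun a _ => hon.norm_sq_spanProj _
      _ = ∑ c ∈ cl, ∑ a ∈ F, ⟪a.1, c.1⟫_ℝ ^ 2 := by
          rw [Finset.sum_comm]; simp only [real_inner_comm]
      _ ≤ ∑ c ∈ cl, 1 := Finset.sum_le_sum fun c hc => by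
          have := hF.sum_inner_sq_le c.1
          rwa [hon.1 c hc, one_pow] at this
      _ = _ := by simp
  have h2 : ∑ a ∈ F, (1 - η ^ 2) ≤ ∑ a ∈ F, ‖spanProj cl a.1‖ ^ 2 := by
    refine Finset.sum_le_sum fun a ha => ?_
    rw [Finset.mem_filter] at ha
    have h3 := hon.norm_sq_add a.1
    have h4 := pow_le_pow_left₀ (norm_nonneg _) (hw a ha.1 ha.2) 2
    rw [h.on.1 a ha.1] at h3
    linarith
  rw [Finset.sum_const, nsmul_eq_mul] at h2
  have h5 : (F.card : ℝ) ≤ 𝓑.card := by exact_mod_cast Finset.card_filter_le _ _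
  have h6 : (F.card : ℝ) * η ^ 2 ≤ 𝓑.card * η ^ 2 := by gcongr
  have h7 : (F.card : ℝ) < cl.card + 1 := by nlinarith
  exact Nat.lt_succ_iff.1 (by exact_mod_cast h7)

open scoped Classical in
theorem norm_sub_spanProj_near_le (h : IsEigenbasis I A 𝓑)
    (hon : ON cl) (hsupp : ∀ c ∈ cl, Supp I c.1) (hr : 0 < r) (hτ : 0 ≤ τ)
    (hres : ∀ c ∈ cl, ‖A c.1 - c.2 • c.1‖ ≤ τ) {f : L2Z} (hf : spanProj cl f = f) :
    ‖f - spanProj (𝓑.filter (near cl r)) f‖ ≤ cl.card * (τ / r) * ‖f‖ := by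
  set F := 𝓑.filter (near cl r)
  have hF : ON F := h.on.subset (Finset.filter_subset _ _)
  have h1 : ∀ c ∈ cl, ‖c.1 - spanProj F c.1‖ ≤ τ / r := fun c hc => by
    rw [le_div_iff₀ hr]
    refine (mul_comm _ _).trans_le (le_trans ?_ (hres c hc))
    refine le_of_sq_le_sq ?_ (norm_nonneg _)
    have hs : Supp I (c.1 - spanProj F c.1) :=
      (hsupp c hc).sub (Supp.spanProj (fun a ha => h.supp a (Finset.mem_of_mem_filter a ha)) _)
    rw [h.norm_apply_sub_sq (hsupp c hc), mul_pow, h.norm_sq hs, Finset.mul_sum]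
    refine Finset.sum_le_sum fun b hb => ?_
    rw [inner_sub_right, h.inner_spanProj_filter _ _ hb]
    split_ifs with hP
    · rw [sub_self, zero_pow two_ne_zero, mul_zero]
      exact mul_nonneg (sq_nonneg _) (sq_nonneg _)
    · rw [sub_zero, ← sq_abs (b.2 - c.2)]
      refine mul_le_mul_of_nonneg_right (pow_le_pow_left₀ hr.le ?_ 2) (sq_nonneg _)
      by_contra! hlt
      exact hP ⟨c, hc, hlt⟩
  have h2 : f - spanProj F f = ∑ c ∈ cl, ⟪c.1, f⟫_ℝ • (c.1 - spanProj F c.1) := by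
    have h3 : spanProj F f = ∑ c ∈ cl, ⟪c.1, f⟫_ℝ • spanProj F c.1 := by
      conv_lhs => rw [← hf]
      simp only [spanProj, _root_.inner_sum, inner_smul_right, Finset.sum_smul, Finset.smul_sum,
        smul_smul]
      rw [Finset.sum_comm]
    simp only [h3, smul_sub, Finset.sum_sub_distrib]
    exact congrArg (· - _) hf.symm
  rw [h2, mul_assoc]
  refine (norm_sum_le _ _).trans ?_
  rw [← nsmul_eq_mul, ← Finset.sum_const]
  refine Finset.sum_le_sum fun c hc => ?_
  rw [norm_smul, mul_comm]
  exact mul_le_mul (h1 c hc) (hon.abs_inner_le f hc) (norm_nonneg _) (by positivity)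

end IsEigenbasis

end Projections

section Update

/-! ### Updating clusters -/

/-- Almost eigenvectors on the circle are replaced by true eigenvectors. -/
theorem exists_update {U : ℤ → ℝ} {B : ℝ} (hU : ∀ n, |U n| ≤ B) {x y : ℤ} (hxy : x < y)
    {𝓑 cl : Finset (L2Z × ℝ)} (h𝓑 : IsEigenbasis (Set.Ico x y) (circ x y U) 𝓑)
    (hon : ON cl) (hsupp : ∀ c ∈ cl, Supp (Set.Ico x y) c.1) {τ r β : ℝ} (hτ : 0 ≤ τ) (hr : 0 < r)
    (hres : ∀ c ∈ cl, ‖circ x y U c.1 - c.2 • c.1‖ ≤ τ)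
    (hsep : ∀ c ∈ cl, ∀ w, Supp (Set.Ico x y) w → (∀ b ∈ cl, ⟪b.1, w⟫_ℝ = 0) →
      r * ‖w‖ ≤ ‖circ x y U w - c.2 • w‖) (h1 : 16 * cl.card * τ ≤ r)
    (h2 : 2 * (𝓑.card * (3 * cl.card * τ / r) ^ 2) ≤ 1)
    (hβ : ∀ a ∈ 𝓑, (∃ c ∈ cl, |a.2 - c.2| ≤ 2 * cl.card * τ) →
      |a.1 x| ≤ β ∧ |a.1 (y - 1)| ≤ β) :
    ∃ cl', Good U x y cl' (4 * β) (r / 40) (B + 4) ∧ cl'.card ≤ cl.card ∧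
      ∀ f, spanProj cl f = f → ∃ f', spanProj cl' f' = f' ∧ ‖f'‖ ≤ ‖f‖ ∧
        ‖f - f'‖ ≤ cl.card * (τ / (r / 4)) * ‖f‖ := by
  classical
  have hsymm := inner_circ hU x y
  have hn : ∀ a ∈ 𝓑, near cl (r / 4) a → ‖a.1 - spanProj cl a.1‖ ≤ 3 * cl.card * τ / r :=
    fun a ha hna => h𝓑.norm_sub_spanProj_le hsymm hon hsupp hτ hr hres hsep ha hna
  have hclose : ∀ a ∈ 𝓑, near cl (r / 4) a → ∃ c ∈ cl, |a.2 - c.2| ≤ 2 * cl.card * τ :=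
    fun a ha hna => by
      obtain ⟨c, hc, _⟩ := id hna
      refine h𝓑.exists_abs_sub_le_of_near hsymm hon hres ha ((hn a ha hna).trans ?_) ⟨c, hc⟩
      rw [div_le_iff₀ hr]
      have : 0 ≤ cl.card * τ := by positivity
      linarith
  have hgood := good_of_isEigenbasis hU hxy h𝓑 (near cl (r / 4)) (γ := r / 8) (β := β)
    (by positivity) (fun a ha b _ hna hnb => by
      obtain ⟨c, hc, hle⟩ := hclose a ha hna
      have h3 : r / 4 ≤ |b.2 - c.2| := by
        by_contra! hlt
        exact hnb ⟨c, hc, hlt⟩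
      have h4 := abs_sub_le b.2 a.2 c.2
      rw [abs_sub_comm b.2 a.2] at h4
      linarith) (fun a ha hna => hβ a ha (hclose a ha hna))
  rw [show r / 8 / 5 = r / 40 by ring] at hgood
  refine ⟨_, hgood, h𝓑.card_filter_near_le hon hn h2, fun f hf => ⟨_, hgood.on.spanProj_idem f,
    hgood.on.norm_spanProj_le f, ?_⟩⟩
  exact h𝓑.norm_sub_spanProj_near_le hon hsupp (by positivity) hτ hres hf

theorem norm_spanProj_filter_le {I : Set ℤ} {A : L2Z →ₗ[ℝ] L2Z} {𝓑 : Finset (L2Z × ℝ)}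
    (h : IsEigenbasis I A 𝓑) (P : L2Z × ℝ → Prop) [DecidablePred P] {w : L2Z} (hw : Supp I w)
    {e γ η : ℝ} (hγ : 0 < γ) (hgap : ∀ a ∈ 𝓑, P a → γ ≤ |a.2 - e|) (hη : ‖A w - e • w‖ ≤ η) :
    ‖spanProj (𝓑.filter P) w‖ ≤ η / γ := by
  rw [le_div_iff₀ hγ]
  refine (mul_comm _ _).trans_le (le_trans (le_of_sq_le_sq ?_ (norm_nonneg _)) hη)
  rw [mul_pow, (h.on.subset (Finset.filter_subset _ _)).norm_sq_spanProj,
    h.norm_apply_sub_sq hw, Finset.mul_sum, Finset.sum_filter]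
  refine Finset.sum_le_sum fun a ha => ?_
  split_ifs with hP
  · rw [← sq_abs (a.2 - e)]
    exact mul_le_mul_of_nonneg_right (pow_le_pow_left₀ hγ.le (hgap a ha hP) 2) (sq_nonneg _)
  · positivity

/-- Cutting off an eigenfunction where it is small. -/
theorem norm_ham_proj_sub_le {U : ℤ → ℝ} {B : ℝ} (hU : ∀ n, |U n| ≤ B) {x y : ℤ} (hxy : x < y)
    {u : L2Z} {e η : ℝ} (heig : ∀ n, x ≤ n → n < y → ham U u n = e * u n)
    (h1 : |u (x - 1)| ≤ η) (h2 : |u x| ≤ η) (h3 : |u (y - 1)| ≤ η) (h4 : |u y| ≤ η) :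
    ‖ham U (proj (Set.Ico x y) u) - e • proj (Set.Ico x y) u‖ ≤ 4 * η := by
  have key : ham U (proj (Set.Ico x y) u) - e • proj (Set.Ico x y) u =
      u x • single (x - 1) - u (x - 1) • single x - u y • single (y - 1) + u (y - 1) • single y := by
    refine ext fun n => ?_
    classical
    have h0 := heig n
    simp only [sub_apply, add_apply, smul_apply, ham_apply hU, single_apply, proj_apply,
      Set.mem_Ico] at h0 ⊢
    rcases lt_trichotomy n (x - 1) with h | h | h
    · simp (disch := omega) only [if_neg]; ring
    · subst h
      simp [hxy, show x - 1 ≠ y - 1 by omega, show x - 1 ≠ y by omega]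
    · rcases lt_trichotomy n y with h' | h' | h'
      · have h0 := h0 (by omega) h'
        rw [if_pos (show x ≤ n ∧ n < y by omega), if_neg (show ¬ n = x - 1 by omega),
          if_neg (show ¬ n = y by omega)]
        have e1 : (if x ≤ n + 1 ∧ n + 1 < y then u (n + 1) else 0)
            = u (n + 1) - u y * if n = y - 1 then 1 else 0 := by
          split_ifs with a b b
          · omega
          · ring
          · rw [b]; simp
          · omega
        have e2 : (if x ≤ n - 1 ∧ n - 1 < y then u (n - 1) else 0)
            = u (n - 1) - u (x - 1) * if n = x then 1 else 0 := by
          split_ifs with a b b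
          · omega
          · ring
          · rw [b]; simp
          · omega
        rw [e1, e2]; linarith
      · subst h'
        simp [show x ≤ n - 1 by omega, show n ≠ x - 1 by omega, show n ≠ x by omega,
          show n ≠ n - 1 by omega]
      · simp (disch := omega) only [if_neg]; ring
  rw [key]
  refine (norm_add_le _ _).trans ?_
  have e1 := norm_sub_le (u x • single (x - 1) - u (x - 1) • single x) (u y • single (y - 1))
  have e2 := norm_sub_le (u x • single (x - 1)) (u (x - 1) • single x)
  simp only [norm_smul, norm_single, mul_one, Real.norm_eq_abs] at e1 e2 ⊢
  linarith

end Update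

section Transfer

/-! ### Transferring clusters between potentials -/

theorem circ_eq_ham {U : ℤ → ℝ} {B : ℝ} (hU : ∀ n, |U n| ≤ B) {x y c d : ℤ} (hx : x < c)
    (hcd : c < d) (hy : d < y) {w : L2Z} (hw : Supp (Set.Ico c d) w) :
    circ x y U w = ham U w := by
  have h := ham_sub_circ hU (by omega : x < y) (hw.mono (Set.Ico_subset_Ico hx.le hy.le))
  rw [hw x (fun h => by have := h.1; omega), hw (y - 1) (fun h => by have := h.2; omega),
    zero_smul, zero_smul, add_zero, sub_eq_zero] at h
  exact h.symm

theorem ham_apply_of_circ {U : ℤ → ℝ} {B : ℝ} (hU : ∀ n, |U n| ≤ B) {x y : ℤ} (hxy : x < y)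
    {u : L2Z} (hu : Supp (Set.Ico x y) u) {e : ℝ} (heig : circ x y U u = e • u) {n : ℤ}
    (h1 : x < n) (h2 : n < y - 1) : ham U u n = e * u n := by
  have h := congrArg (fun w : L2Z => w n) (ham_sub_circ hU hxy hu)
  rw [heig] at h
  simp only [sub_apply, add_apply, smul_apply, single_apply] at h
  rw [if_neg (by omega), if_neg (by omega), if_neg (by omega), if_neg (by omega)] at h
  linarith

theorem spanProj_sum_smul {ι : Type*} (cl : Finset (L2Z × ℝ)) (s : Finset ι) (c : ι → ℝ)
    (w : ι → L2Z) : spanProj cl (∑ i ∈ s, c i • w i) = ∑ i ∈ s, c i • spanProj cl (w i) := by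
  simp only [spanProj, _root_.inner_sum, inner_smul_right, Finset.sum_smul, Finset.smul_sum,
    smul_smul]
  rw [Finset.sum_comm]

/-- A vector supported in the middle is a combination of eigenvectors of the outer circle with
energies in one set and of eigenvectors of the inner circle, if the eigenvectors of the outer
circle with other energies are small at two cuts. -/
theorem exists_capture {UA UB : ℤ → ℝ} {B : ℝ} (hUA : ∀ n, |UA n| ≤ B) (hUB : ∀ n, |UB n| ≤ B)
    {xA yA xB yB c d : ℤ} (hcd : c < d) (hxA : xA < c) (hyA : d < yA) (hxB : xB < c) (hyB : d < yB)
    (hUU : ∀ n ∈ Set.Ico c d, UB n = UA n) {𝓐 𝓑 : Finset (L2Z × ℝ)}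
    (h𝓐 : IsEigenbasis (Set.Ico xA yA) (circ xA yA UA) 𝓐)
    (h𝓑 : IsEigenbasis (Set.Ico xB yB) (circ xB yB UB) 𝓑)
    (PA PB : L2Z × ℝ → Prop) [DecidablePred PA] [DecidablePred PB] {η γ κ : ℝ} (hγ : 0 < γ)
    (hη : ∀ b ∈ 𝓑, ¬ PB b → |b.1 (c - 1)| ≤ η ∧ |b.1 c| ≤ η ∧ |b.1 (d - 1)| ≤ η ∧ |b.1 d| ≤ η)
    (hgapA : ∀ a ∈ 𝓐, ∀ b ∈ 𝓑, ¬ PA a → ¬ PB b → γ ≤ |a.2 - b.2|)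
    (hgapB : ∀ a ∈ 𝓑, ∀ b ∈ 𝓑, PB a → ¬ PB b → γ ≤ |a.2 - b.2|)
    (hη0 : 0 ≤ η) (hκ : 𝓑.card * (4 * η / γ) ≤ κ ^ 2) (hκ0 : 0 ≤ κ) (hκ1 : κ ≤ 1) {v : L2Z}
    (hv : Supp (Set.Ico c d) v) (hv1 : ‖v‖ ≤ 1) :
    ∃ fA fB, spanProj (𝓐.filter PA) fA = fA ∧ spanProj (𝓑.filter PB) fB = fB ∧ ‖fA‖ ≤ 1 ∧
      ‖fB‖ ≤ 1 ∧ ‖v - fA - fB‖ ≤ 2 * κ := by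
  set FA := 𝓐.filter PA
  set FB := 𝓑.filter PB
  set GB := 𝓑.filter fun b => ¬ PB b with hGB
  set I := Set.Ico c d
  have hFA : ON FA := h𝓐.on.subset (Finset.filter_subset _ _)
  have hFB : ON FB := h𝓑.on.subset (Finset.filter_subset _ _)
  have hIB : I ⊆ Set.Ico xB yB := Set.Ico_subset_Ico hxB.le hyB.le
  have hIA : I ⊆ Set.Ico xA yA := Set.Ico_subset_Ico hxA.le hyA.le
  set fB := spanProj FB v with hfB
  have hfB1 : ‖fB‖ ≤ 1 := (hFB.norm_spanProj_le v).trans hv1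
  have hP : v - fB = ∑ b ∈ GB, ⟪b.1, v⟫_ℝ • b.1 := h𝓑.sub_spanProj_filter PB (hv.mono hIB)
  set q := proj I (v - fB) with hq
  have hqs : Supp I q := supp_proj _ _
  have hqP : q = ∑ b ∈ GB, ⟪b.1, v⟫_ℝ • proj I b.1 := by
    rw [hq, hP, map_sum]; simp only [map_smul]
  have hcut : ∀ b ∈ GB, ‖ham UB (proj I b.1) - b.2 • proj I b.1‖ ≤ 4 * η := fun b hb => by
    rw [hGB, Finset.mem_filter] at hb
    obtain ⟨e1, e2, e3, e4⟩ := hη b hb.1 hb.2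
    exact norm_ham_proj_sub_le hUB hcd (fun n h1 h2 => ham_apply_of_circ hUB (by omega)
      (h𝓑.supp b hb.1) (h𝓑.eig b hb.1) (by omega) (by omega)) e1 e2 e3 e4
  have hsum : ∀ F : Finset (L2Z × ℝ), (∀ b ∈ GB, ‖spanProj F (proj I b.1)‖ ≤ 4 * η / γ) →
      ‖spanProj F q‖ ≤ κ ^ 2 := fun F hF => by
    rw [hqP, spanProj_sum_smul]
    refine (norm_sum_le _ _).trans (le_trans ?_ hκ)
    calc _ ≤ ∑ b ∈ GB, 4 * η / γ := Finset.sum_le_sum fun b hb => by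
          rw [norm_smul, Real.norm_eq_abs, ← one_mul (4 * η / γ)]
          refine mul_le_mul ?_ (hF b hb) (norm_nonneg _) zero_le_one
          exact (h𝓑.on.abs_inner_le v (Finset.mem_of_mem_filter b hb)).trans hv1
      _ ≤ _ := by
          rw [Finset.sum_const, nsmul_eq_mul]
          have : (GB.card : ℝ) ≤ 𝓑.card := by exact_mod_cast Finset.card_filter_le _ _
          gcongr
  have h1 : ‖q - spanProj FA q‖ ≤ κ ^ 2 := by
    rw [h𝓐.sub_spanProj_filter PA (hqs.mono hIA)]
    refine hsum _ fun b hb => ?_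
    refine norm_spanProj_filter_le h𝓐 _ ((supp_proj _ _).mono hIA) (e := b.2) hγ
      (fun a ha hPa => ?_) ?_
    · rw [hGB, Finset.mem_filter] at hb
      exact hgapA a ha b hb.1 hPa hb.2
    · rw [circ_eq_ham hUA hxA hcd hyA (supp_proj _ _), ← ham_congr hUB hUA hUU (supp_proj _ _)]
      exact hcut b hb
  have h2 : ‖spanProj FB q‖ ≤ κ ^ 2 := by
    refine hsum _ fun b hb => ?_
    refine norm_spanProj_filter_le h𝓑 _ ((supp_proj _ _).mono hIB) (e := b.2) hγ
      (fun a ha hPa => ?_) ?_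
    · rw [hGB, Finset.mem_filter] at hb
      exact hgapB a ha b hb.1 hPa hb.2
    · rw [circ_eq_ham hUB hxB hcd hyB (supp_proj _ _)]
      exact hcut b hb
  have h3 : ‖v - fB - q‖ ≤ κ := by
    have e1 : v - fB - q = -(fB - proj I fB) := by
      rw [hq, map_sub, hv.proj_eq]; abel
    have e2 : ⟪proj I fB, fB - proj I fB⟫_ℝ = 0 := by
      rw [inner_proj, map_sub, (supp_proj I fB).proj_eq, sub_self, inner_zero_right]
    have e3 : ‖v - fB - q‖ ^ 2 = ⟪fB, spanProj FB q⟫_ℝ := by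
      have e4 : ⟪fB, spanProj FB q⟫_ℝ = ⟪fB, q⟫_ℝ := by
        have := hFB.inner_spanProj_sub q v
        rw [inner_sub_right, sub_eq_zero] at this
        exact this.symm
      have e5 : ⟪fB, v - fB⟫_ℝ = 0 := hFB.inner_spanProj_sub v v
      have e6 : q = (v - fB) + (fB - proj I fB) := by
        rw [← neg_neg (fB - proj I fB), ← e1]; abel
      rw [e4, e6, inner_add_right, e5, zero_add, ← e6, e1, norm_neg,
        ← real_inner_self_eq_norm_sq, inner_sub_left, e2, sub_zero]
    have e7 : ‖v - fB - q‖ ^ 2 ≤ κ ^ 2 := by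
      rw [e3]
      refine (real_inner_le_norm _ _).trans ?_
      calc _ ≤ 1 * κ ^ 2 := mul_le_mul hfB1 h2 (norm_nonneg _) zero_le_one
        _ = _ := one_mul _
    exact le_of_sq_le_sq e7 hκ0
  refine ⟨spanProj FA q, fB, hFA.spanProj_idem q, hFB.spanProj_idem v, ?_, hfB1, ?_⟩
  · refine (hFA.norm_spanProj_le q).trans ((norm_proj_le _ _).trans ?_)
    exact (hFB.norm_sub_spanProj_le v).trans hv1
  · have : v - spanProj FA q - fB = (v - fB - q) + (q - spanProj FA q) := by abel
    rw [this]
    have hκ2 : κ ^ 2 ≤ κ := by nlinarith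
    exact (norm_add_le _ _).trans (by linarith)

/-- A finite set leaves a gap in an interval. -/
theorem exists_slot (Y : Finset ℝ) {lo hi γ : ℝ} (hγ : 0 < γ) (hle : (Y.card + 1) * γ ≤ hi - lo) :
    ∃ d, lo ≤ d ∧ d ≤ hi ∧ ∀ y ∈ Y, y < d → y ≤ d - γ := by
  by_contra! hcon
  have h : ∀ k ∈ Finset.range (Y.card + 1), ∃ y ∈ Y, y < hi - k * γ ∧ hi - k * γ - γ < y :=
    fun k hk => by
      rw [Finset.mem_range] at hk
      have hk' : (k : ℝ) ≤ Y.card := by exact_mod_cast Nat.lt_succ_iff.1 hk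
      refine hcon _ ?_ ?_ <;> nlinarith
  choose! f hf1 hf2 hf3 using h
  have := Finset.card_le_card_of_injOn f hf1 (s := Finset.range (Y.card + 1)) (t := Y)
    fun i hi j hj hij => by
      have a1 := hf2 i hi; have a2 := hf3 i hi; have b1 := hf2 j hj; have b2 := hf3 j hj
      rw [hij] at a1 a2
      have c1 : (j : ℝ) < i + 1 := by nlinarith
      have c2 : (i : ℝ) < j + 1 := by nlinarith
      have c1' : j < i + 1 := by exact_mod_cast c1
      have c2' : i < j + 1 := by exact_mod_cast c2
      omega
  simp at this

/-- A multiple of `θ` can be chosen away from a finite set. -/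
theorem exists_grid (Y : Finset ℝ) {θ : ℝ} (hθ : 0 < θ) :
    ∃ k : ℕ, k ≤ Y.card ∧ ∀ y ∈ Y, θ / 2 ≤ |y + k * θ| := by
  by_contra! hcon
  have h : ∀ k ∈ Finset.range (Y.card + 1), ∃ y ∈ Y, |y + k * θ| < θ / 2 := fun k hk =>
    hcon k (Nat.lt_succ_iff.1 (Finset.mem_range.1 hk))
  choose! f hf1 hf2 using h
  have := Finset.card_le_card_of_injOn f hf1 (s := Finset.range (Y.card + 1)) (t := Y)
    fun i hi j hj hij => by
      have a1 := abs_lt.1 (hf2 i hi); have b1 := abs_lt.1 (hf2 j hj)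
      rw [hij] at a1
      have c1 : (j : ℝ) < i + 1 := by nlinarith
      have c2 : (i : ℝ) < j + 1 := by nlinarith
      have c1' : j < i + 1 := by exact_mod_cast c1
      have c2' : i < j + 1 := by exact_mod_cast c2
      omega
  simp at this

end Transfer

section Scales

/-! ### Large scales -/

section Numerics
variable {p : ℕ}

theorem cast_pos_of_large (hp : 10000 ≤ p) : (0 : ℝ) < p := by exact_mod_cast (by omega : 0 < p)

theorem inv_pos_of_large (hp : 10000 ≤ p) : (0 : ℝ) < (p : ℝ)⁻¹ := inv_pos.2 (cast_pos_of_large hp)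

theorem inv_le_of_large (hp : 10000 ≤ p) : (p : ℝ)⁻¹ ≤ 1 / 10000 := by
  rw [inv_eq_one_div]
  exact one_div_le_one_div_of_le (by norm_num) (by exact_mod_cast hp)

theorem pow_mul_inv_pow (hp : 10000 ≤ p) (k m : ℕ) :
    (p : ℝ) ^ k * (p : ℝ)⁻¹ ^ (k + m) = (p : ℝ)⁻¹ ^ m := by
  have := (cast_pos_of_large hp).ne'
  rw [pow_add, ← mul_assoc, ← mul_pow, mul_inv_cancel₀ this, one_pow, one_mul]

theorem inv_pow_le (hp : 10000 ≤ p) {m k : ℕ} (h : m ≤ k) :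
    (p : ℝ)⁻¹ ^ k ≤ (p : ℝ)⁻¹ ^ m :=
  pow_le_pow_of_le_one (inv_pos_of_large hp).le
    ((inv_le_of_large hp).trans (by norm_num)) h

theorem mul_inv_pow_le (hp : 10000 ≤ p) {c : ℝ} (hc : c ≤ 10000) {m k : ℕ} (h : m + 1 ≤ k) :
    c * (p : ℝ)⁻¹ ^ k ≤ (p : ℝ)⁻¹ ^ m := by
  have h0 := inv_pos_of_large hp
  have h1 := inv_le_of_large hp
  calc c * (p : ℝ)⁻¹ ^ k ≤ 10000 * (p : ℝ)⁻¹ ^ k := by gcongr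
    _ ≤ 10000 * (p : ℝ)⁻¹ ^ (m + 1) := by gcongr 10000 * ?_; exact inv_pow_le hp h
    _ = (10000 * (p : ℝ)⁻¹) * (p : ℝ)⁻¹ ^ m := by ring
    _ ≤ 1 * (p : ℝ)⁻¹ ^ m := by gcongr; linarith
    _ = _ := one_mul _

end Numerics

/-- Outside small neighbourhoods of the finite set `S` there are quantitative gaps. -/
def Thin (V : ℤ → ℝ) (p : ℕ) (S : Finset ℝ) : Prop :=
  ∀ E d, (p : ℝ)⁻¹ ^ 10 ≤ d → (∀ σ ∈ S, d ≤ |E - σ|) → Gap V E (d * (p : ℝ)⁻¹)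

/-- The energy `E` is far from the shifted set `S + μ`. -/
def Far (p : ℕ) (S : Finset ℝ) (μ E : ℝ) : Prop :=
  ∀ σ ∈ S, (p : ℝ)⁻¹ ^ 5 / 64 ≤ |E - (σ + μ)|

theorem Thin.gap_add {V : ℤ → ℝ} {B : ℝ} {p : ℕ} {S : Finset ℝ} (h : Thin V p S)
    (hp : 10000 ≤ p) (hV : ∀ n, |V n| ≤ B) {μ E : ℝ} (hE : Far p S μ E) :
    Gap (fun n => V n + μ) E ((p : ℝ)⁻¹ ^ 7) := by
  intro a b
  have h1 := h (E - μ) ((p : ℝ)⁻¹ ^ 5 / 64) (by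
    have := mul_inv_pow_le hp (c := 64) (by norm_num) (m := 5) (k := 10) (by norm_num)
    linarith) (fun σ hσ => by
    have := hE σ hσ
    rwa [show E - μ - σ = E - (σ + μ) by ring])
  refine ((h1 a b).add_const hV).mono subset_rfl ?_
  have := mul_inv_pow_le hp (c := 64) (by norm_num) (m := 6) (k := 7) (by norm_num)
  have e : (p : ℝ)⁻¹ ^ 5 / 64 * (p : ℝ)⁻¹ = (p : ℝ)⁻¹ ^ 6 / 64 := by ring
  rw [e]; linarith

/-- The period is so large that all the estimates of the inductive step hold. -/
structure Large (B : ℝ) (p : ℕ) : Prop where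
  le : 10000 ≤ p
  bound : (2 * B + 9) * (p : ℝ)⁻¹ ≤ 1 / 4
  exp : 32 * Real.exp (-((p : ℝ)⁻¹ ^ 7 * (p : ℝ) ^ 29 / 8)) ≤ (p : ℝ)⁻¹ ^ 6300

theorem tail_of_far {V : ℤ → ℝ} {B : ℝ} {p : ℕ} {S : Finset ℝ} (h : Thin V p S)
    (hp : Large B p) (hV : ∀ n, |V n| ≤ B) (hper : ∀ n (k : ℤ), V (n + k * p) = V n) {l : ℤ}
    (hl : l = (p : ℤ) ^ 29) {x y k : ℤ} (hxy : y - x = k * p) (hlN : l + 2 ≤ y - x) {U : ℤ → ℝ}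
    (hU : ∀ n, |U n| ≤ B) {μ : ℝ} (hUV1 : ∀ n, x ≤ n → n ≤ x + l → U n = V n + μ)
    (hUV2 : ∀ n, y - l ≤ n → n < y → U n = V n + μ) {E : ℝ} (hE : Far p S μ E) {u : L2Z}
    (hu : Supp (Set.Ico x y) u) (heig : circ x y U u = E • u) (hu1 : ‖u‖ = 1) :
    |u x| ≤ (p : ℝ)⁻¹ ^ 6300 / 4 ∧ |u (y - 1)| ≤ (p : ℝ)⁻¹ ^ 6300 / 4 := by
  have hq := inv_pos_of_large hp.le
  have hq1 := inv_le_of_large hp.le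
  have hl1 : 1 ≤ l := by
    rw [hl]; exact_mod_cast Nat.one_le_pow _ _ (by have := hp.le; omega)
  have key := circ_tail_le (W := fun n => V n + μ) (B' := B + |μ|) hU
    (fun n => (abs_add_le _ _).trans (by gcongr; exact hV n)) hl1 hlN hUV2
    (fun n h1 h2 => by
      rw [hUV1 _ (by omega) (by omega)]
      congr 1
      rw [← hper n (-k)]
      congr 1
      rw [hxy]; ring) (pow_pos hq 7) (pow_le_one₀ hq.le (by linarith))
    ((h.gap_add hp.le hV hE _ _).mono (S' := Set.Ioo (y - l) (y + l))
      Set.Ioo_subset_Ico_self le_rfl) hu heig hu1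
  have hexp := hp.exp
  rw [show (l : ℝ) = (p : ℝ) ^ 29 by rw [hl]; push_cast; rfl] at key
  exact ⟨key.1.trans (by linarith), key.2.trans (by linarith)⟩

/-- A small shift keeps a finite set of numbers away from zero. -/
theorem exists_shift {p : ℕ} (hp : 10000 ≤ p) (Y : Finset ℝ) (hY : Y.card ≤ p ^ 4) :
    ∃ lam : ℝ, 0 ≤ lam ∧ lam ≤ (p : ℝ)⁻¹ / 2 ∧ ∀ y ∈ Y, (p : ℝ)⁻¹ ^ 5 / 4 ≤ |y + lam| := by
  have hq := inv_pos_of_large hp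
  obtain ⟨k, hk, h⟩ := exists_grid Y (θ := (p : ℝ)⁻¹ ^ 5 / 2) (by positivity)
  refine ⟨k * ((p : ℝ)⁻¹ ^ 5 / 2), by positivity, ?_, fun y hy => by linarith [h y hy]⟩
  have h1 : (k : ℝ) ≤ (p : ℝ) ^ 4 := by exact_mod_cast hk.trans hY
  have h2 := pow_mul_inv_pow hp 4 1
  rw [pow_one] at h2
  calc (k : ℝ) * ((p : ℝ)⁻¹ ^ 5 / 2) ≤ (p : ℝ) ^ 4 * ((p : ℝ)⁻¹ ^ 5 / 2) := by gcongr
    _ = (p : ℝ)⁻¹ / 2 := by rw [mul_div_assoc', h2]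

theorem Good.persist {U G : ℤ → ℝ} {B B' : ℝ} (hU : ∀ n, |U n| ≤ B) (hG : ∀ n, |G n| ≤ B')
    {x y x' y' : ℤ} (hx : x' ≤ x) (hy : y ≤ y') (hxy : x' < y') (hUG : ∀ n ∈ Set.Ico x y, U n = G n)
    {cl : Finset (L2Z × ℝ)} {τ g C r : ℝ} (h : Good U x y cl τ g C)
    (hsep : ∀ a ∈ cl, ∀ w, Supp (Set.Ico x' y') w → (∀ b ∈ cl, ⟪b.1, w⟫_ℝ = 0) →
      r * ‖w‖ ≤ ‖circ x' y' G w - a.2 • w‖) : Good G x' y' cl τ (r / 5) C where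
  supp a ha := (h.supp a ha).mono (Set.Ico_subset_Ico hx hy)
  on := h.on
  abs_le := h.abs_le
  res a ha := by rw [← ham_congr hU hG hUG (h.supp a ha)]; exact h.res a ha
  sep a ha w hw hb := by
    have h1 := hsep a ha w hw hb
    have h2 := norm_circ_sub_le hG hxy hw a.2
    linarith

/-- A slot for a threshold on the distances between two finite sets of energies. -/
theorem exists_threshold {p : ℕ} (hp : 10000 ≤ p) (S : Finset ℝ) (hS : S.card ≤ p ^ 2)
    (𝓑 : Finset (L2Z × ℝ)) (h𝓑 : 𝓑.card ≤ p ^ 31) (μ : ℝ) {lo hi : ℝ}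
    (hle : (p : ℝ)⁻¹ ^ 5 / 64 ≤ hi - lo) :
    ∃ d, lo ≤ d ∧ d ≤ hi ∧ ∀ σ ∈ S, ∀ a ∈ 𝓑, |a.2 - (σ + μ)| < d →
      |a.2 - (σ + μ)| ≤ d - (p : ℝ)⁻¹ ^ 40 := by
  classical
  have hq := inv_pos_of_large hp
  obtain ⟨d, h1, h2, h3⟩ := exists_slot ((S ×ˢ 𝓑).image fun z => |z.2.2 - (z.1 + μ)|)
    (lo := lo) (hi := hi) (γ := (p : ℝ)⁻¹ ^ 40) (by positivity) (by
      refine le_trans ?_ hle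
      have e1 : (((S ×ˢ 𝓑).image fun z => |z.2.2 - (z.1 + μ)|).card : ℝ) ≤ (p : ℝ) ^ 33 := by
        have : ((S ×ˢ 𝓑).image fun z => |z.2.2 - (z.1 + μ)|).card ≤ p ^ 33 := by
          refine Finset.card_image_le.trans ?_
          rw [Finset.card_product]
          calc _ ≤ p ^ 2 * p ^ 31 := by gcongr
            _ = _ := by ring
        exact_mod_cast this
      have e2 := pow_mul_inv_pow hp 33 7
      have e3 := mul_inv_pow_le hp (c := 128) (by norm_num) (m := 5) (k := 7) (by norm_num)
      have e4 := inv_pow_le hp (m := 7) (k := 40) (by norm_num)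
      calc _ ≤ ((p : ℝ) ^ 33 + 1) * (p : ℝ)⁻¹ ^ 40 := by gcongr
        _ = (p : ℝ)⁻¹ ^ 7 + (p : ℝ)⁻¹ ^ 40 := by rw [add_mul, one_mul]; rw [← e2]
        _ ≤ _ := by linarith)
  refine ⟨d, h1, h2, fun σ hσ a ha hlt => h3 _ ?_ hlt⟩
  exact Finset.mem_image_of_mem (fun z : ℝ × (L2Z × ℝ) => |z.2.2 - (z.1 + μ)|)
    (Finset.mk_mem_product hσ ha)

end Scales

section Coupling

/-! ### Coupling two scales -/

/-- Every vector in the span of `cl` is close to one in the span of `cl'`. -/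
def Approx (cl cl' : Finset (L2Z × ℝ)) (κ : ℝ) : Prop :=
  ∀ f, spanProj cl f = f → ∃ f', spanProj cl' f' = f' ∧ ‖f'‖ ≤ ‖f‖ ∧ ‖f - f'‖ ≤ κ * ‖f‖

theorem abs_add_le_of_inv {V : ℤ → ℝ} {B q μ : ℝ} (hV : ∀ n, |V n| ≤ B - 2 * q) (h0 : 0 ≤ μ)
    (h1 : μ ≤ q) (n : ℤ) : |V n + μ| ≤ B - q := by
  have := abs_add_le (V n) μ
  rw [abs_of_nonneg h0] at this
  linarith [hV n]

/-- A positive power of a large number dominates. -/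
theorem large_geometry {p : ℕ} (hp : 10000 ≤ p) {l : ℤ} (hl : l = (p : ℤ) ^ 29) :
    1 ≤ l ∧ (p : ℤ) ≤ l ∧ 10000 * l ≤ l * p := by
  have hp1 : 1 ≤ p := by omega
  have h1 : p ≤ p ^ 29 := Nat.le_self_pow (by norm_num) p
  refine ⟨?_, ?_, ?_⟩
  · rw [hl]; exact_mod_cast Nat.one_le_pow _ _ hp1
  · rw [hl]; exact_mod_cast h1
  · have h3 : (0 : ℤ) ≤ l := by rw [hl]; positivity
    have h4 : (10000 : ℤ) ≤ p := by exact_mod_cast hp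
    nlinarith

/-- Cell lengths below `9 * p ^ 30`. -/
theorem exists_length {p : ℕ} (hp : 10000 ≤ p) {l : ℤ} (hl : l = (p : ℤ) ^ 29) {c : ℤ}
    (hc : 0 ≤ c) (hc8 : c ≤ 8) : ∃ N : ℕ, (p : ℤ) + c * (l * p) = N ∧ N ≤ p ^ 31 := by
  obtain ⟨h1, h2, h3⟩ := large_geometry hp hl
  have h4 : l * p = (p : ℤ) ^ 30 := by rw [hl]; ring
  have h0 : (0 : ℤ) < p := by exact_mod_cast (by omega : 0 < p)
  refine ⟨((p : ℤ) + c * (l * p)).toNat, (Int.toNat_of_nonneg (by positivity)).symm, ?_⟩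
  have h5 : (p : ℤ) + c * (l * p) ≤ (p : ℤ) ^ 31 := by
    rw [h4, show (p : ℤ) ^ 31 = p ^ 30 * p by ring]
    have h6 : (p : ℤ) ≤ p ^ 30 := by rw [← h4]; omega
    have h7 : (10000 : ℤ) ≤ p := by exact_mod_cast hp
    nlinarith
  have h6 : ((p ^ 31 : ℕ) : ℤ) = (p : ℤ) ^ 31 := by push_cast; rfl
  omega

variable {B : ℝ} {p : ℕ} {V : ℤ → ℝ} {x : ℤ} {S : Finset ℝ} {cls : ℕ → Finset (L2Z × ℝ)} {K : ℕ}

open scoped Classical in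
set_option maxHeartbeats 1000000 in
theorem exists_inner_step (hp : Large B p) (hV : ∀ n, |V n| ≤ B - 2 * (p : ℝ)⁻¹)
    (hper : ∀ n (k : ℤ), V (n + k * p) = V n) (hS : S.card ≤ p ^ 2) (hthin : Thin V p S)
    (hgood : ∀ j < K, Good V x (x + p) (cls j) ((p : ℝ)⁻¹ ^ 200) ((p : ℝ)⁻¹ ^ 20) (B + 4))
    (hcard : ∑ j ∈ Finset.range K, (cls j).card ≤ p ^ 2) {l : ℤ} (hl : l = (p : ℤ) ^ 29)
    {x' y' : ℤ} (hx' : x' = x - 2 * (l * p)) (hy' : y' = x + p + 2 * (l * p)) :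
    ∃ μ, 0 ≤ μ ∧ μ ≤ (p : ℝ)⁻¹ ∧ ∃ (cls' : ℕ → Finset (L2Z × ℝ)) (𝓐 : Finset (L2Z × ℝ)) (d : ℝ),
      (p : ℝ)⁻¹ ^ 5 / 64 ≤ d ∧ d ≤ (p : ℝ)⁻¹ ^ 5 / 32 ∧
      IsEigenbasis (Set.Ico x' y') (circ x' y' (glue x (x + p) V fun n => V n + μ)) 𝓐 ∧
      𝓐.card ≤ p ^ 31 ∧
      Good (glue x (x + p) V fun n => V n + μ) x' y'
        (𝓐.filter fun a => ∀ σ ∈ S, d ≤ |a.2 - (σ + μ)|)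
        ((p : ℝ)⁻¹ ^ 6300) ((p : ℝ)⁻¹ ^ 115) (B + 4) ∧
      ∀ j < K, Good (glue x (x + p) V fun n => V n + μ) x' y' (cls' j)
          ((p : ℝ)⁻¹ ^ 6300) ((p : ℝ)⁻¹ ^ 115) (B + 4) ∧
        (cls' j).card ≤ (cls j).card ∧ Approx (cls j) (cls' j) (p : ℝ)⁻¹ := by
  set q := (p : ℝ)⁻¹ with hqdef
  have hp0 := hp.le
  have hq : 0 < q := inv_pos_of_large hp0
  have hq1 : q ≤ 1 / 10000 := inv_le_of_large hp0
  obtain ⟨hl1, hpl, hlp⟩ := large_geometry hp0 hl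
  have hpz : (0 : ℤ) < p := by exact_mod_cast (by omega : 0 < p)
  obtain ⟨N, hN, hNle⟩ := exists_length hp0 hl (c := 4) (by norm_num) (by norm_num)
  have hNle' : (N : ℝ) ≤ (p : ℝ) ^ 31 := by exact_mod_cast hNle
  have hyx : y' - x' = N := by rw [← hN, hx', hy']; ring
  have hVB : ∀ n, |V n| ≤ B := fun n => (hV n).trans (by linarith)
  have hcardj : ∀ j < K, (cls j).card ≤ p ^ 2 := fun j hj =>
    (Finset.single_le_sum (f := fun j => (cls j).card) (fun _ _ => Nat.zero_le _)
      (Finset.mem_range.2 hj)).trans hcard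
  -- the shift
  set 𝓔 := (Finset.range K).biUnion fun j => (cls j).image Prod.snd with h𝓔
  have h𝓔c : 𝓔.card ≤ p ^ 2 := by
    refine Finset.card_biUnion_le.trans ((Finset.sum_le_sum fun j _ => ?_).trans hcard)
    exact Finset.card_image_le
  obtain ⟨lam, hlam0, hlam1, hlam⟩ := exists_shift hp0 ((S ×ˢ 𝓔).image fun z => z.1 - z.2) (by
    refine Finset.card_image_le.trans ?_
    rw [Finset.card_product]
    calc _ ≤ p ^ 2 * p ^ 2 := by gcongr
      _ = _ := by ring)
  have hΔ1 : ((p ^ 2 : ℕ) : ℝ) * N * q ^ 40 ≤ q ^ 7 := by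
    rw [← pow_mul_inv_pow hp0 33 7]
    push_cast
    calc _ ≤ (p : ℝ) ^ 2 * p ^ 31 * q ^ 40 := by gcongr
      _ = _ := by ring
  have hq7 : q ^ 7 ≤ q ^ 5 / 32 := by
    have := mul_inv_pow_le hp0 (c := 32) (by norm_num) (m := 5) (k := 7) (by norm_num)
    rw [← hqdef] at this; linarith
  have hq5 : q ^ 5 ≤ q / 10000 := by
    have := mul_inv_pow_le hp0 (c := 10000) (by norm_num) (m := 1) (k := 5) (by norm_num)
    rw [← hqdef, pow_one] at this; linarith
  obtain ⟨s, hs0, hs1, hs⟩ := exists_persist (Finset.range K) cls (x := x) (y := x + p) (x' := x')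
    (y' := y') (by omega) (by omega) (by omega) hVB (U₀ := fun n => V n + lam)
    (fun n => (abs_add_le_of_inv hV hlam0 (by linarith) n).trans (by linarith)) (by positivity)
    (fun j hj => hgood j (Finset.mem_range.1 hj)) hcard hyx (Δ := q ^ 40) (δ := q ^ 21)
    (r := q ^ 114) (by positivity) (hΔ1.trans (by linarith)) (by positivity) (by positivity)
    (by
      have := mul_inv_pow_le hp0 (c := 2) (by norm_num) (m := 0) (k := 21) (by norm_num)
      rw [← hqdef, pow_zero] at this; linarith)
    (by
      have h1 := pow_mul_inv_pow hp0 31 83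
      rw [← hqdef] at h1
      have h2 := mul_inv_pow_le hp0 (c := 3) (by norm_num) (m := 82) (k := 83) (by norm_num)
      rw [← hqdef] at h2
      have h3 : 0 < q ^ 83 := by positivity
      calc (N : ℝ) * (2 * q ^ 114) ≤ (p : ℝ) ^ 31 * (2 * q ^ 114) := by gcongr
        _ = 2 * ((p : ℝ) ^ 31 * q ^ (31 + 83)) := by ring
        _ < 3 * q ^ 83 := by rw [h1]; linarith
        _ ≤ q ^ 82 := h2
        _ = _ := by ring)
    (by
      have h2 := mul_inv_pow_le hp0 (c := 4) (by norm_num) (m := 20) (k := 114) (by norm_num)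
      rw [← hqdef] at h2
      have h3 := hp.bound
      rw [← hqdef] at h3
      have h4 : 0 < q ^ 20 := by positivity
      calc q ^ 114 + (B + 5 + (B + 4)) * q ^ 21 = q ^ 114 + ((2 * B + 9) * q) * q ^ 20 := by ring
        _ ≤ q ^ 20 / 4 + 1 / 4 * q ^ 20 := by gcongr; linarith
        _ = _ := by ring)
  have hs2 : s ≤ q ^ 5 / 32 := hs1.trans (hΔ1.trans hq7)
  set μ := lam + s with hμ
  have hμ0 : 0 ≤ μ := by positivity
  have hμ1 : μ ≤ q := by linarith
  have hμfun : (fun n => V n + lam + s) = fun n => V n + μ := funext fun n => by rw [hμ]; ring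
  simp only [hμfun] at hs
  set G := glue x (x + p) V fun n => V n + μ with hG
  have hGB : ∀ n, |G n| ≤ B :=
    abs_glue_le hVB fun n => (abs_add_le_of_inv hV hμ0 hμ1 n).trans (by linarith)
  have hfarS : ∀ j < K, ∀ c ∈ cls j, ∀ σ ∈ S, 7 * q ^ 5 / 32 ≤ |c.2 - (σ + μ)| := by
    intro j hj c hc σ hσ
    have h1 := hlam (σ - c.2) (Finset.mem_image.2 ⟨(σ, c.2), Finset.mk_mem_product hσ
      (Finset.mem_biUnion.2 ⟨j, Finset.mem_range.2 hj, Finset.mem_image_of_mem _ hc⟩), rfl⟩)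
    have h2 := abs_add_le (σ + μ - c.2) (-s)
    rw [abs_neg, abs_of_nonneg hs0, show σ + μ - c.2 + -s = σ - c.2 + lam by rw [hμ]; ring,
      abs_sub_comm (σ + μ) c.2] at h2
    linarith
  obtain ⟨𝓐, h𝓐, h𝓐c, -⟩ := exists_isEigenbasis_circ hGB x' y'
  have h𝓐c' : 𝓐.card ≤ p ^ 31 := h𝓐c.trans (by omega)
  have h𝓐cR : (𝓐.card : ℝ) ≤ (p : ℝ) ^ 31 := by exact_mod_cast h𝓐c'
  have htail : ∀ a ∈ 𝓐, Far p S μ a.2 → |a.1 x'| ≤ q ^ 6300 / 4 ∧ |a.1 (y' - 1)| ≤ q ^ 6300 / 4 :=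
    fun a ha hfar => tail_of_far hthin hp hVB hper hl (k := 1 + 4 * l)
      (by rw [hx', hy']; ring) (by omega) hGB (fun n h1 h2 => glue_of_notMem (by omega))
      (fun n h1 h2 => glue_of_notMem (by omega)) hfar (h𝓐.supp a ha) (h𝓐.eig a ha) (h𝓐.on.1 a ha)
  obtain ⟨d, hd1, hd2, hd⟩ := exists_threshold hp0 S hS 𝓐 h𝓐c' μ (lo := q ^ 5 / 64)
    (hi := q ^ 5 / 32) (by rw [← hqdef]; linarith)
  have hFA := good_of_isEigenbasis hGB (by omega) h𝓐 (fun a => ∀ σ ∈ S, d ≤ |a.2 - (σ + μ)|)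
    (γ := q ^ 40) (β := q ^ 6300 / 4) (by positivity) (fun a _ b hb hPa hPb => by
      push Not at hPb
      obtain ⟨σ, hσ, hlt⟩ := hPb
      have h1 := hd σ hσ b hb hlt
      have h2 := hPa σ hσ
      have h3 := abs_sub_le a.2 b.2 (σ + μ)
      rw [← hqdef] at h1
      linarith) (fun a ha hPa => htail a ha fun σ hσ => hd1.trans (hPa σ hσ))
  have hupd : ∀ j < K, ∃ cl', Good G x' y' cl' (q ^ 6300) (q ^ 115) (B + 4) ∧
      cl'.card ≤ (cls j).card ∧ Approx (cls j) cl' q := by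
    intro j hj
    have hcj : ((cls j).card : ℝ) ≤ (p : ℝ) ^ 2 := by exact_mod_cast hcardj j hj
    have hg := hgood j hj
    have hsm : (cls j).card * q ^ 200 ≤ q ^ 198 := by
      rw [← pow_mul_inv_pow hp0 2 198]
      gcongr
    have hVG : ∀ n ∈ Set.Ico x (x + p), V n = G n := fun n hn => (glue_of_mem hn.1 hn.2).symm
    obtain ⟨cl', h1, h2, h3⟩ := exists_update hGB (by omega) h𝓐 hg.on
      (fun c hc => (hg.supp c hc).mono (Set.Ico_subset_Ico (by omega) (by omega)))
      (τ := q ^ 200) (r := q ^ 114) (β := q ^ 6300 / 4) (by positivity) (by positivity)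
      (fun c hc => by
        rw [circ_eq_ham hGB (by omega) (by omega) (by omega) (hg.supp c hc),
          ← ham_congr hVB hGB hVG (hg.supp c hc)]
        exact hg.res c hc)
      (hs j (Finset.mem_range.2 hj))
      (by
        have := mul_inv_pow_le hp0 (c := 16) (by norm_num) (m := 114) (k := 198) (by norm_num)
        rw [← hqdef] at this
        linarith)
      (by
        have e1 : 3 * (cls j).card * q ^ 200 / q ^ 114 ≤ 3 * q ^ 84 := by
          rw [div_le_iff₀ (by positivity)]
          calc _ ≤ 3 * q ^ 198 := by linarith
            _ = _ := by ring
        have e2 : 0 ≤ 3 * (cls j).card * q ^ 200 / q ^ 114 := by positivity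
        have e3 := pow_mul_inv_pow hp0 31 137
        rw [← hqdef] at e3
        have e4 := mul_inv_pow_le hp0 (c := 18) (by norm_num) (m := 0) (k := 137) (by norm_num)
        rw [← hqdef, pow_zero] at e4
        calc _ ≤ 2 * ((p : ℝ) ^ 31 * (3 * q ^ 84) ^ 2) := by gcongr
          _ = 18 * ((p : ℝ) ^ 31 * q ^ (31 + 137)) := by ring
          _ ≤ 1 := by rw [e3]; exact e4)
      (fun a ha ⟨c, hc, hac⟩ => htail a ha fun σ hσ => by
        have e1 := hfarS j hj c hc σ hσ
        have e2 := abs_sub_le c.2 a.2 (σ + μ)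
        rw [abs_sub_comm c.2 a.2] at e2
        have e3 := mul_inv_pow_le hp0 (c := 64) (by norm_num) (m := 5) (k := 198) (by norm_num)
        rw [← hqdef] at e3 ⊢
        have : 0 < q ^ 5 := by positivity
        linarith)
    refine ⟨cl', h1.mono (by linarith) ?_ le_rfl, h2, fun f hf => ?_⟩
    · have := mul_inv_pow_le hp0 (c := 40) (by norm_num) (m := 114) (k := 115) (by norm_num)
      rw [← hqdef] at this
      linarith
    · obtain ⟨f', e1, e2, e3⟩ := h3 f hf
      refine ⟨f', e1, e2, e3.trans ?_⟩
      refine mul_le_mul_of_nonneg_right ?_ (norm_nonneg _)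
      have e4 := mul_inv_pow_le hp0 (c := 4) (by norm_num) (m := 1) (k := 84) (by norm_num)
      rw [← hqdef, pow_one] at e4
      refine le_trans ?_ e4
      rw [mul_div_assoc', div_le_iff₀ (by positivity)]
      calc _ ≤ q ^ 198 := hsm
        _ = _ := by ring
  choose! cls' hcls' using hupd
  refine ⟨μ, hμ0, hμ1, cls', 𝓐, d, hd1, hd2, h𝓐, h𝓐c', hFA.mono (by linarith) ?_ le_rfl, hcls'⟩
  have := mul_inv_pow_le hp0 (c := 5) (by norm_num) (m := 40) (k := 115) (by norm_num)
  rw [← hqdef] at this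
  linarith

end Coupling

section Capture

/-! ### Capturing vectors -/

variable {B : ℝ} {p : ℕ} {V : ℤ → ℝ} {x : ℤ} {S : Finset ℝ} {cls : ℕ → Finset (L2Z × ℝ)} {K : ℕ}

/-- Eigenfunctions with energy in a gap are small at an interior point. -/
theorem abs_apply_le_of_far (hp : Large B p) {U : ℤ → ℝ} (hU : ∀ n, |U n| ≤ B)
    (hV : ∀ n, |V n| ≤ B) (hthin : Thin V p S) {l : ℤ} (hl : l = (p : ℤ) ^ 29) {z X Y : ℤ}
    (hz1 : X < z - l) (hz2 : z + l < Y - 1) {μ : ℝ}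
    (hUV : ∀ n ∈ Set.Ioo (z - l) (z + l), U n = V n + μ) {E : ℝ} (hE : Far p S μ E) {u : L2Z}
    (hu : Supp (Set.Ico X Y) u) (heig : circ X Y U u = E • u) (hu1 : ‖u‖ = 1) :
    |u z| ≤ (p : ℝ)⁻¹ ^ 6300 / 4 ∧ |u (z - 1)| ≤ (p : ℝ)⁻¹ ^ 6300 / 4 := by
  classical
  have hq := inv_pos_of_large hp.le
  have hq1 := inv_le_of_large hp.le
  have hl1 := (large_geometry hp.le hl).1
  have hV' : ∀ n, |V n + μ| ≤ B + |μ| := fun n => (abs_add_le _ _).trans (by gcongr; exact hV n)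
  have hgap : GapOn U (Set.Ioo (z - l) (z + l)) E ((p : ℝ)⁻¹ ^ 7) :=
    GapOn.congr hV' hU (fun n hn => (hUV n hn).symm)
      ((hthin.gap_add hp.le hV hE (z - l) (z + l)).mono Set.Ioo_subset_Ico_self le_rfl)
  have h0 : proj (Set.Icc (z - l) (z + l)) (ham U u - E • u) = 0 := ext fun n => by
    by_cases hn : n ∈ Set.Icc (z - l) (z + l)
    · rw [proj_of_mem hn, sub_apply, smul_apply,
        ham_apply_of_circ hU (by omega) hu heig (by have := hn.1; omega) (by have := hn.2; omega)]
      simp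
    · rw [proj_of_notMem hn]; simp
  have hexp := hp.exp
  have key : ∀ n, n = z ∨ n = z - 1 → |u n| ≤ (p : ℝ)⁻¹ ^ 6300 / 4 := by
    intro n hn
    have h1 := GapOn.apply_le hU hl1 (pow_pos hq 7) (pow_le_one₀ hq.le (by linarith)) hgap u hn
    rw [h0, norm_zero, mul_zero, zero_add,
      show (l : ℝ) = (p : ℝ) ^ 29 by rw [hl]; push_cast; rfl] at h1
    have h2 := norm_proj_le (Set.Icc (z - l) (z + l)) u
    rw [hu1] at h2
    have h3 := Real.exp_pos (-((p : ℝ)⁻¹ ^ 7 * (p : ℝ) ^ 29 / 8))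
    nlinarith
  exact ⟨key z (Or.inl rfl), key (z - 1) (Or.inr rfl)⟩

open scoped Classical in
set_option maxHeartbeats 1000000 in
theorem exists_outer_step (hp : Large B p) (hV : ∀ n, |V n| ≤ B - 2 * (p : ℝ)⁻¹)
    (hper : ∀ n (k : ℤ), V (n + k * p) = V n) (hS : S.card ≤ p ^ 2) (hthin : Thin V p S)
    {l : ℤ} (hl : l = (p : ℤ) ^ 29) {xA yA xB yB : ℤ} (hxA : xA = x - 2 * (l * p))
    (hyA : yA = x + p + 2 * (l * p)) (hxB : xB = x - 4 * (l * p)) (hyB : yB = x + p + 4 * (l * p))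
    {UA : ℤ → ℝ} (hUAB : ∀ n, |UA n| ≤ B) {μA : ℝ}
    (hUA : ∀ n, n < x ∨ x + p ≤ n → UA n = V n + μA)
    (hgood : ∀ j < K, Good UA xA yA (cls j) ((p : ℝ)⁻¹ ^ 6300) ((p : ℝ)⁻¹ ^ 115) (B + 4))
    (hcard : ∑ j ∈ Finset.range K, (cls j).card ≤ 2 * p ^ 31)
    {𝓐 : Finset (L2Z × ℝ)} (h𝓐 : IsEigenbasis (Set.Ico xA yA) (circ xA yA UA) 𝓐) {dA : ℝ}
    (hdA : dA ≤ (p : ℝ)⁻¹ ^ 5 / 32) :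
    ∃ μ, 0 ≤ μ ∧ μ ≤ (p : ℝ)⁻¹ ∧ (∀ E, Far p S μA E ∨ Far p S μ E) ∧
      ∃ cl : Finset (L2Z × ℝ), cl.card ≤ p ^ 31 ∧
      Good (glue xA yA UA fun n => V n + μ) xB yB cl
        ((p : ℝ)⁻¹ ^ 6300) ((p : ℝ)⁻¹ ^ 333) (B + 4) ∧
      (∀ j < K, Good (glue xA yA UA fun n => V n + μ) xB yB (cls j)
        ((p : ℝ)⁻¹ ^ 6300) ((p : ℝ)⁻¹ ^ 333) (B + 4)) ∧
      ∀ v, Supp (Set.Ico x (x + p)) v → ‖v‖ ≤ 1 → ∃ fA fB,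
        spanProj (𝓐.filter fun a => ∀ σ ∈ S, dA ≤ |a.2 - (σ + μA)|) fA = fA ∧
        spanProj cl fB = fB ∧ ‖fA‖ ≤ 1 ∧ ‖fB‖ ≤ 1 ∧ ‖v - fA - fB‖ ≤ (p : ℝ)⁻¹ := by
  set q := (p : ℝ)⁻¹ with hqdef
  have hp0 := hp.le
  have hq : 0 < q := inv_pos_of_large hp0
  have hq1 : q ≤ 1 / 10000 := inv_le_of_large hp0
  obtain ⟨hl1, hpl, hlp⟩ := large_geometry hp0 hl
  have hpz : (0 : ℤ) < p := by exact_mod_cast (by omega : 0 < p)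
  obtain ⟨N, hN, hNle⟩ := exists_length hp0 hl (c := 8) (by norm_num) (by norm_num)
  have hNle' : (N : ℝ) ≤ (p : ℝ) ^ 31 := by exact_mod_cast hNle
  have hyx : yB - xB = N := by rw [← hN, hxB, hyB]; ring
  have hVB : ∀ n, |V n| ≤ B := fun n => (hV n).trans (by linarith)
  obtain ⟨lam, hlam0, hlam1, hlam⟩ := exists_shift hp0 ((S ×ˢ S).image fun z => z.1 - z.2 - μA) (by
    refine Finset.card_image_le.trans ?_
    rw [Finset.card_product]
    calc _ ≤ p ^ 2 * p ^ 2 := by gcongr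
      _ = _ := by ring)
  have hΔ1 : ((2 * p ^ 31 : ℕ) : ℝ) * N * q ^ 68 ≤ 2 * q ^ 6 := by
    rw [← pow_mul_inv_pow hp0 62 6]
    push_cast
    calc _ ≤ 2 * (p : ℝ) ^ 31 * p ^ 31 * q ^ 68 := by gcongr
      _ = _ := by ring
  have hq7 : 2 * q ^ 6 ≤ q ^ 5 / 32 := by
    have := mul_inv_pow_le hp0 (c := 64) (by norm_num) (m := 5) (k := 6) (by norm_num)
    rw [← hqdef] at this; linarith
  have hq5 : q ^ 5 ≤ q / 10000 := by
    have := mul_inv_pow_le hp0 (c := 10000) (by norm_num) (m := 1) (k := 5) (by norm_num)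
    rw [← hqdef, pow_one] at this; linarith
  obtain ⟨s, hs0, hs1, hs⟩ := exists_persist (Finset.range K) cls (x := xA) (y := yA) (x' := xB)
    (y' := yB) (by omega) (by omega) (by omega) hUAB (U₀ := fun n => V n + lam)
    (fun n => (abs_add_le_of_inv hV hlam0 (by linarith) n).trans (by linarith)) (by positivity)
    (fun j hj => hgood j (Finset.mem_range.1 hj)) hcard hyx (Δ := q ^ 68) (δ := q ^ 116)
    (r := q ^ 332) (by positivity) (hΔ1.trans (by linarith)) (by positivity) (by positivity)
    (by
      have := mul_inv_pow_le hp0 (c := 2) (by norm_num) (m := 0) (k := 116) (by norm_num)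
      rw [← hqdef, pow_zero] at this; linarith)
    (by
      have h1 := pow_mul_inv_pow hp0 31 301
      rw [← hqdef] at h1
      have h2 := mul_inv_pow_le hp0 (c := 3) (by norm_num) (m := 300) (k := 301) (by norm_num)
      rw [← hqdef] at h2
      have h3 : 0 < q ^ 301 := by positivity
      calc (N : ℝ) * (2 * q ^ 332) ≤ (p : ℝ) ^ 31 * (2 * q ^ 332) := by gcongr
        _ = 2 * ((p : ℝ) ^ 31 * q ^ (31 + 301)) := by ring
        _ < 3 * q ^ 301 := by rw [h1]; linarith
        _ ≤ q ^ 300 := h2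
        _ = _ := by ring)
    (by
      have h2 := mul_inv_pow_le hp0 (c := 4) (by norm_num) (m := 115) (k := 332) (by norm_num)
      rw [← hqdef] at h2
      have h3 := hp.bound
      rw [← hqdef] at h3
      have h4 : 0 < q ^ 115 := by positivity
      calc q ^ 332 + (B + 5 + (B + 4)) * q ^ 116 = q ^ 332 + ((2 * B + 9) * q) * q ^ 115 := by ring
        _ ≤ q ^ 115 / 4 + 1 / 4 * q ^ 115 := by gcongr; linarith
        _ = _ := by ring)
  have hs2 : s ≤ q ^ 5 / 32 := hs1.trans (hΔ1.trans hq7)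
  set μ := lam + s with hμ
  have hμ0 : 0 ≤ μ := by positivity
  have hμ1 : μ ≤ q := by linarith
  have hμfun : (fun n => V n + lam + s) = fun n => V n + μ := funext fun n => by rw [hμ]; ring
  simp only [hμfun] at hs
  set G := glue xA yA UA fun n => V n + μ with hG
  have hGB : ∀ n, |G n| ≤ B :=
    abs_glue_le hUAB fun n => (abs_add_le_of_inv hV hμ0 hμ1 n).trans (by linarith)
  have hq50 : 0 < q ^ 5 := by positivity
  have hfar : ∀ E σ, σ ∈ S → |E - (σ + μA)| < q ^ 5 / 16 → Far p S μ E := by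
    intro E σ hσ hE σ' hσ'
    have h1 := hlam (σ' - σ - μA) (Finset.mem_image.2 ⟨(σ', σ), Finset.mk_mem_product hσ' hσ, rfl⟩)
    rw [← hqdef] at h1 ⊢
    have h2 : σ' - σ - μA + lam = -(E - (σ' + μ)) + (E - (σ + μA)) + (-s) := by rw [hμ]; ring
    have h3 := abs_add_le (-(E - (σ' + μ)) + (E - (σ + μA))) (-s)
    have h4 := abs_add_le (-(E - (σ' + μ))) (E - (σ + μA))
    rw [← h2, abs_neg, abs_of_nonneg hs0] at h3
    rw [abs_neg] at h4
    linarith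
  obtain ⟨𝓑, h𝓑, h𝓑c, -⟩ := exists_isEigenbasis_circ hGB xB yB
  have h𝓑c' : 𝓑.card ≤ p ^ 31 := h𝓑c.trans (by omega)
  have h𝓑cR : (𝓑.card : ℝ) ≤ (p : ℝ) ^ 31 := by exact_mod_cast h𝓑c'
  obtain ⟨d, hd1, hd2, hd⟩ := exists_threshold hp0 S hS 𝓑 h𝓑c' μA (lo := 3 * q ^ 5 / 64)
    (hi := q ^ 5 / 16) (by rw [← hqdef]; linarith)
  rw [← hqdef] at hd
  have hgapB : ∀ a ∈ 𝓑, ∀ b ∈ 𝓑, (∃ σ ∈ S, |a.2 - (σ + μA)| < d) →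
      (¬ ∃ σ ∈ S, |b.2 - (σ + μA)| < d) → q ^ 40 ≤ |a.2 - b.2| := by
    intro a ha b _ hPa hPb
    push Not at hPb
    obtain ⟨σ, hσ, hlt⟩ := hPa
    have h1 := hd σ hσ a ha hlt
    have h2 := hPb σ hσ
    have h3 := abs_sub_le b.2 a.2 (σ + μA)
    rw [abs_sub_comm b.2 a.2] at h3
    linarith
  have hFB := good_of_isEigenbasis hGB (by omega) h𝓑 (fun a => ∃ σ ∈ S, |a.2 - (σ + μA)| < d)
    (γ := q ^ 40) (β := q ^ 6300 / 4) (by positivity) hgapB (fun a ha ⟨σ, hσ, hlt⟩ =>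
      tail_of_far hthin hp hVB hper hl (k := 1 + 8 * l)
        (by rw [hxB, hyB]; ring) (by omega) hGB (fun n h1 h2 => glue_of_notMem (by omega))
        (fun n h1 h2 => glue_of_notMem (by omega)) (hfar _ σ hσ (by linarith))
        (h𝓑.supp a ha) (h𝓑.eig a ha) (h𝓑.on.1 a ha))
  have h333 : q ^ 333 ≤ q ^ 332 / 5 := by
    have := mul_inv_pow_le hp0 (c := 5) (by norm_num) (m := 332) (k := 333) (by norm_num)
    rw [← hqdef] at this; linarith
  refine ⟨μ, hμ0, hμ1, fun E => ?_, 𝓑.filter fun a => ∃ σ ∈ S, |a.2 - (σ + μA)| < d,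
    (Finset.card_filter_le _ _).trans h𝓑c', hFB.mono (by linarith) ?_ le_rfl, fun j hj => ?_,
    fun v hv hv1 => ?_⟩
  · by_cases h : ∃ σ ∈ S, |E - (σ + μA)| < q ^ 5 / 16
    · obtain ⟨σ, hσ, h⟩ := h
      exact Or.inr (hfar E σ hσ h)
    · push Not at h
      refine Or.inl fun σ hσ => ?_
      have := h σ hσ
      rw [← hqdef]; linarith
  · have := mul_inv_pow_le hp0 (c := 5) (by norm_num) (m := 40) (k := 333) (by norm_num)
    rw [← hqdef] at this
    linarith
  · exact (Good.persist hUAB hGB (by omega) (by omega) (by omega)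
      (fun n hn => (glue_of_mem hn.1 hn.2).symm) (hgood j hj)
      (hs j (Finset.mem_range.2 hj))).mono le_rfl h333 le_rfl
  · have hGV : ∀ n, (xA ≤ n ∧ n < x) ∨ (x + p ≤ n ∧ n < yA) → G n = V n + μA := fun n hn => by
      rw [hG, glue_of_mem (by omega) (by omega), hUA n (by omega)]
    obtain ⟨fA, fB, h1, h2, h3, h4, h5⟩ := exists_capture hUAB hGB (xA := xA) (yA := yA) (xB := xB)
      (yB := yB) (c := x - l * p) (d := x + p + l * p) (by omega) (by omega) (by omega) (by omega) (by omega)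
      (fun n hn => by have := hn.1; have := hn.2; exact glue_of_mem (by omega) (by omega)) h𝓐 h𝓑
      (fun a => ∀ σ ∈ S, dA ≤ |a.2 - (σ + μA)|) (fun a => ∃ σ ∈ S, |a.2 - (σ + μA)| < d)
      (η := q ^ 6300 / 4) (γ := q ^ 40) (κ := q / 2) (by positivity)
      (fun b hb hPb => by
        push Not at hPb
        have hE : Far p S μA b.2 := fun σ hσ => by
          have := hPb σ hσ
          rw [← hqdef]; linarith
        have e1 := abs_apply_le_of_far hp hGB hVB hthin hl (z := x - l * p) (X := xB) (Y := yB)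
          (by omega) (by omega) (fun n hn => hGV n (by have := hn.1; have := hn.2; omega)) hE
          (h𝓑.supp b hb) (h𝓑.eig b hb) (h𝓑.on.1 b hb)
        have e2 := abs_apply_le_of_far hp hGB hVB hthin hl (z := x + p + l * p) (X := xB) (Y := yB)
          (by omega) (by omega) (fun n hn => hGV n (by have := hn.1; have := hn.2; omega)) hE
          (h𝓑.supp b hb) (h𝓑.eig b hb) (h𝓑.on.1 b hb)
        exact ⟨e1.2, e1.1, e2.2, e2.1⟩)
      (fun a _ b _ hPa hPb => by
        push Not at hPa hPb
        obtain ⟨σ, hσ, hlt⟩ := hPa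
        have e1 := hPb σ hσ
        have e2 := abs_sub_le b.2 a.2 (σ + μA)
        rw [abs_sub_comm b.2 a.2] at e2
        have e3 := mul_inv_pow_le hp0 (c := 64) (by norm_num) (m := 5) (k := 40) (by norm_num)
        rw [← hqdef] at e3
        linarith) hgapB (by positivity)
      (by
        have e1 := pow_mul_inv_pow hp0 31 6269
        rw [← hqdef] at e1
        have e2 := mul_inv_pow_le hp0 (c := 4) (by norm_num) (m := 42) (k := 6269) (by norm_num)
        rw [← hqdef] at e2
        have e3 : 4 * (q ^ 6300 / 4) / q ^ 40 = q ^ 6300 / q ^ 40 := by ring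
        rw [e3, mul_div_assoc', div_le_iff₀ (by positivity)]
        calc _ ≤ (p : ℝ) ^ 31 * q ^ 6300 := by gcongr
          _ ≤ q ^ 42 / 4 := by
            rw [show 6300 = 31 + 6269 by norm_num, e1]; linarith
          _ = _ := by ring)
      (by positivity) (by linarith)
      (hv.mono (Set.Ico_subset_Ico (by omega) (by omega))) hv1
    exact ⟨fA, fB, h1, h2, h3, h4, h5.trans (by linarith)⟩

end Capture

section Step

/-! ### One step of the construction -/

/-- A periodic potential with small bands outside which there are large gaps, together with
clusters of approximate eigenvectors supported in one period. -/
structure Stage (B : ℝ) (p : ℕ) (V : ℤ → ℝ) (x : ℤ) (cls : ℕ → Finset (L2Z × ℝ)) (K : ℕ) :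
    Prop where
  bound : ∀ n, |V n| ≤ B - 2 * (p : ℝ)⁻¹
  per : ∀ n (k : ℤ), V (n + k * p) = V n
  thin : ∃ S : Finset ℝ, S.card ≤ p ^ 2 ∧ Thin V p S
  good : ∀ j < K, Good V x (x + p) (cls j) ((p : ℝ)⁻¹ ^ 200) ((p : ℝ)⁻¹ ^ 20) (B + 4)
  card : ∑ j ∈ Finset.range K, (cls j).card ≤ p ^ 2

/-- One stage refines another. -/
structure Refines (p : ℕ) (V : ℤ → ℝ) (x : ℤ) (cls : ℕ → Finset (L2Z × ℝ)) (K : ℕ)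
    (p' : ℕ) (V' : ℤ → ℝ) (x' : ℤ) (cls' : ℕ → Finset (L2Z × ℝ)) : Prop where
  two_mul_le : 2 * p ≤ p'
  left_le : x' ≤ x - p
  le_right : x + p + p ≤ x' + p'
  dist_le : ∀ n, |V' n - V n| ≤ (p : ℝ)⁻¹
  card_le : ∀ j < K, (cls' j).card ≤ (cls j).card
  approx : ∀ j < K, Approx (cls j) (cls' j) (p : ℝ)⁻¹
  capture : ∀ v, Supp (Set.Ico x (x + p)) v → ‖v‖ ≤ 1 → ∃ fA fB,
    spanProj (cls' K) fA = fA ∧ spanProj (cls' (K + 1)) fB = fB ∧ ‖fA‖ ≤ 1 ∧ ‖fB‖ ≤ 1 ∧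
    ‖v - fA - fB‖ ≤ (p : ℝ)⁻¹

/-- The periodic extension of a potential from a cell. -/
def periodize (x : ℤ) (N : ℕ) (U : ℤ → ℝ) (n : ℤ) : ℝ := U (x + (n - x) % N)

theorem periodize_add (x : ℤ) (N : ℕ) (U : ℤ → ℝ) (n k : ℤ) :
    periodize x N U (n + k * N) = periodize x N U n := by
  rw [periodize, periodize, show n + k * N - x = n - x + k * N by ring, Int.add_mul_emod_self_right]

theorem periodize_of_mem {x : ℤ} {N : ℕ} {U : ℤ → ℝ} {n : ℤ} (h1 : x ≤ n) (h2 : n < x + N) :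
    periodize x N U n = U n := by
  rw [periodize, Int.emod_eq_of_lt (by omega) (by omega), add_sub_cancel]

theorem abs_periodize_sub_le {x : ℤ} {N : ℕ} {U V : ℤ → ℝ}
    (hV : ∀ n (k : ℤ), V (n + k * N) = V n) {c : ℝ} (h : ∀ n, |U n - V n| ≤ c) (n : ℤ) :
    |periodize x N U n - V n| ≤ c := by
  have h1 : V n = V (x + (n - x) % N) := by
    rw [← hV (x + (n - x) % N) ((n - x) / N)]
    congr 1
    linarith [Int.emod_add_mul_ediv (n - x) N, mul_comm ((n - x) / (N : ℤ)) (N : ℤ)]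
  rw [h1]
  exact h _

variable {B : ℝ} {p : ℕ} {V : ℤ → ℝ} {x : ℤ} {S : Finset ℝ} {cls : ℕ → Finset (L2Z × ℝ)} {K : ℕ}

/-- The new period is still thin. -/
theorem exists_thin_step (hp : Large B p) (hV : ∀ n, |V n| ≤ B) (hthin : Thin V p S)
    {p' : ℕ} {l : ℤ} (hl : l = (p : ℤ) ^ 29) (hp' : (p' : ℤ) = p + 8 * (l * p)) (hp'le : p' ≤ p ^ 31)
    {V' : ℤ → ℝ} {B' : ℝ} (hV' : ∀ n, |V' n| ≤ B') (hper : ∀ n (k : ℤ), V' (n + k * p') = V' n)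
    {z₁ z₂ : ℤ} {μ₁ μ₂ : ℝ}
    (h1 : ∀ n ∈ Set.Ioo (z₁ - l) (z₁ + l), V' n = V n + μ₁)
    (h2 : ∀ n ∈ Set.Ioo (z₂ - l) (z₂ + l), V' n = V n + μ₂)
    (hfar : ∀ E, Far p S μ₁ E ∨ Far p S μ₂ E) :
    ∃ S' : Finset ℝ, S'.card ≤ p' ^ 2 ∧ Thin V' p' S' := by
  classical
  have hp0 := hp.le
  have hq := inv_pos_of_large hp.le
  have hq1 := inv_le_of_large hp.le
  obtain ⟨hl1, hpl, hlp⟩ := large_geometry hp0 hl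
  have hp'0 : 10000 ≤ p' := by omega
  have hq' := inv_pos_of_large hp'0
  have hqq : (p : ℝ)⁻¹ ^ 31 ≤ (p' : ℝ)⁻¹ := by
    rw [inv_pow]
    refine inv_anti₀ (cast_pos_of_large hp'0) ?_
    exact_mod_cast hp'le
  have hqq2 : (p' : ℝ)⁻¹ ≤ (p : ℝ)⁻¹ ^ 30 := by
    rw [inv_pow]
    refine inv_anti₀ (pow_pos (cast_pos_of_large hp0) _) ?_
    have : (p : ℤ) ^ 30 ≤ p' := by rw [hp', show (p : ℤ) ^ 30 = l * p by rw [hl]; ring]; omega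
    exact_mod_cast this
  have hgap : ∀ {z : ℤ} {μ : ℝ}, (∀ n ∈ Set.Ioo (z - l) (z + l), V' n = V n + μ) → ∀ E,
      Far p S μ E → GapOn V' (Set.Ioo (z - l) (z + l)) E ((p : ℝ)⁻¹ ^ 7) := fun {z μ} h E hE =>
    GapOn.congr (fun n => (abs_add_le (V n) μ).trans (add_le_add_left (hV n) _)) hV'
      (fun n hn => (h n hn).symm)
      ((hthin.gap_add hp.le hV hE (z - l) (z + l)).mono Set.Ioo_subset_Ico_self le_rfl)
  obtain ⟨S', hS', h⟩ := exists_thin hV' (N := p') (fun n => by simpa using hper n 1) {z₁, z₂} hl1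
    (by omega) (ρ := (p : ℝ)⁻¹ ^ 7) (by positivity) (pow_le_one₀ hq.le (by linarith))
    (d₀ := (p' : ℝ)⁻¹ ^ 10) (by positivity)
    (fun E => (hfar E).elim (fun hE => ⟨z₁, by simp, hgap h1 E hE⟩)
      (fun hE => ⟨z₂, by simp, hgap h2 E hE⟩)) (by
      have hexp := hp.exp
      have e0 := Real.exp_pos (-((p : ℝ)⁻¹ ^ 7 * (p : ℝ) ^ 29 / 8))
      rw [show (l : ℝ) = (p : ℝ) ^ 29 by rw [hl]; push_cast; rfl]
      set q := (p : ℝ)⁻¹ with hqdef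
      set e := Real.exp (-(q ^ 7 * (p : ℝ) ^ 29 / 8))
      have e1 : q ^ 6300 ≤ (p' : ℝ)⁻¹ ^ 10 := by
        calc q ^ 6300 ≤ q ^ 310 := inv_pow_le hp0 (by norm_num)
          _ = (q ^ 31) ^ 10 := by ring
          _ ≤ _ := by gcongr
      have e2 : 20 * e ≤ (p' : ℝ)⁻¹ ^ 10 := by linarith
      calc 24 * (4 * e) ^ 2 = 384 * e ^ 2 := by ring
        _ ≤ 400 * e ^ 2 := by have := sq_nonneg e; linarith
        _ = (20 * e) ^ 2 := by ring
        _ ≤ _ := by gcongr)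
  refine ⟨S', hS'.trans ?_, fun E d hd hSd => (h E d hd hSd).mono ?_⟩
  · have : ({z₁, z₂} : Finset ℤ).card ≤ 2 := Finset.card_le_two
    nlinarith
  · have hd0 : 0 < d := lt_of_lt_of_le (by positivity) hd
    have e1 := mul_inv_pow_le hp0 (c := 20) (by norm_num) (m := 7) (k := 30) (by norm_num)
    calc d * (p' : ℝ)⁻¹ ≤ d * ((p : ℝ)⁻¹ ^ 7 / 20) := by gcongr; linarith
      _ = _ := by ring

set_option maxHeartbeats 1000000 in
theorem Stage.step (hp : Large B p) (h : Stage B p V x cls K) :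
    ∃ p' V' x' cls', Stage B p' V' x' cls' (K + 2) ∧ Refines p V x cls K p' V' x' cls' := by
  classical
  obtain ⟨hV, hper, ⟨S, hS, hthin⟩, hgood, hcard⟩ := h
  have hp0 := hp.le
  have hq : 0 < (p : ℝ)⁻¹ := inv_pos_of_large hp0
  have hVB : ∀ n, |V n| ≤ B := fun n => (hV n).trans (by linarith)
  obtain ⟨l, hl⟩ : ∃ l, l = (p : ℤ) ^ 29 := ⟨_, rfl⟩
  obtain ⟨hl1, hpl, hlp⟩ := large_geometry hp0 hl
  obtain ⟨p', hp', hp'le⟩ := exists_length hp0 hl (c := 8) (by norm_num) (by norm_num)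
  obtain ⟨μA, hμA0, hμA1, clsA, 𝓐, dA, -, hdA, h𝓐, h𝓐c, hFA, hclsA⟩ :=
    exists_inner_step hp hV hper hS hthin hgood hcard hl rfl rfl
  set xA := x - 2 * (l * p) with hxA
  set yA := x + p + 2 * (l * p) with hyA
  set UA := glue x (x + p) V fun n => V n + μA with hUA
  set FA := 𝓐.filter fun a => ∀ σ ∈ S, dA ≤ |a.2 - (σ + μA)| with hFAdef
  have hUAB : ∀ n, |UA n| ≤ B := abs_glue_le hVB fun n =>
    (abs_add_le_of_inv hV hμA0 hμA1 n).trans (by linarith)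
  have hnew : ∀ j < K, Function.update clsA K FA j = clsA j := fun j hj =>
    Function.update_of_ne (by omega) _ _
  have hsumA : ∑ j ∈ Finset.range K, (clsA j).card ≤ p ^ 2 :=
    (Finset.sum_le_sum fun j hj => (hclsA j (Finset.mem_range.1 hj)).2.1).trans hcard
  have hpp : p ^ 2 ≤ p ^ 31 := Nat.pow_le_pow_right (by omega) (by norm_num)
  have hFAc : FA.card ≤ p ^ 31 := (Finset.card_filter_le _ _).trans h𝓐c
  have hsumA' : ∑ j ∈ Finset.range (K + 1), (Function.update clsA K FA j).card ≤ p ^ 2 + p ^ 31 := by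
    rw [Finset.sum_range_succ, Function.update_self]
    refine add_le_add ?_ hFAc
    rw [Finset.sum_congr rfl fun j hj => by rw [hnew j (Finset.mem_range.1 hj)]]
    exact hsumA
  obtain ⟨μB, hμB0, hμB1, hfar, FB, hFBc, hFB, hclsB, hcap⟩ := exists_outer_step hp hV hper hS
    hthin hl hxA hyA rfl rfl hUAB (μA := μA) (fun n hn => glue_of_notMem hn)
    (cls := Function.update clsA K FA) (K := K + 1) (fun j hj => by
      rcases Nat.lt_succ_iff_lt_or_eq.1 hj with hj | rfl
      · rw [hnew j hj]; exact (hclsA j hj).1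
      · rw [Function.update_self]; exact hFA)
    (hsumA'.trans (by omega)) h𝓐 hdA
  set xB := x - 4 * (l * p) with hxB
  set yB := x + p + 4 * (l * p) with hyB
  set UB := glue xA yA UA fun n => V n + μB with hUB
  have hyxB : yB = xB + p' := by rw [← hp', hxB, hyB]; ring
  have hUBB : ∀ n, |UB n| ≤ B := abs_glue_le hUAB fun n =>
    (abs_add_le_of_inv hV hμB0 hμB1 n).trans (by linarith)
  have hUBV : ∀ n, |UB n - V n| ≤ (p : ℝ)⁻¹ ∧ |UB n| ≤ B - (p : ℝ)⁻¹ := fun n => by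
    rw [hUB, glue]
    split_ifs
    · rw [hUA, glue]
      split_ifs
      · rw [sub_self, abs_zero]; exact ⟨hq.le, by linarith [hV n]⟩
      · rw [add_sub_cancel_left, abs_of_nonneg hμA0]
        exact ⟨hμA1, abs_add_le_of_inv hV hμA0 hμA1 n⟩
    · rw [add_sub_cancel_left, abs_of_nonneg hμB0]
      exact ⟨hμB1, abs_add_le_of_inv hV hμB0 hμB1 n⟩
  set V' := periodize xB p' UB with hV'
  have hV'UB : ∀ n, xB ≤ n → n < yB → V' n = UB n := fun n h1 h2 => periodize_of_mem h1 (by omega)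
  have hV'B : ∀ n, |V' n| ≤ B - (p : ℝ)⁻¹ := fun n => (hUBV _).2
  have hV'B' : ∀ n, |V' n| ≤ B := fun n => (hV'B n).trans (by linarith)
  have hper' : ∀ n (k : ℤ), V' (n + k * p') = V' n := periodize_add xB p' UB
  have h2p : 2 * p ≤ p' := by omega
  have hp'0 : 10000 ≤ p' := by omega
  have hqq : (p : ℝ)⁻¹ ^ 31 ≤ (p' : ℝ)⁻¹ := by
    rw [inv_pow]
    refine inv_anti₀ (cast_pos_of_large hp'0) ?_
    exact_mod_cast hp'le
  have hp30 : p ^ 30 ≤ p' := by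
    have : (p : ℤ) ^ 30 ≤ p' := by rw [← hp', show (p : ℤ) ^ 30 = l * p by rw [hl]; ring]; omega
    exact_mod_cast this
  have hqq2 : (p' : ℝ)⁻¹ ≤ (p : ℝ)⁻¹ ^ 30 := by
    rw [inv_pow]
    refine inv_anti₀ (pow_pos (cast_pos_of_large hp0) _) ?_
    exact_mod_cast hp30
  have hq' := inv_pos_of_large hp'0
  have hmono : ∀ {cl}, Good UB xB yB cl ((p : ℝ)⁻¹ ^ 6300) ((p : ℝ)⁻¹ ^ 333) (B + 4) →
      Good V' xB (xB + p') cl ((p' : ℝ)⁻¹ ^ 200) ((p' : ℝ)⁻¹ ^ 20) (B + 4) := fun hg => by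
    rw [← hyxB]
    refine (hg.congr hUBB hV'B' fun n hn => (hV'UB n hn.1 hn.2).symm).mono ?_ ?_ le_rfl
    · calc (p : ℝ)⁻¹ ^ 6300 ≤ (p : ℝ)⁻¹ ^ (31 * 200) := inv_pow_le hp0 (by norm_num)
        _ = ((p : ℝ)⁻¹ ^ 31) ^ 200 := pow_mul _ _ _
        _ ≤ _ := by gcongr
    · calc (p' : ℝ)⁻¹ ^ 20 ≤ ((p : ℝ)⁻¹ ^ 30) ^ 20 := by gcongr
        _ = (p : ℝ)⁻¹ ^ (30 * 20) := (pow_mul _ _ _).symm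
        _ ≤ _ := inv_pow_le hp0 (by norm_num)
  set clsO := Function.update clsA K FA with hclsO
  have hnew' : ∀ j < K + 1, Function.update clsO (K + 1) FB j = clsO j := fun j hj =>
    Function.update_of_ne (by omega) _ _
  refine ⟨p', V', xB, Function.update clsO (K + 1) FB, ⟨fun n => (hV'B n).trans ?_, hper', ?_,
    fun j hj => hmono ?_, ?_⟩, ⟨h2p, by omega, by omega, ?_, fun j hj => ?_, fun j hj => ?_, ?_⟩⟩
  · have e1 := mul_inv_pow_le hp0 (c := 2) (by norm_num) (m := 1) (k := 30) (by norm_num)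
    rw [pow_one] at e1
    linarith
  · refine exists_thin_step hp hVB hthin hl hp'.symm hp'le hV'B hper' (z₁ := x + p + l * p)
      (z₂ := x + p + 3 * (l * p)) (fun n hn => ?_) (fun n hn => ?_) hfar
    · obtain ⟨h1, h2⟩ := hn
      rw [hV'UB n (by omega) (by omega), hUB, glue_of_mem (by omega) (by omega), hUA,
        glue_of_notMem (by omega)]
    · obtain ⟨h1, h2⟩ := hn
      rw [hV'UB n (by omega) (by omega), hUB, glue_of_notMem (by omega)]
  · rcases Nat.lt_succ_iff_lt_or_eq.1 hj with hj | rfl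
    · rw [hnew' j hj]; exact hclsB j hj
    · rw [Function.update_self]; exact hFB
  · rw [Finset.sum_range_succ, Function.update_self,
      Finset.sum_congr rfl fun j hj => by rw [hnew' j (Finset.mem_range.1 hj)]]
    have e1 : p ^ 2 + p ^ 31 + p ^ 31 ≤ p ^ 30 * p ^ 30 := by
      have e2 : p ^ 31 * 3 ≤ p ^ 31 * p ^ 29 :=
        Nat.mul_le_mul_left _ ((by omega : 3 ≤ p).trans (Nat.le_self_pow (by norm_num) p))
      calc _ ≤ p ^ 31 * 3 := by omega
        _ ≤ _ := e2
        _ = _ := by ring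
    calc _ ≤ p ^ 2 + p ^ 31 + p ^ 31 := add_le_add hsumA' hFBc
      _ ≤ _ := e1
      _ ≤ p' * p' := Nat.mul_le_mul hp30 hp30
      _ = _ := (sq _).symm
  · refine abs_periodize_sub_le (fun n k => ?_) fun n => (hUBV n).1
    rw [← hp', show k * ((p : ℤ) + 8 * (l * p)) = k * (1 + 8 * l) * p by ring, hper]
  · rw [hnew' j (by omega), hnew j hj]; exact (hclsA j hj).2.1
  · rw [hnew' j (by omega), hnew j hj]; exact (hclsA j hj).2.2
  · rw [hnew' K (by omega), hclsO, Function.update_self, Function.update_self]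
    exact hcap

end Step

section PurePoint

/-! ### Pure point spectrum -/

open Filter Topology

theorem sum_range_getD {α : Type*} (F : α → L2Z) {d : α} (hd : F d = 0) (l : List α) :
    ∀ {n : ℕ}, l.length ≤ n → ∑ i ∈ Finset.range n, F (l.getD i d) = (l.map F).sum := by
  induction l with
  | nil => intro n _; simp [hd]
  | cons a l ih =>
    intro n hn
    obtain ⟨n, rfl⟩ : ∃ k, n = k + 1 := ⟨n - 1, by simp at hn; omega⟩
    rw [Finset.sum_range_succ']
    simp only [List.getD_cons_succ, List.getD_cons_zero, List.map_cons, List.sum_cons]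
    rw [ih (by simpa using hn), add_comm]

/-- A bounded real sequence converges along any ultrafilter. -/
theorem exists_tendsto_of_abs_le (𝒰 : Ultrafilter ℕ) {f : ℕ → ℝ} {C : ℝ} (h : ∀ m, |f m| ≤ C) :
    ∃ l, Tendsto f 𝒰 (𝓝 l) := by
  obtain ⟨l, -, hl⟩ := (isCompact_Icc (a := -C) (b := C)).ultrafilter_le_nhds (𝒰.map f)
    (le_principal_iff.2 (Ultrafilter.mem_map.2 (Filter.univ_mem' fun m => abs_le.1 (h m))))
  exact ⟨l, hl⟩

/-- The eigenfunctions of the operator with potential `U`. -/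
abbrev eigenspan (U : ℤ → ℝ) : Submodule ℝ L2Z :=
  Submodule.span ℝ {ψ : L2Z | ∃ E : ℝ, IsEigenfunction U E ψ}

set_option maxHeartbeats 1000000 in
/-- A limit of spans of few approximate eigenvectors consists of combinations of eigenvectors. -/
theorem exists_eigenspan_near {W : ℕ → ℤ → ℝ} {B : ℝ} (hW : ∀ m n, |W m n| ≤ B) {U : ℤ → ℝ}
    (hU : ∀ n, Tendsto (fun m => W m n) atTop (𝓝 (U n))) {cl : ℕ → Finset (L2Z × ℝ)}
    (hon : ∀ m, ON (cl m)) {N : ℕ} (hcard : ∀ m, (cl m).card ≤ N) {C : ℝ} (hC : 0 ≤ C)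
    (habs : ∀ m, ∀ a ∈ cl m, |a.2| ≤ C) {τ : ℕ → ℝ} (hτ : Tendsto τ atTop (𝓝 0))
    (hres : ∀ m, ∀ a ∈ cl m, ‖ham (W m) a.1 - a.2 • a.1‖ ≤ τ m) {g : ℕ → L2Z}
    (hg : ∀ m, spanProj (cl m) (g m) = g m) (hg1 : ∀ m, ‖g m‖ ≤ 1) {f : L2Z} {δ : ℝ}
    (hfg : ∀ m, ‖f - g m‖ ≤ δ) : ∃ h ∈ eigenspan U, ‖f - h‖ ≤ δ := by
  set 𝒰 : Ultrafilter ℕ := hyperfilter ℕ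
  have h𝒰 : (𝒰 : Filter ℕ) ≤ atTop := Nat.hyperfilter_le_atTop
  set b : ℕ → ℕ → L2Z × ℝ := fun m i => (cl m).toList.getD i (0, 0) with hbdef
  have hb : ∀ m i, b m i ∈ cl m ∨ b m i = (0, 0) := fun m i => by
    by_cases hi : i < (cl m).toList.length
    · left
      rw [hbdef, ← Finset.mem_toList]
      simp only [List.getD_eq_getElem _ _ hi]
      exact List.getElem_mem hi
    · right
      exact List.getD_eq_default _ _ (by omega)
  have hb1 : ∀ m i, ‖(b m i).1‖ ≤ 1 := fun m i => by
    rcases hb m i with h | h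
    · exact ((hon m).1 _ h).le
    · rw [h]; simp
  have hb2 : ∀ m i, |(b m i).2| ≤ C := fun m i => by
    rcases hb m i with h | h
    · exact habs m _ h
    · rw [h]; simpa using hC
  have hb3 : ∀ m i, ‖ham (W m) (b m i).1 - (b m i).2 • (b m i).1‖ ≤ |τ m| := fun m i => by
    rcases hb m i with h | h
    · exact (hres m _ h).trans (le_abs_self _)
    · rw [h]; simp
  have hsum : ∀ m, ∑ i ∈ Finset.range N, ⟪(b m i).1, g m⟫_ℝ • (b m i).1 = g m := fun m => by
    have h1 := sum_range_getD (fun a : L2Z × ℝ => ⟪a.1, g m⟫_ℝ • a.1) (d := (0, 0))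
      (by simp) (cl m).toList (n := N) (by rw [Finset.length_toList]; exact hcard m)
    rw [Finset.sum_map_toList] at h1
    exact h1.trans (hg m)
  choose c hc using fun i => exists_tendsto_of_abs_le 𝒰 (f := fun m => ⟪(b m i).1, g m⟫_ℝ)
    (C := 1) fun m => (abs_real_inner_le_norm _ _).trans
      (mul_le_one₀ (hb1 m i) (norm_nonneg _) (hg1 m))
  choose e he using fun i => exists_tendsto_of_abs_le 𝒰 (f := fun m => (b m i).2) fun m => hb2 m i
  choose φ hφ using fun i n => exists_tendsto_of_abs_le 𝒰 (f := fun m => (b m i).1 n) fun m =>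
    (abs_apply_le _ n).trans (hb1 m i)
  have hφ' : ∀ i, Memℓp (φ i) 2 := fun i =>
    lp.memℓp_of_tendsto (l := (𝒰 : Filter ℕ)) (F := fun m => (b m i).1)
      ((isBounded_iff_forall_norm_le).2 ⟨1, by rintro _ ⟨m, rfl⟩; exact hb1 m i⟩)
      (tendsto_pi_nhds.2 fun n => hφ i n)
  set ψ : ℕ → L2Z := fun i => ⟨φ i, hφ' i⟩ with hψ
  have hψa : ∀ i n, ψ i n = φ i n := fun i n => rfl
  have heig : ∀ i n, ψ i (n + 1) + ψ i (n - 1) + U n * ψ i n = e i * ψ i n := fun i n => by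
    have h1 : Tendsto (fun m => (ham (W m) (b m i).1 - (b m i).2 • (b m i).1) n) 𝒰 (𝓝 0) := by
      refine squeeze_zero_norm (fun m => (abs_apply_le _ n).trans (hb3 m i)) ?_
      simpa using (hτ.mono_left h𝒰).abs
    have h2 : Tendsto (fun m => (ham (W m) (b m i).1 - (b m i).2 • (b m i).1) n) 𝒰
        (𝓝 (φ i (n + 1) + φ i (n - 1) + U n * φ i n - e i * φ i n)) := by
      simp only [sub_apply, smul_apply, ham_apply (hW _)]
      exact (((hφ i _).add (hφ i _)).add (((hU n).mono_left h𝒰).mul (hφ i n))).sub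
        ((he i).mul (hφ i n))
    have := tendsto_nhds_unique h1 h2
    simp only [hψa]
    linarith
  refine ⟨∑ i ∈ Finset.range N, c i • ψ i, Submodule.sum_mem _ fun i _ => ?_, ?_⟩
  · by_cases h0 : ψ i = 0
    · rw [h0, smul_zero]; exact Submodule.zero_mem _
    · exact Submodule.smul_mem _ _ (Submodule.subset_span ⟨e i, h0, heig i⟩)
  · refine lp.norm_le_of_tendsto (l := (𝒰 : Filter ℕ)) (F := fun m => f - g m)
      (Eventually.of_forall hfg) (tendsto_pi_nhds.2 fun n => ?_)
    have : ∀ m, (f - g m) n = f n - ∑ i ∈ Finset.range N, ⟪(b m i).1, g m⟫_ℝ * (b m i).1 n :=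
      fun m => by
        have h1 := congrArg (fun w : L2Z => w n) (hsum m)
        simp only [sum_apply, smul_apply] at h1
        rw [sub_apply, h1]
    simp only [id, this, sub_apply, sum_apply, smul_apply]
    exact tendsto_const_nhds.sub (tendsto_finsetSum _ fun i _ => (hc i).mul (hφ i n))

/-- If all basis vectors are limits of combinations of eigenvectors, the spectrum is pure point. -/
theorem hasPurePointSpectrum_of_single {U : ℤ → ℝ}
    (h : ∀ y, ∀ ε > 0, ∃ g ∈ eigenspan U, ‖single y - g‖ ≤ ε) : HasPurePointSpectrum U := by
  have h1 : ∀ y, single y ∈ (eigenspan U).topologicalClosure := fun y => by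
    rw [← SetLike.mem_coe, Submodule.topologicalClosure_coe, Metric.mem_closure_iff]
    intro ε hε
    obtain ⟨g, hg, hle⟩ := h y (ε / 2) (by positivity)
    exact ⟨g, hg, by rw [dist_eq_norm]; linarith⟩
  refine (Submodule.eq_top_iff' (p := (eigenspan U).topologicalClosure)).2 fun f => ?_
  have h2 := lp.hasSum_single (p := 2) (by norm_num) f
  refine (Submodule.isClosed_topologicalClosure _).mem_of_tendsto h2
    (Eventually.of_forall fun s => Submodule.sum_mem _ fun y _ => ?_)
  have h3 : lp.single 2 y (f y) = f y • single y := by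
    rw [single, ← lp.single_smul]; simp
  rw [h3]
  exact Submodule.smul_mem _ _ (h1 y)

end PurePoint

section Limit

/-! ### The limit potential -/

open Filter Topology

theorem eventually_exp_le (n : ℕ) :
    ∀ᶠ p : ℕ in atTop, 32 * Real.exp (-((p : ℝ) / 8)) ≤ (p : ℝ)⁻¹ ^ n := by
  have h1 : Tendsto (fun p : ℕ => (p : ℝ) / 8) atTop atTop :=
    tendsto_natCast_atTop_atTop.atTop_div_const (by norm_num)
  have h2 := (Real.tendsto_pow_mul_exp_neg_atTop_nhds_zero n).comp h1
  have h3 : (0 : ℝ) < (1 / 8) ^ n / 32 := by positivity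
  filter_upwards [h2.eventually (ge_mem_nhds h3), eventually_gt_atTop 0] with p hp hp0
  have hp1 : (0 : ℝ) < p := by exact_mod_cast hp0
  simp only [Function.comp] at hp
  have h4 : (0 : ℝ) < (1 / 8) ^ n := by positivity
  rw [div_eq_mul_one_div (p : ℝ) 8, mul_pow] at hp
  rw [inv_pow, inv_eq_one_div, le_div_iff₀ (by positivity), div_eq_mul_one_div (p : ℝ) 8]
  nlinarith

theorem exists_large (B : ℝ) : ∃ p₀, ∀ p ≥ p₀, Large B p := by
  rw [← eventually_atTop]
  have h1 : Tendsto (fun p : ℕ => (2 * B + 9) * (p : ℝ)⁻¹) atTop (𝓝 0) := by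
    simpa using (tendsto_inv_atTop_nhds_zero_nat (𝕜 := ℝ)).const_mul (2 * B + 9)
  filter_upwards [eventually_ge_atTop 10000, h1.eventually (ge_mem_nhds (by norm_num : (0:ℝ) < 1 / 4)),
    eventually_exp_le 6300] with p hp hb he
  refine ⟨hp, hb, le_trans ?_ he⟩
  have h2 : (1 : ℝ) ≤ p := by exact_mod_cast (by omega : 1 ≤ p)
  have h3 : (p : ℝ)⁻¹ ^ 7 * (p : ℝ) ^ 29 = p ^ 22 := by
    rw [show (p : ℝ) ^ 29 = p ^ 7 * p ^ 22 by ring, ← mul_assoc, ← mul_pow,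
      inv_mul_cancel₀ (by positivity), one_pow, one_mul]
  rw [h3]
  gcongr
  exact le_self_pow₀ h2 (by norm_num)

/-- An infinite sequence of stages. -/
structure Tower (B : ℝ) (P : ℕ → ℕ) (W : ℕ → ℤ → ℝ) (X : ℕ → ℤ) (C : ℕ → ℕ → Finset (L2Z × ℝ)) :
    Prop where
  stage : ∀ k, Stage B (P k) (W k) (X k) (C k) (2 * k)
  refines : ∀ k, Refines (P k) (W k) (X k) (C k) (2 * k) (P (k + 1)) (W (k + 1)) (X (k + 1))
    (C (k + 1))
  pos : ∀ k, 0 < P k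

theorem exists_tower {B : ℝ} {p₀ : ℕ} (hlarge : ∀ p ≥ p₀, Large B p) {p : ℕ} (hp : p₀ ≤ p)
    {V : ℤ → ℝ} {x : ℤ} {cls : ℕ → Finset (L2Z × ℝ)} (h : Stage B p V x cls 0) :
    ∃ P W X C, Tower B P W X C ∧ P 0 = p ∧ W 0 = V := by
  let T := ℕ × (ℤ → ℝ) × ℤ × (ℕ → Finset (L2Z × ℝ))
  let good : ℕ → T → Prop := fun k s => p₀ ≤ s.1 ∧ Stage B s.1 s.2.1 s.2.2.1 s.2.2.2 (2 * k)
  have step : ∀ k (s : T), good k s → ∃ s' : T, good (k + 1) s' ∧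
      Refines s.1 s.2.1 s.2.2.1 s.2.2.2 (2 * k) s'.1 s'.2.1 s'.2.2.1 s'.2.2.2 := by
    rintro k s ⟨h1, h2⟩
    obtain ⟨p', V', x', cls', h3, h4⟩ := h2.step (hlarge _ h1)
    exact ⟨(p', V', x', cls'), ⟨by have := h4.two_mul_le; simp only; omega, h3⟩, h4⟩
  choose! next hnext using step
  let seq : ℕ → T := fun k => Nat.rec (p, V, x, cls) (fun k s => next k s) k
  have hseq : ∀ k, good k (seq k) := by
    intro k
    induction k with
    | zero => exact ⟨hp, h⟩
    | succ k ih => exact (hnext k _ ih).1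
  exact ⟨fun k => (seq k).1, fun k => (seq k).2.1, fun k => (seq k).2.2.1, fun k => (seq k).2.2.2,
    ⟨fun k => (hseq k).2, fun k => (hnext k _ (hseq k)).2,
      fun k => by have := (hlarge _ (hseq k).1).le; omega⟩, rfl, rfl⟩

namespace Tower

variable {B : ℝ} {P : ℕ → ℕ} {W : ℕ → ℤ → ℝ} {X : ℕ → ℤ} {C : ℕ → ℕ → Finset (L2Z × ℝ)}

theorem inv_le (h : Tower B P W X C) (k m : ℕ) : ((P (k + m) : ℕ) : ℝ)⁻¹ ≤ (P k : ℝ)⁻¹ / 2 ^ m := by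
  induction m with
  | zero => simp
  | succ m ih =>
    have h1 : (0 : ℝ) < P (k + m) := by exact_mod_cast h.pos _
    have h2 : (2 : ℝ) * P (k + m) ≤ P (k + m + 1) := by
      exact_mod_cast (h.refines (k + m)).two_mul_le
    calc ((P (k + m + 1) : ℕ) : ℝ)⁻¹ ≤ (2 * (P (k + m) : ℝ))⁻¹ := inv_anti₀ (by positivity) h2
      _ = (P (k + m) : ℝ)⁻¹ / 2 := by rw [mul_inv]; ring
      _ ≤ (P k : ℝ)⁻¹ / 2 ^ m / 2 := by gcongr
      _ = _ := by rw [pow_succ]; ring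

theorem tendsto_inv (h : Tower B P W X C) : Tendsto (fun k => (P k : ℝ)⁻¹) atTop (𝓝 0) := by
  have h1 : Tendsto (fun m : ℕ => (P 0 : ℝ)⁻¹ / 2 ^ m) atTop (𝓝 0) :=
    tendsto_const_nhds.div_atTop (tendsto_pow_atTop_atTop_of_one_lt (by norm_num))
  exact squeeze_zero (fun k => by positivity) (fun k => by simpa using h.inv_le 0 k) h1

/-- Distances along a tower are dominated by a geometric series. -/
theorem dist_le_geometric {α : Type*} [PseudoMetricSpace α] (h : Tower B P W X C) {u : ℕ → α}
    {k : ℕ} (hu : ∀ m, dist (u m) (u (m + 1)) ≤ (P (k + m) : ℝ)⁻¹) (m : ℕ) :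
    dist (u m) (u (m + 1)) ≤ 2 * (P k : ℝ)⁻¹ / 2 / 2 ^ m := by
  refine (hu m).trans ((h.inv_le k m).trans (le_of_eq ?_))
  ring

theorem exists_limit (h : Tower B P W X C) : ∃ U : ℤ → ℝ,
    (∀ n, Tendsto (fun k => W k n) atTop (𝓝 (U n))) ∧ ∀ k n, |U n - W k n| ≤ 2 * (P k : ℝ)⁻¹ := by
  have h1 : ∀ k n m, dist (W (k + m) n) (W (k + (m + 1)) n) ≤ (P (k + m) : ℝ)⁻¹ := fun k n m => by
    rw [dist_comm, Real.dist_eq]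
    exact (h.refines (k + m)).dist_le n
  have h2 : ∀ n, ∃ a, Tendsto (fun k => W k n) atTop (𝓝 a) := fun n => by
    refine cauchySeq_tendsto_of_complete
      (cauchySeq_of_le_geometric_two (C := 2 * (P 0 : ℝ)⁻¹) fun m => ?_)
    exact h.dist_le_geometric (k := 0) (u := fun m => W m n)
      (fun m => by simpa using h1 0 n m) m
  choose U hU using h2
  refine ⟨U, hU, fun k n => ?_⟩
  have h3 : Tendsto (fun m => W (k + m) n) atTop (𝓝 (U n)) := by
    simpa only [add_comm k] using (tendsto_add_atTop_iff_nat k).2 (hU n)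
  have h4 := dist_le_of_le_geometric_two_of_tendsto₀ (C := 2 * (P k : ℝ)⁻¹)
    (h.dist_le_geometric (u := fun m => W (k + m) n) (h1 k n)) h3
  rw [dist_comm, Real.dist_eq] at h4
  simpa using h4

theorem abs_le (h : Tower B P W X C) (k : ℕ) (n : ℤ) : |W k n| ≤ B := by
  have h1 := (h.stage k).bound n
  have h2 : (0 : ℝ) ≤ (P k : ℝ)⁻¹ := by positivity
  linarith

/-- Vectors in the span of a cluster of a tower are close to combinations of eigenvectors of the
limiting operator. -/
theorem exists_eigenspan_near (h : Tower B P W X C) {U : ℤ → ℝ}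
    (hU : ∀ n, Tendsto (fun k => W k n) atTop (𝓝 (U n))) {k j : ℕ} (hj : j < 2 * k) {f : L2Z}
    (hf : spanProj (C k j) f = f) (hf1 : ‖f‖ ≤ 1) :
    ∃ g ∈ eigenspan U, ‖f - g‖ ≤ 2 * (P k : ℝ)⁻¹ := by
  have hB : 0 ≤ B := (abs_nonneg _).trans (h.abs_le 0 0)
  have step : ∀ m u, (spanProj (C (k + m) j) u = u ∧ ‖u‖ ≤ 1) → ∃ v,
      (spanProj (C (k + (m + 1)) j) v = v ∧ ‖v‖ ≤ 1) ∧ ‖u - v‖ ≤ (P (k + m) : ℝ)⁻¹ := by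
    rintro m u ⟨h1, h2⟩
    obtain ⟨v, h3, h4, h5⟩ := (h.refines (k + m)).approx j (by omega) u h1
    refine ⟨v, ⟨h3, h4.trans h2⟩, h5.trans ?_⟩
    exact mul_le_of_le_one_right (by positivity) h2
  choose! next hnext using step
  let u : ℕ → L2Z := fun m => Nat.rec f (fun m v => next m v) m
  have hu : ∀ m, spanProj (C (k + m) j) (u m) = u m ∧ ‖u m‖ ≤ 1 := by
    intro m
    induction m with
    | zero => exact ⟨hf, hf1⟩
    | succ m ih => exact (hnext m _ ih).1
  have hdist : ∀ m, dist (u m) (u (m + 1)) ≤ (P (k + m) : ℝ)⁻¹ := fun m => by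
    rw [dist_eq_norm]; exact (hnext m _ (hu m)).2
  have hfu : ∀ m, ‖f - u m‖ ≤ 2 * (P k : ℝ)⁻¹ := fun m => by
    have h1 := dist_le_range_sum_of_dist_le (f := u) m
      (fun {i} _ => h.dist_le_geometric hdist i)
    have h2 := (summable_geometric_two' (2 * (P k : ℝ)⁻¹)).sum_le_tsum (Finset.range m)
      fun i _ => by positivity
    rw [tsum_geometric_two'] at h2
    rw [← dist_eq_norm]
    exact h1.trans h2
  have hgood := fun m => (h.stage (k + m)).good j (by omega)
  refine L2Z.exists_eigenspan_near (W := fun m => W (k + m)) (fun m n => h.abs_le _ n)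
    (fun n => ?_) (fun m => (hgood m).on) (N := (C k j).card) (fun m => ?_) (C := B + 4)
    (by linarith) (fun m => (hgood m).abs_le) (τ := fun m => (P (k + m) : ℝ)⁻¹ ^ 200) ?_
    (fun m => (hgood m).res) (g := u) (fun m => (hu m).1) (fun m => (hu m).2) hfu
  · simpa only [add_comm k] using (tendsto_add_atTop_iff_nat k).2 (hU n)
  · induction m with
    | zero => exact le_rfl
    | succ m ih => exact ((h.refines (k + m)).card_le j (by omega)).trans ih
  · have h1 : Tendsto (fun m => (P (k + m) : ℝ)⁻¹) atTop (𝓝 0) := by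
      simpa only [add_comm k] using (tendsto_add_atTop_iff_nat k).2 h.tendsto_inv
    simpa using h1.pow 200

theorem bounds (h : Tower B P W X C) (k : ℕ) : X k ≤ X 0 - k ∧ X 0 + k ≤ X k + P k := by
  induction k with
  | zero => simp
  | succ k ih =>
    have h1 := h.pos k
    have h2 := (h.refines k).left_le
    have h3 := (h.refines k).le_right
    push_cast
    omega

theorem hasPurePointSpectrum (h : Tower B P W X C) {U : ℤ → ℝ}
    (hU : ∀ n, Tendsto (fun k => W k n) atTop (𝓝 (U n))) : HasPurePointSpectrum U := by
  refine hasPurePointSpectrum_of_single fun y ε hε => ?_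
  have h1 : ∀ᶠ k in atTop, (P k : ℝ)⁻¹ ≤ ε / 3 :=
    h.tendsto_inv.eventually (ge_mem_nhds (by positivity))
  obtain ⟨k, hk, hky⟩ := (h1.and (eventually_gt_atTop ((y - X 0).natAbs))).exists
  have hb := h.bounds k
  obtain ⟨fA, fB, hA, hB, hA1, hB1, hAB⟩ := (h.refines k).capture (single y)
    (supp_single ⟨by omega, by omega⟩) (norm_single y).le
  obtain ⟨gA, hgA, hgA'⟩ := h.exists_eigenspan_near hU (k := k + 1) (by omega) hA hA1
  obtain ⟨gB, hgB, hgB'⟩ := h.exists_eigenspan_near hU (k := k + 1) (by omega) hB hB1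
  refine ⟨gA + gB, Submodule.add_mem _ hgA hgB, ?_⟩
  have h2 := h.inv_le k 1
  have h3 : single y - (gA + gB) = (single y - fA - fB) + (fA - gA) + (fB - gB) := by abel
  have h4 := norm_add₃_le (a := single y - fA - fB) (b := fA - gA) (c := fB - gB)
  rw [h3]
  linarith

theorem isLimitPeriodic (h : Tower B P W X C) {U : ℤ → ℝ}
    (hU : ∀ k n, |U n - W k n| ≤ 2 * (P k : ℝ)⁻¹) : IsLimitPeriodic U := by
  intro ε hε
  obtain ⟨k, hk⟩ := (h.tendsto_inv.eventually (ge_mem_nhds (by positivity : 0 < ε / 2))).exists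
  refine ⟨W k, ⟨P k, h.pos k, fun n => ?_⟩, fun n => (hU k n).trans (by linarith)⟩
  simpa using (h.stage k).per n 1

end Tower

end Limit

section TransferMatrices

/-! ### Transfer matrices -/

open Matrix

/-- The one-step transfer matrix at energy `E`. -/
def transfer (W : ℤ → ℝ) (E : ℝ) (n : ℤ) : Matrix (Fin 2) (Fin 2) ℝ := !![E - W n, -1; 1, 0]

/-- The transfer matrix from site `n` over `m` steps. -/
def monodromy (W : ℤ → ℝ) (E : ℝ) : ℕ → ℤ → Matrix (Fin 2) (Fin 2) ℝ
  | 0, _ => 1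
  | m + 1, n => transfer W E (n + m) * monodromy W E m n

variable {W W' : ℤ → ℝ} {E : ℝ}

@[simp] theorem det_transfer (n : ℤ) : (transfer W E n).det = 1 := by
  simp [transfer, det_fin_two]

@[simp] theorem det_monodromy (m : ℕ) (n : ℤ) : (monodromy W E m n).det = 1 := by
  induction m with
  | zero => simp [monodromy]
  | succ m ih => rw [monodromy, det_mul, ih, det_transfer, one_mul]

theorem monodromy_add (m k : ℕ) (n : ℤ) :
    monodromy W E (m + k) n = monodromy W E k (n + m) * monodromy W E m n := by
  induction k with
  | zero => simp [monodromy]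
  | succ k ih =>
    rw [← add_assoc, monodromy, ih, monodromy, mul_assoc]
    congr 2
    push_cast; ring

theorem monodromy_congr {m : ℕ} {n n' : ℤ} (h : ∀ i < m, W (n + i) = W' (n' + i)) :
    monodromy W E m n = monodromy W' E m n' := by
  induction m with
  | zero => rfl
  | succ m ih =>
    rw [monodromy, monodromy, ih fun i hi => h i (by omega), transfer, transfer, h m (by omega)]

theorem monodromy_mul {N : ℕ} (hW : ∀ n, W (n + N) = W n) (b : ℕ) (n : ℤ) :
    monodromy W E (N * b) n = monodromy W E N n ^ b := by
  have hk : ∀ (k : ℕ) (i : ℤ), W (i + (N * k : ℕ)) = W i := fun k i => by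
    induction k with
    | zero => simp
    | succ k ih => rw [← ih, ← hW (i + (N * k : ℕ))]; congr 1; push_cast; ring
  induction b with
  | zero => simp [monodromy]
  | succ b ih =>
    rw [mul_add_one, monodromy_add, ih, pow_succ']
    congr 1
    refine monodromy_congr fun i _ => ?_
    rw [← hk b (n + i)]
    congr 1; ring

theorem trace_monodromy_succ {N : ℕ} (hW : ∀ n, W (n + N) = W n) (n : ℤ) :
    (monodromy W E N (n + 1)).trace = (monodromy W E N n).trace := by
  have h1 := monodromy_add (W := W) (E := E) N 1 n
  rw [add_comm N 1, monodromy_add] at h1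
  have h2 : monodromy W E 1 (n + N) = monodromy W E 1 n := monodromy_congr fun i _ => by
    rw [← hW (n + i)]; congr 1; ring
  rw [h2] at h1
  push_cast at h1
  have h3 : IsUnit (monodromy W E 1 n).det := by simp
  have h4 : monodromy W E N (n + 1)
      = monodromy W E 1 n * monodromy W E N n * (monodromy W E 1 n)⁻¹ := by
    rw [← h1, Matrix.mul_assoc, Matrix.mul_nonsing_inv _ h3, Matrix.mul_one]
  rw [h4, trace_mul_comm, ← Matrix.mul_assoc, Matrix.nonsing_inv_mul _ h3, Matrix.one_mul]

theorem trace_monodromy_eq {N : ℕ} (hW : ∀ n, W (n + N) = W n) (n : ℤ) :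
    (monodromy W E N n).trace = (monodromy W E N 0).trace := by
  induction n using Int.induction_on with
  | zero => rfl
  | succ n ih => rw [trace_monodromy_succ hW, ih]
  | pred n ih => rw [← ih, ← trace_monodromy_succ hW]; congr 2; ring

theorem mul_self_of_det_eq_one {M : Matrix (Fin 2) (Fin 2) ℝ} (hM : M.det = 1) :
    M * M = M.trace • M - 1 := by
  rw [det_fin_two] at hM
  ext i j
  fin_cases i <;> fin_cases j <;> simp [Matrix.mul_apply, Fin.sum_univ_two, trace_fin_two] <;>
    linarith

/-- The norm of a transfer matrix. -/
theorem norm_transfer_mulVec_le {B : ℝ} (hW : ∀ n, |W n| ≤ B) (n : ℤ) (y : Fin 2 → ℝ) :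
    ‖transfer W E n *ᵥ y‖ ≤ (|E| + B + 1) * ‖y‖ := by
  have hB : 0 ≤ B := (abs_nonneg _).trans (hW n)
  have h0 : |y 0| ≤ ‖y‖ := norm_le_pi_norm y 0
  have h1 : |y 1| ≤ ‖y‖ := norm_le_pi_norm y 1
  have h2 : |E - W n| ≤ |E| + B := (abs_sub _ _).trans (by linarith [hW n])
  have hy := norm_nonneg y
  refine (pi_norm_le_iff_of_nonneg (by positivity)).2 fun i => ?_
  fin_cases i
  · have h3 : (transfer W E n *ᵥ y) 0 = (E - W n) * y 0 - y 1 := by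
      simp [transfer, Matrix.mulVec, dotProduct, Fin.sum_univ_two]; ring
    simp only [Fin.zero_eta, h3, Real.norm_eq_abs]
    calc |(E - W n) * y 0 - y 1| ≤ |E - W n| * |y 0| + |y 1| := by
          rw [← abs_mul]; exact abs_sub _ _
      _ ≤ (|E| + B) * ‖y‖ + ‖y‖ := by gcongr
      _ = _ := by ring
  · have h3 : (transfer W E n *ᵥ y) 1 = y 0 := by
      simp [transfer, Matrix.mulVec, dotProduct, Fin.sum_univ_two]
    simp only [Fin.mk_one, h3, Real.norm_eq_abs]
    have := abs_nonneg E
    nlinarith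

theorem norm_monodromy_mulVec_le {B : ℝ} (hW : ∀ n, |W n| ≤ B) (m : ℕ) (n : ℤ) (y : Fin 2 → ℝ) :
    ‖monodromy W E m n *ᵥ y‖ ≤ (|E| + B + 1) ^ m * ‖y‖ := by
  have hB : 0 ≤ B := (abs_nonneg _).trans (hW 0)
  induction m with
  | zero => simp [monodromy]
  | succ m ih =>
    rw [monodromy, ← Matrix.mulVec_mulVec]
    refine (norm_transfer_mulVec_le hW _ _).trans ?_
    rw [pow_succ', mul_assoc]
    gcongr

/-- The transfer matrix propagates approximate solutions. -/
theorem norm_sub_monodromy_le {B : ℝ} (hW : ∀ n, |W n| ≤ B) {u f : ℤ → ℝ}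
    (hu : ∀ n, u (n + 1) = (E - W n) * u n - u (n - 1) + f n) (m : ℕ) (n : ℤ) :
    ‖![u (n + m), u (n + m - 1)] - monodromy W E m n *ᵥ ![u n, u (n - 1)]‖
      ≤ (|E| + B + 1) ^ m * ∑ i ∈ Finset.range m, |f (n + i)| := by
  have hB : 0 ≤ B := (abs_nonneg _).trans (hW 0)
  induction m with
  | zero => simp [monodromy]
  | succ m ih =>
    set κ := |E| + B + 1 with hκ
    have hκ1 : 1 ≤ κ := by have := abs_nonneg E; linarith
    have h1 : ![u (n + (m + 1 : ℕ)), u (n + (m + 1 : ℕ) - 1)]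
        - monodromy W E (m + 1) n *ᵥ ![u n, u (n - 1)]
        = transfer W E (n + m) *ᵥ (![u (n + m), u (n + m - 1)]
          - monodromy W E m n *ᵥ ![u n, u (n - 1)]) + ![f (n + m), 0] := by
      rw [Matrix.mulVec_sub, Matrix.mulVec_mulVec, ← monodromy, sub_add_eq_add_sub]
      congr 1
      have e1 := hu (n + m)
      ext i
      fin_cases i
      · simp [transfer, ← add_assoc, e1]; ring
      · simp [transfer, ← add_assoc]
    have h2 : ‖![f (n + m), 0]‖ ≤ |f (n + m)| :=
      (pi_norm_le_iff_of_nonneg (abs_nonneg _)).2 fun i => by fin_cases i <;> simp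
    rw [h1, Finset.sum_range_succ, mul_add]
    refine (norm_add_le _ _).trans (add_le_add ?_ (h2.trans ?_))
    · refine (norm_transfer_mulVec_le hW _ _).trans ?_
      rw [pow_succ', mul_assoc]
      gcongr
    · exact le_mul_of_one_le_left (abs_nonneg _) (one_le_pow₀ hκ1)

/-- Approximate solutions satisfy the Cayley–Hamilton recurrence up to a controlled error. -/
theorem abs_cayleyHamilton_le {N : ℕ} (hW : ∀ n, W (n + N) = W n) {B : ℝ} (hB : ∀ n, |W n| ≤ B)
    {u f : ℤ → ℝ} (hu : ∀ n, u (n + 1) = (E - W n) * u n - u (n - 1) + f n) {Δ κ : ℝ}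
    (hΔ : Δ = (monodromy W E N 0).trace) (hκ : κ = (|E| + B + 1) ^ N) (n : ℤ) :
    |u (n + N + N) + u n - Δ * u (n + N)|
      ≤ (κ + |Δ| + 1) * κ * ∑ i ∈ Finset.range (2 * N), |f (n + i)| := by
  have hB0 : 0 ≤ B := (abs_nonneg _).trans (hB 0)
  have hκ1 : 1 ≤ κ := hκ ▸ one_le_pow₀ (by have := abs_nonneg E; linarith)
  set s₁ := ∑ i ∈ Finset.range N, |f (n + i)|
  set s₂ := ∑ i ∈ Finset.range N, |f (n + N + i)|
  have hs₁ : 0 ≤ s₁ := Finset.sum_nonneg fun _ _ => abs_nonneg _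
  have hs₂ : 0 ≤ s₂ := Finset.sum_nonneg fun _ _ => abs_nonneg _
  have hs : ∑ i ∈ Finset.range (2 * N), |f (n + i)| = s₁ + s₂ := by
    rw [two_mul, Finset.sum_range_add]
    simp only [s₁, s₂]
    push_cast
    simp only [add_assoc]
  rw [hs]
  set M := monodromy W E N n
  have hM : monodromy W E N (n + N) = M := monodromy_congr fun i _ => by
    rw [← hW (n + i)]; congr 1; ring
  have hMM : M * M = Δ • M - 1 := by
    rw [mul_self_of_det_eq_one (det_monodromy N n), trace_monodromy_eq hW, hΔ]
  set y₀ : Fin 2 → ℝ := ![u n, u (n - 1)]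
  set y₁ : Fin 2 → ℝ := ![u (n + N), u (n + N - 1)]
  set y₂ : Fin 2 → ℝ := ![u (n + N + N), u (n + N + N - 1)]
  have e1 : ‖y₁ - M *ᵥ y₀‖ ≤ κ * s₁ := hκ ▸ norm_sub_monodromy_le hB hu N n
  have e2 : ‖y₂ - M *ᵥ y₁‖ ≤ κ * s₂ := by
    have := norm_sub_monodromy_le hB hu N (n + N)
    rwa [hM, ← hκ] at this
  have e3 : y₂ + y₀ - Δ • y₁ = M *ᵥ (y₁ - M *ᵥ y₀) - Δ • (y₁ - M *ᵥ y₀) + (y₂ - M *ᵥ y₁) := by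
    rw [Matrix.mulVec_sub, Matrix.mulVec_mulVec, hMM, Matrix.sub_mulVec, Matrix.smul_mulVec,
      Matrix.one_mulVec, smul_sub]
    abel
  have e4 : u (n + N + N) + u n - Δ * u (n + N) = (y₂ + y₀ - Δ • y₁) 0 := by
    simp [y₀, y₁, y₂]
  rw [e4, ← Real.norm_eq_abs]
  refine (norm_le_pi_norm _ 0).trans ?_
  rw [e3]
  calc _ ≤ ‖M *ᵥ (y₁ - M *ᵥ y₀)‖ + ‖Δ • (y₁ - M *ᵥ y₀)‖ + ‖y₂ - M *ᵥ y₁‖ :=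
        (norm_add_le _ _).trans (add_le_add_left (norm_sub_le _ _) _)
    _ ≤ κ * (κ * s₁) + |Δ| * (κ * s₁) + κ * s₂ := by
        rw [norm_smul, Real.norm_eq_abs]
        gcongr
        refine (norm_monodromy_mulVec_le hB N n _).trans ?_
        rw [← hκ]
        gcongr
    _ ≤ (κ + |Δ| + 1) * κ * (s₁ + s₂) := by
        have := abs_nonneg Δ
        have h1 : 0 ≤ κ * s₁ := by positivity
        have h2 : 0 ≤ (κ + |Δ|) * (κ * s₂) := by positivity
        nlinarith

theorem exists_abs (f : L2Z) : ∃ g : L2Z, ‖g‖ ≤ ‖f‖ ∧ ∀ n, g n = |f n| := by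
  have h : Memℓp (fun n => |f n|) 2 := by
    rw [memlp_iff]; simpa only [sq_abs] using (hasSum_sq f).summable
  have h' : ∀ n, (⟨fun n => |f n|, h⟩ : L2Z) n = |f n| := fun _ => rfl
  exact ⟨_, norm_le_of_abs_le fun n => by rw [h', abs_abs], h'⟩

theorem norm_le_of_abs_le_sum {f g : L2Z} {c : ℝ} (hc : 0 ≤ c) {m : ℕ}
    (h : ∀ n, |g n| ≤ c * ∑ i ∈ Finset.range m, |f (n + i)|) : ‖g‖ ≤ c * (m * ‖f‖) := by
  obtain ⟨a, ha, ha'⟩ := exists_abs f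
  have hs : ∀ n, (∑ i ∈ Finset.range m, shift (i : ℤ) a) n = ∑ i ∈ Finset.range m, |f (n + i)| :=
    fun n => by rw [sum_apply]; exact Finset.sum_congr rfl fun i _ => by rw [shift_apply, ha']
  have h1 : ‖g‖ ≤ ‖c • ∑ i ∈ Finset.range m, shift (i : ℤ) a‖ := norm_le_of_abs_le fun n => by
    rw [smul_apply, hs, abs_of_nonneg (a := _ * _)
      (mul_nonneg hc (Finset.sum_nonneg fun _ _ => abs_nonneg _))]
    exact h n
  refine h1.trans ?_
  rw [norm_smul, Real.norm_eq_abs, abs_of_nonneg hc]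
  refine mul_le_mul_of_nonneg_left ?_ hc
  calc _ ≤ ∑ i ∈ Finset.range m, ‖f‖ := norm_sum_le_of_le _ fun i _ => by rwa [norm_shift]
    _ = _ := by rw [Finset.sum_const, Finset.card_range, nsmul_eq_mul]

/-- An energy at which the monodromy matrix is hyperbolic lies in a gap. -/
theorem exists_gap_of_trace {N : ℕ} (hW : ∀ n, W (n + N) = W n) {B : ℝ} (hB : ∀ n, |W n| ≤ B)
    (htr : 2 < |(monodromy W E N 0).trace|) : ∃ ρ > 0, Gap W E ρ := by
  have hB0 : 0 ≤ B := (abs_nonneg _).trans (hB 0)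
  obtain ⟨Δ, hΔ⟩ : ∃ Δ, Δ = (monodromy W E N 0).trace := ⟨_, rfl⟩
  obtain ⟨κ, hκ⟩ : ∃ κ, κ = (|E| + B + 1) ^ N := ⟨_, rfl⟩
  have hκ0 : 0 ≤ κ := hκ ▸ by positivity
  rw [← hΔ] at htr
  set C := (κ + |Δ| + 1) * κ * (2 * N) + 1 with hC
  have hC0 : 0 < C := by positivity
  refine ⟨(|Δ| - 2) / C, div_pos (by linarith) hC0, fun a b w _ => ?_⟩
  obtain ⟨f, hf⟩ : ∃ f, f = ham W w - E • w := ⟨_, rfl⟩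
  have hu : ∀ n, w (n + 1) = (E - W n) * w n - w (n - 1) + f n := fun n => by
    rw [hf, sub_apply, smul_apply, ham_apply hB]; ring
  obtain ⟨g, hg⟩ : ∃ g, g = shift (N + N) w + w - Δ • shift N w := ⟨_, rfl⟩
  have hgn : ‖g‖ ≤ (κ + |Δ| + 1) * κ * ((2 * N : ℕ) * ‖f‖) :=
    norm_le_of_abs_le_sum (by positivity) fun n => by
      rw [hg, sub_apply, add_apply, smul_apply, shift_apply, shift_apply, ← add_assoc]
      exact abs_cayleyHamilton_le hW hB hu hΔ hκ n
  push_cast at hgn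
  have h1 : Δ • shift N w = shift (N + N) w + w - g := by rw [hg]; abel
  have h2 : |Δ| * ‖w‖ ≤ ‖w‖ + ‖w‖ + ‖g‖ := by
    calc |Δ| * ‖w‖ = ‖Δ • shift N w‖ := by rw [norm_smul, norm_shift, Real.norm_eq_abs]
      _ ≤ ‖shift (N + N) w‖ + ‖w‖ + ‖g‖ := by
        rw [h1]; exact (norm_sub_le _ _).trans (add_le_add_left (norm_add_le _ _) _)
      _ = _ := by rw [norm_shift]
  rw [← hf, div_mul_eq_mul_div, div_le_iff₀ hC0]
  have h3 : ‖g‖ ≤ ‖f‖ * C := by rw [hC]; linarith [norm_nonneg f]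
  linarith

end TransferMatrices

section OpeningGaps

/-! ### Opening gaps -/

open Matrix

variable {W : ℤ → ℝ} {E : ℝ}

/-- Changing a periodic potential at the last two sites of each period. -/
theorem exists_trace_monodromy_perturb {N : ℕ} (hN : 2 ≤ N) (hW : ∀ n, W (n + N) = W n) (E : ℝ)
    {σ σ' δ : ℝ} (hσ : |σ| ≤ δ) (hσ' : |σ'| ≤ δ) {T : Matrix (Fin 2) (Fin 2) ℝ}
    (hT : T = monodromy W E N 0) :
    ∃ (W' : ℤ → ℝ) (x : ℝ), (∀ n, W' (n + N) = W' n) ∧ (∀ n, |W' n - W n| ≤ δ) ∧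
      (σ' = 0 → monodromy W' E N 0 1 0 = T 1 0) ∧
      (monodromy W' E N 0).trace = T 0 0 + T 1 1 - σ * T 1 0
        - σ' * (-x * T 0 0 + x ^ 2 * T 1 0 - T 0 1 + x * T 1 1)
        + σ * σ' * (-T 0 0 + x * T 1 0) := by
  obtain ⟨m, rfl⟩ : ∃ m, N = m + 2 := ⟨N - 2, by omega⟩
  obtain ⟨W', hW'⟩ : ∃ W' : ℤ → ℝ, ∀ n, W' n = W n + if n % (m + 2 : ℕ) = m + 1 then σ else
    if n % (m + 2 : ℕ) = m then σ' else 0 := ⟨_, fun _ => rfl⟩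
  have h1 : W' (m + 1) = W (m + 1) + σ := by
    rw [hW', if_pos (Int.emod_eq_of_lt (by omega) (by push_cast; omega))]
  have h0 : W' m = W m + σ' := by
    have : (m : ℤ) % (m + 2 : ℕ) = m := Int.emod_eq_of_lt (by omega) (by push_cast; omega)
    rw [hW', if_neg (by rw [this]; omega), if_pos this]
  have h2 : monodromy W' E m 0 = monodromy W E m 0 := monodromy_congr fun i hi => by
    have : (i : ℤ) % (m + 2 : ℕ) = i := Int.emod_eq_of_lt (by omega) (by push_cast; omega)
    rw [zero_add, hW', this, if_neg (by omega), if_neg (by omega), add_zero]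
  have hm : ∀ W : ℤ → ℝ, monodromy W E (m + 2) 0
      = !![E - W (m + 1), -1; 1, 0] * (!![E - W m, -1; 1, 0] * monodromy W E m 0) := fun W => by
    simp [monodromy, transfer]
  have hδ : 0 ≤ δ := (abs_nonneg _).trans hσ
  refine ⟨W', E - W (m + 1), fun n => ?_, fun n => ?_, fun h => ?_, ?_⟩
  · rw [hW', hW', hW, Int.add_emod_right]
  · rw [hW', add_sub_cancel_left]
    split_ifs <;> simpa
  · rw [hT, hm, hm, h0, h1, h2, h]
    simp [Matrix.mul_apply, Fin.sum_univ_two]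
  · rw [hT, hm, hm, h0, h1, h2]
    simp [Matrix.vecMul, dotProduct, Matrix.mul_apply, Fin.sum_univ_two, trace_fin_two]
    ring

/-- The case where the monodromy matrix is upper triangular. -/
theorem exists_hyperbolic_of_upper {N : ℕ} (hN : 2 ≤ N) (hW : ∀ n, W (n + N) = W n)
    {ε : ℝ} (hε : 0 < ε) (h0 : monodromy W E N 0 1 0 = 0) :
    ∃ W' : ℤ → ℝ, (∀ n, W' (n + N) = W' n) ∧ (∀ n, |W' n - W n| ≤ ε) ∧
      2 < |(monodromy W' E N 0).trace| := by
  by_cases htr : 2 < |(monodromy W E N 0).trace|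
  · exact ⟨W, hW, fun n => by simpa using hε.le, htr⟩
  push Not at htr
  obtain ⟨T, hT⟩ : ∃ T, T = monodromy W E N 0 := ⟨_, rfl⟩
  have hdet : T.det = 1 := hT ▸ det_monodromy N 0
  rw [← hT] at htr h0
  rw [det_fin_two, h0, mul_zero, sub_zero] at hdet
  rw [trace_fin_two] at htr
  have had : T 0 0 = T 1 1 := by
    have : (T 0 0 + T 1 1) ^ 2 ≤ 2 ^ 2 := sq_le_sq' (abs_le.1 htr).1 (abs_le.1 htr).2
    nlinarith [sq_nonneg (T 0 0 - T 1 1)]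
  rw [← had] at hdet
  have ha : |T 0 0| = 1 := by
    rcases mul_self_eq_one_iff.1 hdet with h | h <;> simp [h]
  obtain ⟨s, hs, hs'⟩ : ∃ s : ℝ, |s| = ε ∧ 0 ≤ s * (T 0 0 * T 0 1) := by
    rcases le_total 0 (T 0 0 * T 0 1) with h | h
    · exact ⟨ε, abs_of_pos hε, mul_nonneg hε.le h⟩
    · exact ⟨-ε, by rw [abs_neg, abs_of_pos hε], by nlinarith⟩
  obtain ⟨W', x, hper, hdist, -, htrace⟩ := exists_trace_monodromy_perturb hN hW E (σ := -s)
    (σ' := s) (δ := ε) (by rw [abs_neg, hs]) hs.le hT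
  refine ⟨W', hper, hdist, ?_⟩
  have hss : s * s = ε * ε := by rw [← abs_mul_abs_self, hs]
  have : (monodromy W' E N 0).trace = T 0 0 * (2 + s * (T 0 0 * T 0 1) + s * s) := by
    rw [htrace, h0, ← had]
    linear_combination (-s * T 0 1) * hdet
  rw [this, abs_mul, ha, one_mul, hss, abs_of_pos (by positivity)]
  have := mul_pos hε hε
  linarith

/-- Powers of a matrix of determinant one and trace `2 cos φ`. -/
theorem sin_smul_pow {T : Matrix (Fin 2) (Fin 2) ℝ} (hT : T.det = 1) {φ : ℝ}
    (htr : T.trace = 2 * Real.cos φ) (m : ℕ) :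
    Real.sin φ • T ^ m = Real.sin (m * φ) • T - Real.sin ((m - 1) * φ) • 1 := by
  induction m with
  | zero => simp
  | succ m ih =>
    rw [pow_succ, ← smul_mul_assoc, ih, sub_mul, smul_mul_assoc, smul_mul_assoc, one_mul,
      mul_self_of_det_eq_one hT, htr]
    have h1 : Real.sin ((m + 1 : ℕ) * φ) = 2 * Real.cos φ * Real.sin (m * φ)
        - Real.sin ((m - 1) * φ) := by
      rw [Nat.cast_add_one, add_mul, sub_mul, one_mul, Real.sin_add, Real.sin_sub]; ring
    have h2 : ((m + 1 : ℕ) - 1 : ℝ) * φ = m * φ := by push_cast; ring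
    rw [h1, h2]
    module

theorem exists_rat_two_mul_cos_mem {lo hi : ℝ} (h : lo < hi) (hlo : -2 ≤ lo) (hhi : hi ≤ 2) :
    ∃ (m : ℕ) (φ : ℝ), 0 < m ∧ Real.sin (m * φ) = 0 ∧ 0 < Real.sin φ ∧
      2 * Real.cos φ ∈ Set.Ioo lo hi := by
  have hπ := Real.pi_pos
  have h1 : Real.arccos (hi / 2) < Real.arccos (lo / 2) :=
    Real.strictAntiOn_arccos ⟨by linarith, by linarith⟩ ⟨by linarith, by linarith⟩ (by linarith)
  obtain ⟨r, hr1, hr2⟩ := exists_rat_btwn (div_lt_div_of_pos_right h1 hπ)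
  rw [div_lt_iff₀ hπ] at hr1
  rw [lt_div_iff₀ hπ] at hr2
  have h0 : 0 < r * Real.pi := (Real.arccos_nonneg _).trans_lt hr1
  have h2 : r * Real.pi < Real.pi := hr2.trans_le (Real.arccos_le_pi _)
  refine ⟨r.den, r * Real.pi, r.den_pos, ?_, Real.sin_pos_of_pos_of_lt_pi h0 h2, ?_, ?_⟩
  · rw [← mul_assoc, ← Rat.cast_natCast, ← Rat.cast_mul, Rat.den_mul_eq_num, Rat.cast_intCast,
      Real.sin_int_mul_pi]
  · have := Real.cos_lt_cos_of_nonneg_of_le_pi h0.le (Real.arccos_le_pi _) hr2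
    rw [Real.cos_arccos (by linarith) (by linarith)] at this
    linarith
  · have := Real.cos_lt_cos_of_nonneg_of_le_pi (Real.arccos_nonneg _) h2.le hr1
    rw [Real.cos_arccos (by linarith) (by linarith)] at this
    linarith

/-- Any energy can be made hyperbolic by a small periodic perturbation, possibly after enlarging
the period. -/
theorem exists_hyperbolic {N : ℕ} (hN : 0 < N) (hW : ∀ n, W (n + N) = W n) (E : ℝ)
    {ε : ℝ} (hε : 0 < ε) :
    ∃ (W' : ℤ → ℝ) (N' : ℕ), 0 < N' ∧ (∀ n, W' (n + N') = W' n) ∧ (∀ n, |W' n - W n| ≤ ε) ∧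
      2 < |(monodromy W' E N' 0).trace| := by
  wlog hN2 : 2 ≤ N generalizing N
  · refine this (N := 2 * N) (by omega) (fun n => ?_) (by omega)
    rw [← hW n, ← hW (n + N)]; congr 1; push_cast; ring
  obtain ⟨T, hT⟩ : ∃ T, T = monodromy W E N 0 := ⟨_, rfl⟩
  by_cases h0 : T 1 0 = 0
  · obtain ⟨W', h1, h2, h3⟩ := exists_hyperbolic_of_upper hN2 hW hε (hT ▸ h0)
    exact ⟨W', N, hN, h1, h2, h3⟩
  by_cases hσ : ∃ σ : ℝ, |σ| ≤ ε / 2 ∧ 2 < |T 0 0 + T 1 1 - σ * T 1 0|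
  · obtain ⟨σ, hσ, htr⟩ := hσ
    obtain ⟨W', x, h1, h2, -, h3⟩ := exists_trace_monodromy_perturb hN2 hW E (σ := σ) (σ' := 0)
      (δ := ε) (by linarith) (by simpa using hε.le) hT
    exact ⟨W', N, hN, h1, h2, by rw [h3]; simpa using htr⟩
  push Not at hσ
  have hc := abs_pos.2 h0
  have habs : |ε / 2| ≤ ε / 2 := (abs_of_pos (by positivity)).le
  have habs' : |(-(ε / 2))| ≤ ε / 2 := by rwa [abs_neg]
  have hp := abs_le.1 (hσ _ habs)
  have hm := abs_le.1 (hσ _ habs')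
  have hlt : 0 < ε / 2 * |T 1 0| := by positivity
  obtain ⟨m, φ, hm0, hsin, hφ, hlo, hhi⟩ := exists_rat_two_mul_cos_mem
    (lo := T 0 0 + T 1 1 - ε / 2 * |T 1 0|) (hi := T 0 0 + T 1 1 + ε / 2 * |T 1 0|) (by linarith)
    (by cases abs_cases (T 1 0) <;> nlinarith) (by cases abs_cases (T 1 0) <;> nlinarith)
  obtain ⟨W₁, x, h1, h2, h3, h4⟩ := exists_trace_monodromy_perturb hN2 hW E
    (σ := (T 0 0 + T 1 1 - 2 * Real.cos φ) / T 1 0) (σ' := 0) (δ := ε / 2)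
    (by rw [abs_div, div_le_iff₀ hc]; exact abs_le.2 ⟨by linarith, by linarith⟩)
    (by simpa using (half_pos hε).le) hT
  have h5 : (monodromy W₁ E N 0).trace = 2 * Real.cos φ := by
    rw [h4, div_mul_cancel₀ _ h0]; ring
  have h6 : monodromy W₁ E (N * m) 0 1 0 = 0 := by
    rw [monodromy_mul h1]
    have := congrFun (congrFun (sin_smul_pow (det_monodromy N 0) h5 m) 1) 0
    rw [hsin] at this
    simpa [hφ.ne'] using this
  have hper : ∀ n, W₁ (n + (N * m : ℕ)) = W₁ n := fun n => by
    clear h6 hm0 hsin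
    induction m with
    | zero => simp
    | succ m ih => rw [← ih, ← h1 (n + (N * m : ℕ))]; congr 1; push_cast; ring
  obtain ⟨W', h7, h8, h9⟩ := exists_hyperbolic_of_upper
    (hN2.trans (Nat.le_mul_of_pos_right N hm0)) hper (half_pos hε) h6
  refine ⟨W', N * m, by positivity, h7, fun n => ?_, h9⟩
  have := abs_sub_le (W' n) (W₁ n) (W n)
  linarith [h2 n, h8 n]

end OpeningGaps

section Initial

/-! ### The initial periodic potential -/

open Filter Topology

theorem Gap.of_dist {U : ℤ → ℝ} {E E' ρ : ℝ} (h : Gap U E ρ) (hE : |E' - E| ≤ ρ / 2) :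
    Gap U E' (ρ / 2) := fun a b w hw => by
  have h1 := h a b w hw
  have h2 : ham U w - E • w = ham U w - E' • w + (E' - E) • w := by rw [sub_smul]; abel
  have h3 : ‖(E' - E) • w‖ ≤ ρ / 2 * ‖w‖ := by
    rw [norm_smul, Real.norm_eq_abs]; gcongr
  rw [h2] at h1
  linarith [norm_add_le (ham U w - E' • w) ((E' - E) • w)]

theorem gap_of_le_abs {U : ℤ → ℝ} {B E : ℝ} (hU : ∀ n, |U n| ≤ B) (hE : B + 3 ≤ |E|) :
    Gap U E 1 := fun a b w _ => by
  have h1 : |E| * ‖w‖ = ‖E • w‖ := by rw [norm_smul, Real.norm_eq_abs]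
  have h2 := norm_sub_norm_le (E • w) (ham U w)
  rw [norm_sub_rev, ← h1] at h2
  have h3 := norm_ham_le hU w
  nlinarith [norm_nonneg w]

/-- Finitely many small periodic perturbations whose gaps cover all energies. -/
theorem exists_gap_family {W : ℤ → ℝ} {N : ℕ} (hN : 0 < N) (hW : ∀ n, W (n + N) = W n)
    {B : ℝ} (hB : ∀ n, |W n| ≤ B) {ε : ℝ} (hε : 0 < ε) :
    ∃ (r : ℕ) (Ws : ℕ → ℤ → ℝ) (ρ : ℝ), 0 < r ∧ 0 < ρ ∧ ρ ≤ 1 ∧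
      (∀ i n, |Ws i n - W n| ≤ ε) ∧
      ∀ E, ∃ i < r, Gap (Ws i) E ρ := by
  choose We Ne hNe hper hdist htr using fun E => exists_hyperbolic hN hW E hε
  have hbd : ∀ E n, |We E n| ≤ B + ε := fun E n => by
    have := abs_sub_abs_le_abs_sub (We E n) (W n)
    linarith [hdist E n, hB n]
  choose ρe hρe hgap using fun E => exists_gap_of_trace (hper E) (hbd E) (htr E)
  obtain ⟨t, -, ht⟩ := (isCompact_Icc (a := -(B + ε + 3)) (b := B + ε + 3)).elim_nhds_subcover
    (fun E => Metric.closedBall E (ρe E / 2))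
    fun E _ => Metric.closedBall_mem_nhds E (half_pos (hρe E))
  set t' := insert 0 t with ht'
  have hne : t'.Nonempty := ⟨0, Finset.mem_insert_self _ _⟩
  set e : ℕ → ℝ := fun i => t'.toList.getD i 0 with he
  have hcov : ∀ E ∈ t', ∃ i < t'.card, e i = E := fun E hE => by
    obtain ⟨i, hi, rfl⟩ := List.getElem_of_mem (Finset.mem_toList.2 hE)
    exact ⟨i, by rwa [Finset.length_toList] at hi, List.getD_eq_getElem _ _ hi⟩
  set ρ := min 1 (t'.inf' hne fun E => ρe E / 2) with hρ
  have hρ' : ∀ E ∈ t', ρ ≤ ρe E / 2 := fun E hE =>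
    (min_le_right _ _).trans (Finset.inf'_le (fun E => ρe E / 2) hE)
  refine ⟨t'.card, fun i => We (e i), ρ, hne.card_pos,
    lt_min one_pos ((Finset.lt_inf'_iff _).2 fun E _ => half_pos (hρe E)), min_le_left _ _,
    fun i => hdist _, fun E => ?_⟩
  rcases le_total (B + ε + 3) |E| with hE | hE
  · obtain ⟨i, hi, -⟩ := hcov 0 (Finset.mem_insert_self _ _)
    exact ⟨i, hi, (gap_of_le_abs (hbd _) hE).mono (min_le_left _ _)⟩
  · obtain ⟨E₀, hE₀, hd⟩ := Set.mem_iUnion₂.1 (ht (abs_le.1 hE))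
    have hE₀' : E₀ ∈ t' := Finset.mem_insert_of_mem hE₀
    obtain ⟨i, hi, rfl⟩ := hcov E₀ hE₀'
    exact ⟨i, hi, ((hgap _).of_dist (by simpa [Real.dist_eq] using hd)).mono (hρ' _ hE₀')⟩

theorem eventually_exp_mul_le {c C : ℝ} (hc : 0 < c) (hC : 0 < C) (n : ℕ) :
    ∀ᶠ m : ℕ in atTop, 20 * Real.exp (-(c * m)) ≤ (C * m)⁻¹ ^ n := by
  have h1 : Tendsto (fun m : ℕ => c * (m : ℝ)) atTop atTop :=
    tendsto_natCast_atTop_atTop.const_mul_atTop hc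
  have h2 := (Real.tendsto_pow_mul_exp_neg_atTop_nhds_zero n).comp h1
  have h3 : 0 < (c / C) ^ n / 20 := by positivity
  filter_upwards [h2.eventually (ge_mem_nhds h3), eventually_gt_atTop 0] with m hm hm0
  have hm1 : (0 : ℝ) < m := by exact_mod_cast hm0
  simp only [Function.comp] at hm
  have h4 : (c * m) ^ n = (c / C) ^ n * (C * m) ^ n := by
    rw [← mul_pow]; congr 1; field_simp
  have h5 : 0 < (c / C) ^ n := by positivity
  rw [h4, le_div_iff₀ (by norm_num)] at hm
  rw [inv_pow, ← one_div, le_div_iff₀ (by positivity)]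
  nlinarith

/-- A small perturbation of a periodic potential, of large period and with thin spectrum. -/
theorem exists_thin_periodic {W : ℤ → ℝ} {N : ℕ} (hN : 0 < N) (hW : ∀ n, W (n + N) = W n)
    {B : ℝ} (hB : ∀ n, |W n| ≤ B) {ε : ℝ} (hε : 0 < ε) :
    ∃ᶠ p : ℕ in atTop, ∃ V : ℤ → ℝ, (∀ n, |V n - W n| ≤ ε) ∧ (∀ n (k : ℤ), V (n + k * p) = V n) ∧
      ∃ S : Finset ℝ, S.card ≤ p ^ 2 ∧ Thin V p S := by
  rw [frequently_atTop]
  intro p₀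
  obtain ⟨r, Ws, ρ, hr, hρ, hρ1, hWs, hcov⟩ := exists_gap_family hN hW hB hε
  have hrR : (0 : ℝ) < r := by exact_mod_cast hr
  have hNR : (0 : ℝ) < N := by exact_mod_cast hN
  obtain ⟨m, hexp, hm0, hmp, hmρ⟩ := ((eventually_exp_mul_le (c := ρ * N / 8) (C := r * (3 * N))
    (by positivity) (by positivity) 10).and ((eventually_gt_atTop 0).and
    ((eventually_ge_atTop p₀).and (tendsto_natCast_atTop_atTop.eventually_ge_atTop (20 / ρ))))).exists
  obtain ⟨l, hl⟩ : ∃ l, l = m * N := ⟨_, rfl⟩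
  have hl0 : 0 < l := hl ▸ by positivity
  obtain ⟨p, hp⟩ : ∃ p, p = r * (3 * l) := ⟨_, rfl⟩
  have h3l : 3 * l ≤ p := hp ▸ Nat.le_mul_of_pos_left _ hr
  have hml : m ≤ l := hl ▸ Nat.le_mul_of_pos_right _ hN
  have hrp : r ≤ p := hp ▸ Nat.le_mul_of_pos_right _ (by omega)
  have hpR : (0 : ℝ) < p := by exact_mod_cast (by omega : 0 < p)
  obtain ⟨U, hU⟩ : ∃ U : ℤ → ℝ, ∀ n, U n = Ws (n / (3 * l : ℕ)).toNat n := ⟨_, fun _ => rfl⟩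
  have hdist : ∀ n, |periodize 0 p U n - W n| ≤ ε := abs_periodize_sub_le (fun n k => by
    rw [← Function.Periodic.int_mul (f := W) (c := N) hW (k * (r * 3 * m)) n, hp, hl]
    congr 1; push_cast; ring)
    fun n => by rw [hU]; exact hWs _ _
  have hbd : ∀ {V : ℤ → ℝ}, (∀ n, |V n - W n| ≤ ε) → ∀ n, |V n| ≤ B + ε := fun {V} h n => by
    have := abs_sub_abs_le_abs_sub (V n) (W n)
    linarith [h n, hB n]
  set zs : Finset ℤ := (Finset.range r).image fun i : ℕ => (i : ℤ) * (3 * l) + l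
  have hg : ∀ E, ∃ z ∈ zs, GapOn (periodize 0 p U) (Set.Ioo (z - l) (z + l)) E ρ := fun E => by
    obtain ⟨i, hi, hgap⟩ := hcov E
    refine ⟨(i : ℤ) * (3 * l) + l, Finset.mem_image_of_mem _ (Finset.mem_range.2 hi),
      GapOn.congr (hbd (hWs i)) (hbd hdist) (fun n hn => ?_)
        ((hgap (i * (3 * l)) (i * (3 * l) + 3 * l)).mono (fun n hn => ?_) le_rfl)⟩
    · obtain ⟨h1, h2⟩ := hn
      have h3 : (i + 1 : ℤ) * (3 * l) ≤ r * (3 * l) :=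
        mul_le_mul_of_nonneg_right (by exact_mod_cast hi) (by positivity)
      have h4 : 0 ≤ (i : ℤ) * (3 * l) := by positivity
      have h5 : (p : ℤ) = r * (3 * l) := by rw [hp]; push_cast; rfl
      rw [periodize_of_mem (by linarith) (by linarith), hU]
      have h6 : n / (3 * l : ℕ) = i := by
        refine Int.ediv_eq_iff_of_pos (by positivity) |>.2 ⟨?_, ?_⟩ <;> push_cast <;> linarith
      rw [h6, Int.toNat_natCast]
    · obtain ⟨h1, h2⟩ := hn
      exact ⟨by linarith, by linarith⟩
  have hβ : 24 * (4 * Real.exp (-(ρ * (l : ℤ) / 8))) ^ 2 ≤ ((p : ℝ)⁻¹ ^ 10) ^ 2 := by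
    have h1 : (p : ℝ) = r * (3 * N) * m := by rw [hp, hl]; push_cast; ring
    have h2 : ρ * ((l : ℤ) : ℝ) / 8 = ρ * N / 8 * m := by rw [hl]; push_cast; ring
    rw [← h1, ← h2] at hexp
    have h3 := pow_le_pow_left₀ (by positivity) hexp 2
    nlinarith [sq_nonneg (Real.exp (-(ρ * (l : ℤ) / 8)))]
  obtain ⟨S, hS, hthin⟩ := exists_thin (hbd hdist) (N := p)
    (fun n => by simpa using periodize_add 0 p U n 1) zs (l := l) (by omega) (by omega) hρ hρ1
    (d₀ := (p : ℝ)⁻¹ ^ 10) (by positivity) hg hβ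
  refine ⟨p, by omega, periodize 0 p U, hdist, periodize_add 0 p U, S, ?_, fun E d hd hdS => ?_⟩
  · have : zs.card ≤ r := Finset.card_image_le.trans (Finset.card_range r).le
    rw [sq]
    exact hS.trans (Nat.mul_le_mul_right _ (this.trans hrp))
  · refine (hthin E d hd hdS).mono ?_
    have h1 : (20 : ℝ) / ρ ≤ p := hmρ.trans (by exact_mod_cast (by omega : m ≤ p))
    have h2 : (p : ℝ)⁻¹ ≤ ρ / 20 := by
      rw [inv_le_comm₀ hpR (by positivity), inv_div]; exact h1
    have h3 : 0 ≤ d := le_trans (by positivity) hd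
    rw [mul_div_assoc]
    gcongr

theorem _root_.IsPeriodicPotential.exists_bound {W : ℤ → ℝ} (hW : IsPeriodicPotential W) :
    ∃ B, ∀ n, |W n| ≤ B := by
  obtain ⟨N, hN, hper⟩ := hW
  have hN' : (0 : ℤ) < N := by exact_mod_cast hN
  obtain ⟨B, hB⟩ := ((Set.finite_Ico (0 : ℤ) N).image fun n => |W n|).bddAbove
  refine ⟨B, fun n => ?_⟩
  have h := Function.Periodic.int_mul (f := W) (c := N) hper (n / N) (n % N)
  rw [Int.cast_id, mul_comm, Int.emod_add_mul_ediv] at h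
  rw [h]
  exact hB ⟨_, ⟨Int.emod_nonneg _ hN'.ne', Int.emod_lt_of_pos _ hN'⟩, rfl⟩

theorem exists_limitPeriodic_hasPurePointSpectrum (V : ℤ → ℝ) (hV : IsLimitPeriodic V)
    (ε : ℝ) (hε : 0 < ε) :
    ∃ V' : ℤ → ℝ, IsLimitPeriodic V' ∧
      (∃ C : ℝ, C < ε ∧ ∀ n : ℤ, |V n - V' n| ≤ C) ∧
      HasPurePointSpectrum V' := by
  have hε4 : 0 < ε / 4 := by positivity
  obtain ⟨W, hWper, hVW⟩ := hV (ε / 4) hε4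
  obtain ⟨B, hB⟩ := hWper.exists_bound
  obtain ⟨N, hN, hW⟩ := hWper
  obtain ⟨p₀, hp₀⟩ := exists_large (B + ε / 4 + 1)
  have hinv : ∀ᶠ p : ℕ in atTop, 2 * (p : ℝ)⁻¹ ≤ min 1 (ε / 4) := by
    have h : Tendsto (fun p : ℕ => 2 * (p : ℝ)⁻¹) atTop (𝓝 0) := by
      simpa using (tendsto_inv_atTop_nhds_zero_nat (𝕜 := ℝ)).const_mul 2
    exact h.eventually (ge_mem_nhds (by positivity))
  obtain ⟨p, ⟨V₁, hdist, hper, hthin⟩, hp, hpε⟩ :=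
    ((exists_thin_periodic hN hW hB hε4).and_eventually
      ((eventually_ge_atTop p₀).and hinv)).exists
  obtain ⟨hp1, hpε⟩ := le_min_iff.1 hpε
  have hstage : Stage (B + ε / 4 + 1) p V₁ 0 (fun _ => ∅) 0 :=
    { bound := fun n => by
        have := abs_sub_abs_le_abs_sub (V₁ n) (W n)
        linarith [hdist n, hB n]
      per := hper
      thin := hthin
      good := fun j hj => absurd hj (Nat.not_lt_zero j)
      card := by simp }
  obtain ⟨P, Ws, X, C, h, rfl, rfl⟩ := exists_tower hp₀ hp hstage
  obtain ⟨U, hU, hUW⟩ := h.exists_limit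
  refine ⟨U, h.isLimitPeriodic hUW, ⟨3 * (ε / 4), by linarith, fun n => ?_⟩,
    h.hasPurePointSpectrum hU⟩
  have h1 := abs_sub_le (V n) (W n) (U n)
  have h2 := abs_sub_le (W n) (Ws 0 n) (U n)
  have h3 := hUW 0 n
  have h4 := hdist n
  rw [abs_sub_comm] at h3 h4
  linarith [hVW n]

end Initial

end L2Z

/-- For every limit-periodic `V` and every `ε > 0` there is a limit-periodic `V'` with
`‖V - V'‖_∞ < ε` such that the Schrödinger operator with potential `V'` has
pure point spectrum. -/
theorem dense_purePoint_limitPeriodic (V : ℤ → ℝ) (hV : IsLimitPeriodic V)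
    (ε : ℝ) (hε : 0 < ε) :
    ∃ V' : ℤ → ℝ, IsLimitPeriodic V' ∧
      (∃ C : ℝ, C < ε ∧ ∀ n : ℤ, |V n - V' n| ≤ C) ∧
      HasPurePointSpectrum V' :=
  L2Z.exists_limitPeriodic_hasPurePointSpectrum V hV ε hε
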